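/- Let Q be a finite, connected, acyclic quiver and let ℰ = (ε₁, …, ε_N) be a quiver exceptional sequence for Q. Let Q(ℰ) be the quiver with vertex set {1, …, N} and −⟨ε_i, ε_j⟩ arrows from vertex i to vertex j for all i ≠ j, and let I : ℝ^N → ℝ^{Q₀} be given by I(γ₁,…,γ_N) = Σ_{i=1}^N γ_i ε_i. Then for any two dimension vectors α and β of Q(ℰ), one has (α∘β)_{Q(ℰ)} = (I(α)∘I(β))_Q. -/

import Mathlib

/-- A finite quiver: finite sets of vertices and arrows with tail and head maps. -/
structure FinQuiver where
  V : Type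
  A : Type
  [instFinV : Fintype V]
  [instDecV : DecidableEq V]
  [instFinA : Fintype A]
  [instDecA : DecidableEq A]
  t : A → V
  h : A → V

attribute [instance] FinQuiver.instFinV FinQuiver.instDecV FinQuiver.instFinA FinQuiver.instDecA

/-- Coerce an `ℕ`-valued function (dimension vector) to a `ℤ`-valued one. -/
def natToInt {X : Type} (α : X → ℕ) : X → ℤ := fun x => (α x : ℤ)

namespace FinQuiver

variable (Q : FinQuiver)

/-- `Q` has an oriented cycle. -/
def HasCycle : Prop :=
  ∃ k : ℕ, ∃ c : Fin (k + 1) → Q.A, ∀ i : Fin (k + 1), Q.h (c i) = Q.t (c (i + 1))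

/-- `Q` is acyclic: it has no oriented cycles. -/
def Acyclic : Prop := ¬ Q.HasCycle

/-- Two vertices are adjacent if some arrow joins them (in either direction). -/
def Adj (u v : Q.V) : Prop :=
  ∃ a : Q.A, (Q.t a = u ∧ Q.h a = v) ∨ (Q.t a = v ∧ Q.h a = u)

/-- `Q` is connected as an undirected graph. -/
def Connected : Prop := ∀ u v : Q.V, Relation.ReflTransGen Q.Adj u v

/-- The representation space `rep(Q, β)`. -/
def Rep (β : Q.V → ℕ) : Type :=
  ∀ a : Q.A, Matrix (Fin (β (Q.h a))) (Fin (β (Q.t a))) ℂ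

/-- The group `GL(β) = ∏ₓ GL(β(x), ℂ)`. -/
def GLb (β : Q.V → ℕ) : Type :=
  ∀ x : Q.V, (Matrix (Fin (β x)) (Fin (β x)) ℂ)ˣ

/-- The action of `g⁻¹ ∈ GL(β)` on `W ∈ rep(Q,β)`: `(g⁻¹ · W)ₐ = g_{ha}⁻¹ Wₐ g_{ta}`. -/
noncomputable def invAct {β : Q.V → ℕ} (g : Q.GLb β) (W : Q.Rep β) : Q.Rep β :=
  fun a => ((g (Q.h a))⁻¹).val * W a * (g (Q.t a)).val

/-- `f : rep(Q,β) → ℂ` is a polynomial function of the matrix entries. -/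
def IsPolyFun {β : Q.V → ℕ} (f : Q.Rep β → ℂ) : Prop :=
  ∃ P : MvPolynomial ((a : Q.A) × (Fin (β (Q.h a)) × Fin (β (Q.t a)))) ℂ,
    ∀ W : Q.Rep β, f W = MvPolynomial.eval (fun i => W i.1 i.2.1 i.2.2) P

/-- The character `∏ₓ det(gₓ)^{σ(x)}` of `GL(β)` attached to an integral weight `σ`. -/
noncomputable def detWeight {β : Q.V → ℕ} (σ : Q.V → ℤ) (g : Q.GLb β) : ℂ :=
  ∏ x : Q.V, (Matrix.det (g x).val) ^ (σ x)

/-- The space `SI(Q,β)_σ` of semi-invariants of weight `σ`: polynomial functions `f` on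
`rep(Q,β)` with `f(g⁻¹ · W) = (∏ₓ det(gₓ)^{σ(x)}) f(W)` for all `g ∈ GL(β)`. -/
noncomputable def SIw (β : Q.V → ℕ) (σ : Q.V → ℤ) : Submodule ℂ (Q.Rep β → ℂ) where
  carrier := {f | Q.IsPolyFun f ∧
    ∀ (g : Q.GLb β) (W : Q.Rep β), f (Q.invAct g W) = Q.detWeight σ g * f W}
  add_mem' := by
    rintro f₁ f₂ ⟨⟨P₁, hP₁⟩, h₁⟩ ⟨⟨P₂, hP₂⟩, h₂⟩
    refine ⟨⟨P₁ + P₂, fun W => ?_⟩, fun g W => ?_⟩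
    · simp [Pi.add_apply, hP₁ W, hP₂ W]
    · simp only [Pi.add_apply, h₁ g W, h₂ g W]; ring
  zero_mem' := by
    refine ⟨⟨0, fun W => ?_⟩, fun g W => ?_⟩ <;> simp
  smul_mem' := by
    rintro c f ⟨⟨P, hP⟩, hf⟩
    refine ⟨⟨MvPolynomial.C c * P, fun W => ?_⟩, fun g W => ?_⟩
    · simp [Pi.smul_apply, hP W, smul_eq_mul]
    · simp only [Pi.smul_apply, hf g W, smul_eq_mul]; ring

/-- The dimension of the weight space of semi-invariants `SI(Q,β)_σ`. -/
noncomputable def siDim (β : Q.V → ℕ) (σ : Q.V → ℤ) : ℕ :=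
  Module.finrank ℂ (Q.SIw β σ)

/-- The Euler (Ringel) form of `Q`. -/
def euler (α γ : Q.V → ℤ) : ℤ :=
  (∑ x : Q.V, α x * γ x) - ∑ a : Q.A, α (Q.t a) * γ (Q.h a)

/-- The weight `⟨α, ·⟩ : x ↦ ⟨α, eₓ⟩` attached to a dimension vector `α`. -/
def weightOf (α : Q.V → ℕ) : Q.V → ℤ :=
  fun x => (α x : ℤ) - ∑ a : Q.A, (if Q.h a = x then (α (Q.t a) : ℤ) else 0)

/-- `(α ∘ β)_Q := dim SI(Q,β)_{⟨α,·⟩}`. -/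
noncomputable def circ (α β : Q.V → ℕ) : ℕ := Q.siDim β (Q.weightOf α)

/-- `φ` is a morphism of representations `V → W`. -/
def IsHom {α γ : Q.V → ℕ} (V : Q.Rep α) (W : Q.Rep γ)
    (φ : ∀ x : Q.V, Matrix (Fin (γ x)) (Fin (α x)) ℂ) : Prop :=
  ∀ a : Q.A, φ (Q.h a) * V a = W a * φ (Q.t a)

/-- The space `Hom_Q(V, W)` of morphisms of representations. -/
noncomputable def homSpace {α γ : Q.V → ℕ} (V : Q.Rep α) (W : Q.Rep γ) :
    Submodule ℂ (∀ x : Q.V, Matrix (Fin (γ x)) (Fin (α x)) ℂ) where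
  carrier := {φ | Q.IsHom V W φ}
  add_mem' := by
    intro φ ψ hφ hψ a
    simp only [Pi.add_apply, Matrix.add_mul, Matrix.mul_add, hφ a, hψ a]
  zero_mem' := by
    intro a
    simp
  smul_mem' := by
    intro c φ hφ a
    simp only [Pi.smul_apply, Matrix.smul_mul, Matrix.mul_smul, hφ a]

/-- A representation is Schur if its endomorphism algebra is one-dimensional. -/
def IsSchur {α : Q.V → ℕ} (V : Q.Rep α) : Prop :=
  Module.finrank ℂ (Q.homSpace V V) = 1

/-- A quiver exceptional sequence of dimension vectors. -/
def IsExcSeq {Nn : ℕ} (ε : Fin Nn → (Q.V → ℕ)) : Prop :=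
  (∀ i, Q.euler (natToInt (ε i)) (natToInt (ε i)) = 1 ∧ ∃ V : Q.Rep (ε i), Q.IsSchur V) ∧
  ∀ i j : Fin Nn, i < j →
    Q.euler (natToInt (ε i)) (natToInt (ε j)) ≤ 0 ∧ Q.circ (ε j) (ε i) ≠ 0

/-- The quiver `Q(ℰ)` attached to a sequence `ℰ = (ε₁,…,ε_N)` of dimension vectors:
vertices `1,…,N` and `−⟨εᵢ, εⱼ⟩` arrows from `i` to `j` for `i ≠ j`. -/
def quiverOfSeq {Nn : ℕ} (ε : Fin Nn → (Q.V → ℕ)) : FinQuiver where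
  V := Fin Nn
  A := (i : Fin Nn) × (j : Fin Nn) ×
        Fin (if i = j then 0 else (-(Q.euler (natToInt (ε i)) (natToInt (ε j)))).toNat)
  t := fun a => a.1
  h := fun a => a.2.1

end FinQuiver

/-- An isomorphism of quivers. -/
structure QuiverIso (Q₁ Q₂ : FinQuiver) where
  vEquiv : Q₁.V ≃ Q₂.V
  aEquiv : Q₁.A ≃ Q₂.A
  t_comm : ∀ a : Q₁.A, Q₂.t (aEquiv a) = vEquiv (Q₁.t a)
  h_comm : ∀ a : Q₁.A, Q₂.h (aEquiv a) = vEquiv (Q₁.h a)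

/-- The `p`-complete bipartite quiver `Q^p_{m,n}`: sources `x₁,…,x_m`, sinks `y₁,…,y_n`,
and `p` arrows from each `xᵢ` to each `yⱼ`. -/
def Qpmn (m n p : ℕ) : FinQuiver where
  V := Fin m ⊕ Fin n
  A := Fin m × Fin n × Fin p
  t := fun a => Sum.inl a.1
  h := fun a => Sum.inr a.2.1

/-- The number `T_{a,b}` of 3-way contingency tables of size `m × n × p` with the two
plane-sum margins fixed by `a` and `b`. -/
noncomputable def numTables (m n p : ℕ) (a : Fin m → ℕ) (b : Fin n → ℕ) : ℕ :=
  Nat.card {x : Fin m × Fin n × Fin p → ℕ //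
    (∀ i : Fin m, ∑ j : Fin n, ∑ k : Fin p, x (i, j, k) = a i) ∧
    (∀ j : Fin n, ∑ i : Fin m, ∑ k : Fin p, x (i, j, k) = b j)}

/-- The weight `θ_{a,b}` of `Q^p_{m,n}`. -/
def thetaAB {m n : ℕ} (a : Fin m → ℕ) (b : Fin n → ℕ) : Fin m ⊕ Fin n → ℤ :=
  Sum.elim (fun i => (a i : ℤ)) (fun j => -(b j : ℤ))


namespace EmbThm
open Finset

/-- inclusion-exclusion indicator -/
theorem sum_sign_subset {n : Type*} [Fintype n] [DecidableEq n] (T : Finset n) :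
    ∑ S : Finset n, (-1 : ℂ) ^ (Sᶜ).card * (if T ⊆ S then 1 else 0) = if T = univ then 1 else 0 := by
  have h1 : ∑ S : Finset n, (-1 : ℂ) ^ (Sᶜ).card * (if T ⊆ S then 1 else 0)
      = ∑ S : Finset n, (-1 : ℂ) ^ S.card * (if S ⊆ Tᶜ then 1 else 0) := by
    refine Fintype.sum_bijective (fun S : Finset n => Sᶜ) compl_bijective _ _ (fun S => ?_)
    simp only [Finset.compl_subset_compl]
  rw [h1]
  have h2 : ∑ S : Finset n, (-1 : ℂ) ^ S.card * (if S ⊆ Tᶜ then 1 else 0)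
      = ∑ S ∈ (Tᶜ).powerset, (-1 : ℂ) ^ S.card := by
    simp only [mul_ite, mul_one, mul_zero]
    rw [← Finset.sum_filter]
    congr 1
    ext S; simp
  rw [h2]
  have h3 := Finset.sum_powerset_neg_one_pow_card (x := Tᶜ)
  have h4 : ∑ S ∈ (Tᶜ).powerset, (-1 : ℂ) ^ S.card
      = ((∑ S ∈ (Tᶜ).powerset, (-1 : ℤ) ^ S.card : ℤ) : ℂ) := by push_cast; rfl
  rw [h4, h3]
  simp

theorem ryser {n : Type*} [Fintype n] [DecidableEq n] (y : n → n → ℂ) :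
    ∑ S : Finset n, (-1 : ℂ) ^ (Sᶜ).card * ∏ p, ∑ r ∈ S, y p r
      = ∑ θ : Equiv.Perm n, ∏ p, y p (θ p) := by
  have h1 : ∀ S : Finset n, ∏ p, ∑ r ∈ S, y p r
      = ∑ f : n → n, (if univ.image f ⊆ S then 1 else 0) * ∏ p, y p (f p) := by
    intro S
    have : ∀ p, ∑ r ∈ S, y p r = ∑ r, (if r ∈ S then y p r else 0) := by
      intro p; simp
    simp only [this]
    rw [Fintype.prod_sum]
    refine Finset.sum_congr rfl (fun f _ => ?_)
    by_cases hf : univ.image f ⊆ S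
    · rw [if_pos hf, one_mul]
      refine Finset.prod_congr rfl (fun p _ => ?_)
      rw [if_pos]
      exact hf (mem_image_of_mem _ (mem_univ _))
    · rw [if_neg hf, zero_mul]
      have : ∃ p, f p ∉ S := by
        by_contra! hh
        apply hf
        intro x hx
        obtain ⟨p, _, rfl⟩ := mem_image.1 hx
        exact hh p
      obtain ⟨p, hp⟩ := this
      exact Finset.prod_eq_zero (mem_univ p) (if_neg hp)
  simp only [h1, Finset.mul_sum, ← mul_assoc]
  rw [Finset.sum_comm]
  simp only [← Finset.sum_mul, sum_sign_subset]
  rw [show ∑ f : n → n, (if univ.image f = univ then (1:ℂ) else 0) * ∏ p, y p (f p)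
      = ∑ f ∈ univ.filter (fun f : n → n => Function.Bijective f), ∏ p, y p (f p) by
    rw [Finset.sum_filter]
    refine Finset.sum_congr rfl (fun f _ => ?_)
    have : (univ.image f = univ) ↔ Function.Bijective f := by
      rw [← Finset.coe_inj, Finset.coe_image, Finset.coe_univ, Set.image_univ, Set.range_eq_univ]
      exact Finite.surjective_iff_bijective
    by_cases h : Function.Bijective f
    · rw [if_pos (this.2 h), if_pos h, one_mul]
    · rw [if_neg (fun hh => h (this.1 hh)), if_neg h, zero_mul]]
  symm
  refine Finset.sum_bij (fun θ _ => (θ : n → n)) ?_ ?_ ?_ ?_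
  · intro θ _; exact mem_filter.2 ⟨mem_univ _, θ.bijective⟩
  · intro a _ b _ h; exact Equiv.coe_fn_injective h
  · intro f hf
    exact ⟨Equiv.ofBijective f (mem_filter.1 hf).2, mem_univ _, rfl⟩
  · intro θ _; rfl

/-- signed weight of a permutation preserving blocks -/
noncomputable def sgnw {n Bl : Type*} [Fintype n] [DecidableEq n] [DecidableEq Bl] (b : n → Bl)
    (π : Equiv.Perm n) : ℂ :=
  ((Equiv.Perm.sign π : ℤ) : ℂ) * ∏ p, (if b (π p) = b p then 1 else 0)

/-- block determinant -/
noncomputable def chi {n Bl K : Type*} [Fintype n] [DecidableEq n] [DecidableEq Bl] (b : n → Bl)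
    (k : n → K) (h : Matrix K K ℂ) : ℂ :=
  Matrix.det (Matrix.of fun p q => (if b p = b q then (1:ℂ) else 0) * h (k p) (k q))

theorem chi_eq {n Bl K : Type*} [Fintype n] [DecidableEq n] [DecidableEq Bl] (b : n → Bl)
    (k : n → K) (h : Matrix K K ℂ) :
    chi b k h = ∑ ρ : Equiv.Perm n, sgnw b ρ * ∏ p, h (k p) (k (ρ p)) := by
  unfold chi sgnw
  rw [← Matrix.det_transpose, Matrix.det_apply']
  refine Finset.sum_congr rfl (fun ρ _ => ?_)
  simp only [Matrix.transpose_apply, Matrix.of_apply, Finset.prod_mul_distrib]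
  simp only [eq_comm (a := b (ρ _)), mul_assoc]

theorem chi_eq' {n Bl K : Type*} [Fintype n] [DecidableEq n] [DecidableEq Bl] (b : n → Bl)
    (k : n → K) (h : Matrix K K ℂ) :
    chi b k h = ∑ ρ : Equiv.Perm n, sgnw b ρ * ∏ p, h (k (ρ p)) (k p) := by
  unfold chi sgnw
  rw [Matrix.det_apply']
  refine Finset.sum_congr rfl (fun ρ _ => ?_)
  simp only [Matrix.of_apply, Finset.prod_mul_distrib, mul_assoc]

theorem chi_one {n Bl K : Type*} [Fintype n] [DecidableEq n] [DecidableEq Bl] [DecidableEq K]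
    (b : n → Bl) (k : n → K) (hinj : ∀ p q, b p = b q → k p = k q → p = q) :
    chi b k 1 = 1 := by
  unfold chi
  rw [show (Matrix.of fun p q => (if b p = b q then (1:ℂ) else 0) * (1 : Matrix K K ℂ) (k p) (k q))
    = 1 by
      ext p q
      by_cases h : p = q
      · subst h; simp
      · rw [Matrix.one_apply_ne h, Matrix.of_apply]
        by_cases hb : b p = b q
        · rw [Matrix.one_apply_ne (fun hk => h (hinj p q hb hk)), mul_zero]
        · rw [if_neg hb, zero_mul]]
  exact Matrix.det_one

/-- the normalisation constant -/
noncomputable def cC {n Bl K : Type*} [Fintype n] [DecidableEq n] [DecidableEq Bl] [DecidableEq K]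
    (b : n → Bl) (k : n → K) : ℂ :=
  ∑ π : Equiv.Perm n, sgnw b π * ∑ ρ : Equiv.Perm n, sgnw b ρ * ∑ τ : Equiv.Perm n,
    ∏ p, ((if k (τ p) = k p then 1 else 0) * (if k (π (τ p)) = k (ρ p) then 1 else 0))

theorem cC_ne_zero {n Bl K : Type*} [Fintype n] [DecidableEq n] [DecidableEq Bl] [DecidableEq K]
    [Fintype K] (b : n → Bl) (k : n → K) (hinj : ∀ p q, b p = b q → k p = k q → p = q) :
    cC b k ≠ 0 := by
  classical
  -- integer weights
  let s : Equiv.Perm n → ℤ := fun π => (Equiv.Perm.sign π : ℤ) * ∏ p, (if b (π p) = b p then 1 else 0)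
  have hs : ∀ π, sgnw b π = (s π : ℂ) := by
    intro π; simp [s, sgnw]
  let bb : (n → K × K) → ℤ := fun w => ∑ π : Equiv.Perm n, s π * ∑ τ : Equiv.Perm n,
    (if (fun p => (k (τ p), k (π (τ p)))) = w then 1 else 0)
  have ind : ∀ u v : n → K × K, ∑ w, (if u = w then (1:ℤ) else 0) * (if v = w then 1 else 0)
      = ∏ p, ((if (u p).1 = (v p).1 then 1 else 0) * (if (u p).2 = (v p).2 then 1 else 0)) := by
    intro u v
    simp only [ite_mul, one_mul, zero_mul, Finset.sum_ite_eq, Finset.mem_univ, if_true]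
    by_cases h : v = u
    · subst h; simp
    · rw [if_neg h]
      have : ∃ p, v p ≠ u p := by by_contra! hh; exact h (funext hh)
      obtain ⟨p, hp⟩ := this
      symm
      apply Finset.prod_eq_zero (mem_univ p)
      by_cases h1 : (u p).1 = (v p).1
      · have h2 : (u p).2 ≠ (v p).2 := fun h2 => hp (Prod.ext h1.symm h2.symm)
        simp [h2]
      · simp [h1]
  have key : ((∑ _τ : Equiv.Perm n, (1:ℂ)) * cC b k) = ((∑ w, bb w ^ 2 : ℤ) : ℂ) := by
    have e1 : ∀ w, bb w ^ 2 = ∑ π : Equiv.Perm n, ∑ ρ : Equiv.Perm n, s π * (s ρ *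
       ∑ τ₂ : Equiv.Perm n, ∑ τ₁ : Equiv.Perm n,
        (if (fun p => (k (τ₁ p), k (π (τ₁ p)))) = w then 1 else 0) *
        (if (fun p => (k (τ₂ p), k (ρ (τ₂ p)))) = w then 1 else 0)) := by
      intro w
      simp only [bb, sq, Finset.sum_mul_sum]
      refine Finset.sum_congr rfl (fun π _ => Finset.sum_congr rfl (fun ρ _ => ?_))
      rw [Finset.sum_comm, ← Finset.sum_mul_sum]
      ring
    have e2 : ∀ (π ρ τ₂ : Equiv.Perm n), ∑ w : n → K × K, ∑ τ₁ : Equiv.Perm n,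
        (if (fun p => (k (τ₁ p), k (π (τ₁ p)))) = w then (1:ℤ) else 0) *
        (if (fun p => (k (τ₂ p), k (ρ (τ₂ p)))) = w then 1 else 0)
        = ∑ τ : Equiv.Perm n,
    ∏ p, ((if k (τ p) = k p then 1 else 0) * (if k (π (τ p)) = k (ρ p) then 1 else 0)) := by
      intro π ρ τ₂
      rw [Finset.sum_comm]
      rw [← Equiv.sum_comp (Equiv.mulRight τ₂)]
      refine Finset.sum_congr rfl (fun τ _ => ?_)
      rw [ind]
      rw [← Equiv.prod_comp τ₂ (fun p => (if k (τ p) = k p then (1:ℤ) else 0) *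
        (if k (π (τ p)) = k (ρ p) then 1 else 0))]
      rfl
    have e3 : ∑ w, bb w ^ 2 = ∑ π : Equiv.Perm n, ∑ ρ : Equiv.Perm n, s π * (s ρ *
       ∑ τ₂ : Equiv.Perm n, ∑ τ : Equiv.Perm n,
    ∏ p, ((if k (τ p) = k p then 1 else 0) * (if k (π (τ p)) = k (ρ p) then 1 else 0))) := by
      simp only [e1]
      rw [Finset.sum_comm]
      refine Finset.sum_congr rfl (fun π _ => ?_)
      rw [Finset.sum_comm]
      refine Finset.sum_congr rfl (fun ρ _ => ?_)
      rw [← Finset.mul_sum, ← Finset.mul_sum, Finset.sum_comm]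
      congr 2
      refine Finset.sum_congr rfl (fun τ₂ _ => ?_)
      exact e2 π ρ τ₂
    rw [e3]
    unfold cC
    push_cast
    rw [Finset.mul_sum]
    refine Finset.sum_congr rfl (fun π _ => ?_)
    rw [hs, mul_left_comm, Finset.mul_sum, Finset.mul_sum]
    refine Finset.sum_congr rfl (fun ρ _ => ?_)
    rw [hs]
    simp only [Finset.sum_const, nsmul_eq_mul, mul_one]
    ring
  intro h0
  rw [h0, mul_zero] at key
  have hsum : ∑ w, bb w ^ 2 = 0 := by exact_mod_cast key.symm
  have hbb : ∀ w, bb w = 0 := by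
    intro w
    have := (Finset.sum_eq_zero_iff_of_nonneg (fun w _ => sq_nonneg (bb w))).1 hsum w (mem_univ _)
    exact pow_eq_zero_iff (two_ne_zero) |>.1 this
  have h1 := chi_one b k hinj
  have h2 : (∑ _τ : Equiv.Perm n, (1:ℂ)) * chi b k 1 = ∑ w : n → K × K, (bb w : ℂ) *
      ∏ p, (1 : Matrix K K ℂ) (w p).1 (w p).2 := by
    have hw : ∀ w : n → K × K, (bb w : ℂ) * ∏ p, (1 : Matrix K K ℂ) (w p).1 (w p).2
      = ∑ π : Equiv.Perm n, ∑ τ : Equiv.Perm n, (if (fun p => (k (τ p), k (π (τ p)))) = w then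
        sgnw b π * ∏ p, (1 : Matrix K K ℂ) (w p).1 (w p).2 else 0) := by
      intro w
      simp only [bb]
      push_cast
      rw [Finset.sum_mul]
      refine Finset.sum_congr rfl (fun π _ => ?_)
      rw [Finset.mul_sum, Finset.sum_mul]
      refine Finset.sum_congr rfl (fun τ _ => ?_)
      rw [hs]
      split_ifs <;> simp
    simp only [hw]
    rw [Finset.sum_comm, chi_eq, Finset.mul_sum]
    refine Finset.sum_congr rfl (fun π _ => ?_)
    rw [Finset.sum_comm, Finset.sum_mul]
    refine Finset.sum_congr rfl (fun τ _ => ?_)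
    rw [Finset.sum_ite_eq, if_pos (mem_univ _), one_mul]
    congr 1
    rw [← Equiv.prod_comp τ]
  simp only [hbb, h1] at h2
  simp only [Int.cast_zero, zero_mul, Finset.sum_const_zero, Finset.sum_const, mul_one,
    nsmul_eq_mul] at h2
  have := Fintype.card_pos (α := Equiv.Perm n)
  have h3 : (Fintype.card (Equiv.Perm n) : ℂ) = 0 := by simpa only [mul_one, card_univ] using h2
  norm_cast at h3
  omega

/-- a homogeneous polynomial function as a sum over words -/
noncomputable def wsum {n K L A' : Type*} [Fintype n] [DecidableEq n] [Fintype K] [Fintype L]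
    [Fintype A']
    (c : (n → A' × K × L) → ℂ) (Y : A' → Matrix K L ℂ) : ℂ :=
  ∑ w : n → A' × K × L, c w * ∏ p, Y (w p).1 (w p).2.1 (w p).2.2

/-- determinant attached to a coefficient family -/
noncomputable def Dv {n K L A' Bl Bl' : Type*} [Fintype n] [DecidableEq n] [Fintype A']
    (b : n → Bl) (k : n → K) (b' : n → Bl') (l : n → L) (v : A' → Bl → Bl' → ℂ)
    (Y : A' → Matrix K L ℂ) : ℂ :=
  Matrix.det (Matrix.of fun p q => ∑ a, v a (b p) (b' q) * Y a (k p) (l q))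

theorem ryser2 {n : Type*} [Fintype n] [DecidableEq n] (z : n → n → n → ℂ) :
    ∑ S : Finset n, (-1 : ℂ) ^ (Sᶜ).card * ∑ S' : Finset n, (-1 : ℂ) ^ (S'ᶜ).card *
      ∏ p, ∑ r ∈ S, ∑ r' ∈ S', z p r r'
      = ∑ τ : Equiv.Perm n, ∑ τ' : Equiv.Perm n, ∏ p, z p (τ p) (τ' p) := by
  simp only [Finset.mul_sum]
  rw [Finset.sum_comm]
  simp only [mul_left_comm, ← Finset.mul_sum]
  simp only [ryser (fun p r => ∑ r' ∈ _, z p r r')]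
  simp only [Finset.mul_sum]
  rw [Finset.sum_comm]
  refine Finset.sum_congr rfl (fun τ _ => ?_)
  exact ryser (fun p r' => z p (τ p) r')

noncomputable def hm {n K : Type*} [DecidableEq K] (k k' : n → K) (S : Finset n) : Matrix K K ℂ :=
  Matrix.of fun i j => ∑ r ∈ S, (if k r = i then 1 else 0) * (if k' r = j then 1 else 0)

theorem sum_chi_hm {n Bl K : Type*} [Fintype n] [DecidableEq n] [DecidableEq Bl] [DecidableEq K]
    (b : n → Bl) (k : n → K) :
    ∑ π : Equiv.Perm n, sgnw b π * ∑ S : Finset n, (-1 : ℂ) ^ (Sᶜ).card *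
      chi b k (hm k (fun r => k (π r)) S) = cC b k := by
  unfold cC
  refine Finset.sum_congr rfl (fun π _ => ?_)
  congr 1
  simp only [chi_eq, hm, Matrix.of_apply, Finset.mul_sum]
  rw [Finset.sum_comm]
  simp only [mul_left_comm, ← Finset.mul_sum]
  refine Finset.sum_congr rfl (fun ρ _ => ?_)
  congr 1
  exact ryser (fun p r => (if k r = k p then (1:ℂ) else 0) * (if k (π r) = k (ρ p) then 1 else 0))

theorem sum_chi_hm' {n Bl K : Type*} [Fintype n] [DecidableEq n] [DecidableEq Bl] [DecidableEq K]
    (b : n → Bl) (k : n → K) :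
    ∑ π : Equiv.Perm n, sgnw b π * ∑ S : Finset n, (-1 : ℂ) ^ (Sᶜ).card *
      chi b k (hm (fun r => k (π r)) k S) = cC b k := by
  unfold cC
  refine Finset.sum_congr rfl (fun π _ => ?_)
  congr 1
  simp only [chi_eq', hm, Matrix.of_apply, Finset.mul_sum]
  rw [Finset.sum_comm]
  simp only [mul_left_comm, ← Finset.mul_sum]
  refine Finset.sum_congr rfl (fun ρ _ => ?_)
  congr 1
  rw [← ryser (fun p r => (if k r = k p then (1:ℂ) else 0) * (if k (π r) = k (ρ p) then 1 else 0))]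
  simp only [mul_comm]

theorem hm_mul_mul {n K L : Type*} [DecidableEq K] [DecidableEq L] [Fintype K] [Fintype L]
    (k k' : n → K) (l l' : n → L) (S S' : Finset n) (X : Matrix K L ℂ) (i : K) (j : L) :
    (hm k k' S * X * hm l' l S') i j = ∑ r ∈ S, ∑ r' ∈ S',
      (if k r = i then 1 else 0) * (if l r' = j then 1 else 0) * X (k' r) (l' r') := by
  simp only [Matrix.mul_apply, hm, Matrix.of_apply, Finset.sum_mul, Finset.mul_sum]
  rw [Finset.sum_comm]
  rw [Finset.sum_comm (s := S)]
  refine Finset.sum_congr rfl (fun r' _ => ?_)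
  have : ∀ x : L, ∑ y : K, ∑ r ∈ S, (if k r = i then (1:ℂ) else 0) * (if k' r = y then 1 else 0) *
      X y x * ((if l' r' = x then 1 else 0) * (if l r' = j then 1 else 0))
      = ∑ r ∈ S, (if k r = i then (1:ℂ) else 0) * X (k' r) x *
        ((if l' r' = x then 1 else 0) * (if l r' = j then 1 else 0)) := by
    intro x
    rw [Finset.sum_comm]
    refine Finset.sum_congr rfl (fun r _ => ?_)
    simp
  simp only [this]
  rw [Finset.sum_comm]
  refine Finset.sum_congr rfl (fun r _ => ?_)
  simp [mul_comm]

theorem sgnw_comp {n Bl : Type*} [Fintype n] [DecidableEq n] [DecidableEq Bl] (b : n → Bl)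
    (π σ : Equiv.Perm n) (u : n → n) (hu : ∀ p, π (σ p) = u p) :
    sgnw b π = ((Equiv.Perm.sign π : ℤ) : ℂ) * ∏ p, (if b (u p) = b (σ p) then 1 else 0) := by
  unfold sgnw
  rw [← Equiv.prod_comp σ]
  simp only [hu]

/-- the alternating sum is in the span of determinants -/
theorem U_eq {n K L A' Bl Bl' : Type*} [Fintype n] [DecidableEq n] [Fintype A'] [DecidableEq A']
    [DecidableEq Bl] [DecidableEq Bl']
    (b : n → Bl) (k : n → K) (b' : n → Bl') (l : n → L) (a : n → A') (τ τ' : Equiv.Perm n)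
    (Y : A' → Matrix K L ℂ) :
    ∑ π : Equiv.Perm n, ∑ π' : Equiv.Perm n, sgnw b π * sgnw b' π' *
      ∏ p, Y (a p) (k (π (τ p))) (l (π' (τ' p)))
      = ∑ S : Finset n, (((Equiv.Perm.sign τ * Equiv.Perm.sign τ' : ℤˣ) : ℤ) : ℂ) *
        (-1 : ℂ) ^ (Sᶜ).card *
        Dv b k b' l (fun a₁ β β' => ∑ r ∈ S, (if a r = a₁ then 1 else 0) *
          ((if β = b (τ r) then 1 else 0) * (if β' = b' (τ' r) then 1 else 0))) Y := by
  have hD : ∀ S : Finset n, Dv b k b' l (fun a₁ β β' => ∑ r ∈ S, (if a r = a₁ then 1 else 0) *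
          ((if β = b (τ r) then 1 else 0) * (if β' = b' (τ' r) then 1 else 0))) Y
      = ∑ φ : Equiv.Perm n, ((Equiv.Perm.sign φ : ℤ) : ℂ) * ∏ q, ∑ r ∈ S,
        ((if b (φ q) = b (τ r) then 1 else 0) * (if b' q = b' (τ' r) then 1 else 0)) *
          Y (a r) (k (φ q)) (l q) := by
    intro S
    unfold Dv
    rw [Matrix.det_apply']
    refine Finset.sum_congr rfl (fun φ _ => ?_)
    congr 1
    refine Finset.prod_congr rfl (fun q _ => ?_)
    simp only [Matrix.of_apply, Finset.sum_mul]
    rw [Finset.sum_comm]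
    refine Finset.sum_congr rfl (fun r _ => ?_)
    simp
  simp only [hD]
  have h1 : ∑ S : Finset n, (((Equiv.Perm.sign τ * Equiv.Perm.sign τ' : ℤˣ) : ℤ) : ℂ) *
        (-1 : ℂ) ^ (Sᶜ).card * ∑ φ : Equiv.Perm n, ((Equiv.Perm.sign φ : ℤ) : ℂ) * ∏ q, ∑ r ∈ S,
        ((if b (φ q) = b (τ r) then 1 else 0) * (if b' q = b' (τ' r) then 1 else 0)) *
          Y (a r) (k (φ q)) (l q)
      = ∑ φ : Equiv.Perm n, (((Equiv.Perm.sign τ * Equiv.Perm.sign τ' : ℤˣ) : ℤ) : ℂ) *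
         ((Equiv.Perm.sign φ : ℤ) : ℂ) * ∑ θ : Equiv.Perm n, ∏ q,
        ((if b (φ q) = b (τ (θ q)) then 1 else 0) * (if b' q = b' (τ' (θ q)) then 1 else 0)) *
          Y (a (θ q)) (k (φ q)) (l q) := by
    have hr : ∀ φ : Equiv.Perm n, _ := fun φ =>
      ryser (fun q r => ((if b (φ q) = b (τ r) then (1:ℂ) else 0) *
      (if b' q = b' (τ' r) then 1 else 0)) * Y (a r) (k (φ q)) (l q))
    simp only [← hr]
    simp only [Finset.mul_sum]
    rw [Finset.sum_comm]
    refine Finset.sum_congr rfl (fun φ _ => Finset.sum_congr rfl (fun S _ => ?_))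
    ring
  rw [h1]
  simp only [Finset.mul_sum]
  rw [Finset.sum_comm]
  conv_rhs => rw [Finset.sum_comm]
  symm
  refine Fintype.sum_equiv ((Equiv.mulLeft τ').trans (Equiv.inv (Equiv.Perm n))) _ _ (fun θ => ?_)
  refine Fintype.sum_equiv (Equiv.mulRight (θ⁻¹ * τ⁻¹)) _ _ (fun φ => ?_)
  simp only [Equiv.coe_mulRight, Equiv.trans_apply, Equiv.coe_mulLeft, Equiv.inv_apply]
  have e1 : ∀ p, (φ * (θ⁻¹ * τ⁻¹)) (τ (θ p)) = φ p := by intro p; simp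
  have e2 : ∀ p, (τ' * θ)⁻¹ (τ' (θ p)) = p := by
    intro p
    rw [mul_inv_rev]
    simp
  rw [sgnw_comp b _ (τ * θ) (fun p => φ p) e1, sgnw_comp b' _ (τ' * θ) (fun p => p) e2]
  rw [← Equiv.prod_comp θ (fun p => Y (a p) (k ((φ * (θ⁻¹ * τ⁻¹)) (τ p))) (l ((τ' * θ)⁻¹ (τ' p))))]
  simp only [e1, e2, Finset.prod_mul_distrib]
  have q1 : (∏ p, if b (φ p) = b ((τ * θ) p) then (1:ℂ) else 0)
    = ∏ p, if b (φ p) = b (τ (θ p)) then (1:ℂ) else 0 := rfl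
  have q2 : (∏ p, if b' p = b' ((τ' * θ) p) then (1:ℂ) else 0)
    = ∏ p, if b' p = b' (τ' (θ p)) then (1:ℂ) else 0 := rfl
  rw [q1, q2]
  have hsq : ∀ π : Equiv.Perm n, (((Equiv.Perm.sign π : ℤ) : ℂ)) * ((Equiv.Perm.sign π : ℤ) : ℂ) = 1 := by
    intro π
    norm_cast
    simp
  have := hsq θ
  simp only [Equiv.Perm.sign_mul, Equiv.Perm.sign_inv, Units.val_mul, Int.cast_mul]
  linear_combination (-(((Equiv.Perm.sign τ : ℤ) : ℂ) * ((Equiv.Perm.sign τ' : ℤ) : ℂ) *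
    ((Equiv.Perm.sign φ : ℤ) : ℂ) * ((∏ x, if b (φ x) = b (τ (θ x)) then (1:ℂ) else 0) *
    (∏ x, if b' x = b' (τ' (θ x)) then (1:ℂ) else 0) * ∏ x, Y (a (θ x)) (k (φ x)) (l x)))) * this

theorem sgnw_eq_zero {n Bl : Type*} [Fintype n] [DecidableEq n] [DecidableEq Bl] (b : n → Bl)
    (π : Equiv.Perm n) (h : ¬ ∀ p, b (π p) = b p) : sgnw b π = 0 := by
  push Not at h
  obtain ⟨p, hp⟩ := h
  unfold sgnw
  rw [Finset.prod_eq_zero (mem_univ p) (if_neg hp), mul_zero]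

theorem lemmaA {n K L A' Bl Bl' WW : Type*} [Fintype n] [DecidableEq n] [Fintype A']
    [DecidableEq A'] [DecidableEq Bl] [DecidableEq Bl'] [Fintype K] [DecidableEq K]
    [Fintype L] [DecidableEq L]
    (b : n → Bl) (k : n → K) (b' : n → Bl') (l : n → L)
    (hinj : ∀ p q, b p = b q → k p = k q → p = q)
    (hinj' : ∀ p q, b' p = b' q → l p = l q → p = q)
    (c : (n → A' × K × L) → ℂ) (X : WW → A' → Matrix K L ℂ)
    (Ph : Matrix K K ℂ → Prop) (Pg : Matrix L L ℂ → Prop)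
    (hPh : ∀ (π : Equiv.Perm n) (S : Finset n), (∀ p, b (π p) = b p) →
      Ph (hm k (fun r => k (π r)) S))
    (hPg : ∀ (π : Equiv.Perm n) (S : Finset n), (∀ p, b' (π p) = b' p) →
      Pg (hm (fun r => l (π r)) l S))
    (hF : ∀ W h g, Ph h → Pg g → wsum c (fun a => h * X W a * g)
      = chi b k h * chi b' l g * wsum c (X W)) :
    (fun W => wsum c (X W)) ∈ Submodule.span ℂ (Set.range fun v : A' → Bl → Bl' → ℂ =>
      fun W => Dv b k b' l v (X W)) := by
  have main : ∀ W, cC b k * cC b' l * wsum c (X W) =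
      ∑ w : n → A' × K × L, ∑ τ : Equiv.Perm n, ∑ τ' : Equiv.Perm n,
        (c w * ∏ p, ((if k (τ p) = (w p).2.1 then 1 else 0) *
          (if l (τ' p) = (w p).2.2 then 1 else 0))) *
        ∑ π : Equiv.Perm n, ∑ π' : Equiv.Perm n, sgnw b π * sgnw b' π' *
          ∏ p, X W (w p).1 (k (π (τ p))) (l (π' (τ' p))) := by
    intro W
    have h1 : cC b k * cC b' l * wsum c (X W) = ∑ π : Equiv.Perm n, ∑ π' : Equiv.Perm n,
        sgnw b π * sgnw b' π' * ∑ S : Finset n, (-1 : ℂ) ^ (Sᶜ).card * ∑ S' : Finset n,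
          (-1 : ℂ) ^ (S'ᶜ).card * wsum c (fun a => hm k (fun r => k (π r)) S * X W a *
            hm (fun r => l (π' r)) l S') := by
      rw [← sum_chi_hm b k, ← sum_chi_hm' b' l, Finset.sum_mul_sum, Finset.sum_mul]
      refine Finset.sum_congr rfl (fun π _ => ?_)
      rw [Finset.sum_mul]
      refine Finset.sum_congr rfl (fun π' _ => ?_)
      by_cases hπ : ∀ p, b (π p) = b p
      swap
      · rw [sgnw_eq_zero b π hπ]; simp
      by_cases hπ' : ∀ p, b' (π' p) = b' p
      swap
      · rw [sgnw_eq_zero b' π' hπ']; simp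
      have : ∀ S S', wsum c (fun a => hm k (fun r => k (π r)) S * X W a *
            hm (fun r => l (π' r)) l S') = _ := fun S S' =>
          hF W _ _ (hPh π S hπ) (hPg π' S' hπ')
      simp only [this]
      have e : ∑ S : Finset n, (-1 : ℂ) ^ (Sᶜ).card * ∑ S' : Finset n,
          (-1 : ℂ) ^ (S'ᶜ).card * (chi b k (hm k (fun r => k (π r)) S) *
            chi b' l (hm (fun r => l (π' r)) l S') * wsum c (X W))
          = (∑ S : Finset n, (-1 : ℂ) ^ (Sᶜ).card * chi b k (hm k (fun r => k (π r)) S)) *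
          (∑ S' : Finset n, (-1 : ℂ) ^ (S'ᶜ).card * chi b' l (hm (fun r => l (π' r)) l S')) *
          wsum c (X W) := by
        rw [Finset.sum_mul_sum, Finset.sum_mul]
        refine Finset.sum_congr rfl (fun S _ => ?_)
        rw [Finset.mul_sum, Finset.sum_mul]
        refine Finset.sum_congr rfl (fun S' _ => ?_)
        ring
      rw [e]
      ring
    rw [h1]
    have h2 : ∀ π π' : Equiv.Perm n, ∑ S : Finset n, (-1 : ℂ) ^ (Sᶜ).card * ∑ S' : Finset n,
          (-1 : ℂ) ^ (S'ᶜ).card * wsum c (fun a => hm k (fun r => k (π r)) S * X W a *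
            hm (fun r => l (π' r)) l S')
        = ∑ w : n → A' × K × L, c w * ∑ τ : Equiv.Perm n, ∑ τ' : Equiv.Perm n,
         ∏ p, ((if k (τ p) = (w p).2.1 then 1 else 0) *
          (if l (τ' p) = (w p).2.2 then 1 else 0) * X W (w p).1 (k (π (τ p))) (l (π' (τ' p)))) := by
      intro π π'
      have hr : ∀ w : n → A' × K × L, _ := fun w => ryser2 (fun p r r' =>
        ((if k r = (w p).2.1 then (1:ℂ) else 0) *
          (if l r' = (w p).2.2 then 1 else 0) * X W (w p).1 (k (π r)) (l (π' r'))))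
      simp only [← hr, wsum, hm_mul_mul, Finset.mul_sum]
      conv_rhs => rw [Finset.sum_comm]
      refine Finset.sum_congr rfl (fun S _ => ?_)
      conv_rhs => rw [Finset.sum_comm]
      refine Finset.sum_congr rfl (fun S' _ => Finset.sum_congr rfl (fun w _ => ?_))
      ring
    simp only [h2]
    simp only [Finset.mul_sum]
    -- move sums over pi inside
    have h3 : ∀ (G : Equiv.Perm n → Equiv.Perm n → (n → A' × K × L) → Equiv.Perm n →
        Equiv.Perm n → ℂ),
        ∑ π, ∑ π', ∑ w, ∑ τ, ∑ τ', G π π' w τ τ' = ∑ w, ∑ τ, ∑ τ', ∑ π, ∑ π', G π π' w τ τ' := by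
      intro G
      calc ∑ π, ∑ π', ∑ w, ∑ τ, ∑ τ', G π π' w τ τ'
          = ∑ x : Equiv.Perm n × Equiv.Perm n, ∑ y : (n → A' × K × L) × Equiv.Perm n × Equiv.Perm n,
            G x.1 x.2 y.1 y.2.1 y.2.2 := by simp only [Fintype.sum_prod_type]
        _ = ∑ y : (n → A' × K × L) × Equiv.Perm n × Equiv.Perm n,
            ∑ x : Equiv.Perm n × Equiv.Perm n,
            G x.1 x.2 y.1 y.2.1 y.2.2 := Finset.sum_comm
        _ = _ := by simp only [Fintype.sum_prod_type]
    rw [h3]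
    refine Finset.sum_congr rfl (fun w _ => Finset.sum_congr rfl (fun τ _ =>
      Finset.sum_congr rfl (fun τ' _ => Finset.sum_congr rfl (fun π _ =>
      Finset.sum_congr rfl (fun π' _ => ?_)))))
    simp only [Finset.prod_mul_distrib]
    ring
  have hC : cC b k * cC b' l ≠ 0 := mul_ne_zero (cC_ne_zero b k hinj) (cC_ne_zero b' l hinj')
  have hfun : (fun W => wsum c (X W)) = (cC b k * cC b' l)⁻¹ •
      ∑ w : n → A' × K × L, ∑ τ : Equiv.Perm n, ∑ τ' : Equiv.Perm n,
        (c w * ∏ p, ((if k (τ p) = (w p).2.1 then 1 else 0) *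
          (if l (τ' p) = (w p).2.2 then 1 else 0))) •
        ∑ S : Finset n, ((((Equiv.Perm.sign τ * Equiv.Perm.sign τ' : ℤˣ) : ℤ) : ℂ) *
        (-1 : ℂ) ^ (Sᶜ).card) •
        (fun W => Dv b k b' l (fun a₁ β β' => ∑ r ∈ S, (if (w r).1 = a₁ then 1 else 0) *
          ((if β = b (τ r) then 1 else 0) * (if β' = b' (τ' r) then 1 else 0))) (X W)) := by
    funext W
    have := main W
    simp only [U_eq b k b' l (fun p => (_ : n → A' × K × L) p |>.1)] at this
    simp only [Pi.smul_apply, Finset.sum_apply, smul_eq_mul]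
    rw [← this, inv_mul_cancel_left₀ hC]
  rw [hfun]
  refine Submodule.smul_mem _ _ (Submodule.sum_mem _ (fun w _ => Submodule.sum_mem _ (fun τ _ =>
    Submodule.sum_mem _ (fun τ' _ => Submodule.smul_mem _ _ (Submodule.sum_mem _ (fun S _ =>
      Submodule.smul_mem _ _ (Submodule.subset_span ⟨_, rfl⟩)))))))

end EmbThm


namespace EmbThm
open Finset

/-- a polynomial that is homogeneous as a function is a sum over words -/
theorem exists_words {n ι : Type*} [Fintype n] [DecidableEq n] [Fintype ι] [DecidableEq ι]
    (P : MvPolynomial ι ℂ)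
    (hP : ∀ (t : ℂ) (x : ι → ℂ), MvPolynomial.eval (fun i => t * x i) P
      = t ^ (Fintype.card n) * MvPolynomial.eval x P) :
    ∃ c : (n → ι) → ℂ, ∀ x : ι → ℂ, MvPolynomial.eval x P = ∑ w : n → ι, c w * ∏ r, x (w r) := by
  classical
  have h1 : ∀ x : ι → ℂ, MvPolynomial.eval x P =
      ∑ m ∈ P.support, (if ∑ i, m i = Fintype.card n then P.coeff m * ∏ i, x i ^ m i else 0) := by
    intro x
    let p : Polynomial ℂ := ∑ m ∈ P.support, Polynomial.monomial (∑ i, m i) (P.coeff m * ∏ i, x i ^ m i)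
    let q : Polynomial ℂ := Polynomial.monomial (Fintype.card n) (MvPolynomial.eval x P)
    have hpq : p = q := by
      apply Polynomial.funext
      intro t
      have := hP t x
      simp only [p, q, Polynomial.eval_finsetSum, Polynomial.eval_monomial]
      rw [mul_comm, ← this, MvPolynomial.eval_eq']
      refine Finset.sum_congr rfl (fun m _ => ?_)
      simp only [mul_pow, Finset.prod_mul_distrib, Finset.prod_pow_eq_pow_sum]
      ring
    have := congrArg (fun r => Polynomial.coeff r (Fintype.card n)) hpq
    simp only [p, q, Polynomial.finsetSum_coeff, Polynomial.coeff_monomial, if_true] at this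
    exact this.symm
  have h2 : ∀ m : ι →₀ ℕ, ∑ i, m i = Fintype.card n → ∃ w : n → ι, ∀ x : ι → ℂ,
      ∏ r, x (w r) = ∏ i, x i ^ m i := by
    intro m hm
    have hc : Fintype.card n = Fintype.card (Σ i, Fin (m i)) := by
      rw [Fintype.card_sigma]; simp [hm]
    let e := Fintype.equivOfCardEq hc
    refine ⟨fun r => (e r).1, fun x => ?_⟩
    rw [Equiv.prod_comp e (fun y => x y.1), Fintype.prod_sigma]
    simp
  choose w hw using h2
  refine ⟨fun u => ∑ m ∈ P.support, (if h : ∑ i, m i = Fintype.card n then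
    (if w m h = u then P.coeff m else 0) else 0), fun x => ?_⟩
  rw [h1 x]
  simp only [Finset.sum_mul]
  rw [Finset.sum_comm]
  refine Finset.sum_congr rfl (fun m _ => ?_)
  split_ifs with h
  · simp only [ite_mul, zero_mul, Finset.sum_ite_eq, Finset.mem_univ, if_true]
    rw [hw m h]
  · simp

end EmbThm


namespace EmbThm
open Finset

/-- total index set -/
abbrev BB (Q : FinQuiver) (β : Q.V → ℕ) : Type := (x : Q.V) × Fin (β x)

/-- variable index set -/
abbrev VI (Q : FinQuiver) (β : Q.V → ℕ) : Type := (a : Q.A) × (Fin (β (Q.h a)) × Fin (β (Q.t a)))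

theorem det_bd {S : Type*} [Fintype S] [DecidableEq S] {n : S → Type*} [∀ s, Fintype (n s)]
    [∀ s, DecidableEq (n s)] (M : ∀ s, Matrix (n s) (n s) ℂ) :
    (Matrix.blockDiagonal' M).det = ∏ s, (M s).det := by
  letI : LinearOrder S := LinearOrder.lift' (Fintype.equivFin S) (Equiv.injective _)
  have hbt : (Matrix.blockDiagonal' M).BlockTriangular (fun p : (s : S) × n s => p.1) := by
    rintro ⟨s, i⟩ ⟨t, j⟩ h
    exact Matrix.blockDiagonal'_apply_ne _ _ _ (ne_of_gt h)
  rw [Matrix.BlockTriangular.det_fintype hbt]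
  refine Finset.prod_congr rfl (fun s _ => ?_)
  rw [← Matrix.det_submatrix_equiv_self (Equiv.sigmaSubtype s).symm]
  congr 1
  ext i j
  simp only [Matrix.submatrix_apply, Matrix.toSquareBlock_def, Matrix.of_apply]
  exact Matrix.blockDiagonal'_apply_eq M s i j

variable {Q : FinQuiver}

/-- big matrix of one arrow -/
noncomputable def hat {β : Q.V → ℕ} (W : Q.Rep β) (a : Q.A) : Matrix (BB Q β) (BB Q β) ℂ :=
  Matrix.of fun s t => ∑ i, ∑ j, (if s = ⟨Q.h a, i⟩ then 1 else 0) *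
    (if t = ⟨Q.t a, j⟩ then 1 else 0) * W a i j

theorem hat_apply {β : Q.V → ℕ} (W : Q.Rep β) (a : Q.A) (i : Fin (β (Q.h a)))
    (j : Fin (β (Q.t a))) : hat W a ⟨Q.h a, i⟩ ⟨Q.t a, j⟩ = W a i j := by
  simp [hat]

theorem hat_zero {β : Q.V → ℕ} (W : Q.Rep β) (a : Q.A) (s t : BB Q β)
    (h : ¬ (s.1 = Q.h a ∧ t.1 = Q.t a)) : hat W a s t = 0 := by
  simp only [hat, Matrix.of_apply]
  refine Finset.sum_eq_zero (fun i _ => Finset.sum_eq_zero (fun j _ => ?_))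
  by_cases h1 : s = ⟨Q.h a, i⟩
  · by_cases h2 : t = ⟨Q.t a, j⟩
    · exact absurd ⟨by rw [h1], by rw [h2]⟩ h
    · simp [h2]
  · simp [h1]

/-- a block diagonal matrix on the total index set -/
def IsBD {β : Q.V → ℕ} (h : Matrix (BB Q β) (BB Q β) ℂ) : Prop :=
  ∀ s t, s.1 ≠ t.1 → h s t = 0

/-- the blocks -/
def blk {β : Q.V → ℕ} (h : Matrix (BB Q β) (BB Q β) ℂ) (x : Q.V) :
    Matrix (Fin (β x)) (Fin (β x)) ℂ := Matrix.of fun i j => h ⟨x, i⟩ ⟨x, j⟩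

theorem IsBD.eq {β : Q.V → ℕ} {h : Matrix (BB Q β) (BB Q β) ℂ} (hh : IsBD h) :
    h = Matrix.blockDiagonal' (blk h) := by
  ext ⟨x, i⟩ ⟨y, j⟩
  by_cases hxy : x = y
  · subst hxy; rw [Matrix.blockDiagonal'_apply_eq]; rfl
  · rw [Matrix.blockDiagonal'_apply_ne _ _ _ hxy]; exact hh _ _ hxy

theorem IsBD.det {β : Q.V → ℕ} {h : Matrix (BB Q β) (BB Q β) ℂ} (hh : IsBD h) :
    h.det = ∏ x, (blk h x).det := by
  conv_lhs => rw [hh.eq]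
  exact det_bd _

/-- block determinants for multiplied blocks -/
theorem det_multi {β : Q.V → ℕ} {S : Type*} [Fintype S] [DecidableEq S] (π : S → Q.V)
    (h : Matrix (BB Q β) (BB Q β) ℂ) :
    Matrix.det (Matrix.of fun p q : (s : S) × Fin (β (π s)) =>
      (if p.1 = q.1 then (1:ℂ) else 0) * h ⟨π p.1, p.2⟩ ⟨π q.1, q.2⟩) = ∏ s, (blk h (π s)).det := by
  rw [← det_bd (fun s => blk h (π s))]
  congr 1
  ext ⟨s, i⟩ ⟨t, j⟩
  by_cases hst : s = t
  · subst hst; rw [Matrix.blockDiagonal'_apply_eq]; simp [blk]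
  · rw [Matrix.blockDiagonal'_apply_ne _ _ _ hst]; simp [hst]

/-- the homogenised polynomial, over any ring -/
noncomputable def Fgen {β : Q.V → ℕ} {R : Type*} [CommRing R] (φ : ℂ →+* R)
    (P : MvPolynomial (VI Q β) ℂ) (N : ℕ) (Y : Option Q.A → Matrix (BB Q β) (BB Q β) R) : R :=
  ∑ m ∈ P.support, φ (P.coeff m) * (∏ e : VI Q β, ((Y (some e.1) * (Y none).adjugate)
    ⟨Q.h e.1, e.2.1⟩ ⟨Q.t e.1, e.2.2⟩) ^ (m e)) * (Y none).det ^ (N - ∑ e, m e)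

theorem Fgen_map {β : Q.V → ℕ} {R R' : Type*} [CommRing R] [CommRing R'] (φ : ℂ →+* R)
    (ψ : R →+* R') (P : MvPolynomial (VI Q β) ℂ) (N : ℕ)
    (Y : Option Q.A → Matrix (BB Q β) (BB Q β) R) :
    ψ (Fgen φ P N Y) = Fgen (ψ.comp φ) P N (fun a => (Y a).map ψ) := by
  unfold Fgen
  rw [map_sum]
  refine Finset.sum_congr rfl (fun m _ => ?_)
  rw [map_mul, map_mul, map_prod, map_pow]
  congr 1
  · congr 1
    refine Finset.prod_congr rfl (fun e _ => ?_)
    rw [map_pow]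
    congr 1
    have h1 : ((Y none).map ψ).adjugate = (Y none).adjugate.map ψ :=
      (RingHom.map_adjugate ψ (Y none)).symm
    rw [h1, ← Matrix.map_mul, Matrix.map_apply]
  · congr 1
    exact RingHom.map_det ψ (Y none)

theorem Fgen_smul {β : Q.V → ℕ} (P : MvPolynomial (VI Q β) ℂ) (N : ℕ)
    (hN : ∀ m ∈ P.support, ∑ e, m e ≤ N)
    (Y : Option Q.A → Matrix (BB Q β) (BB Q β) ℂ) (t : ℂ) :
    Fgen (RingHom.id ℂ) P N (fun a => t • Y a)
      = t ^ (N * Fintype.card (BB Q β)) * Fgen (RingHom.id ℂ) P N Y := by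
  unfold Fgen
  rw [Finset.mul_sum]
  refine Finset.sum_congr rfl (fun m hm => ?_)
  rw [Matrix.det_smul]
  have h1 : ∀ e : VI Q β, ((t • Y (some e.1)) * (t • Y none).adjugate)
      ⟨Q.h e.1, e.2.1⟩ ⟨Q.t e.1, e.2.2⟩ = t ^ (Fintype.card (BB Q β)) *
        ((Y (some e.1)) * (Y none).adjugate) ⟨Q.h e.1, e.2.1⟩ ⟨Q.t e.1, e.2.2⟩ := by
    intro e
    have hpos : 0 < Fintype.card (BB Q β) := Fintype.card_pos_iff.2 ⟨⟨Q.h e.1, e.2.1⟩⟩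
    rw [Matrix.adjugate_smul, Matrix.smul_mul, Matrix.mul_smul, smul_smul, Matrix.smul_apply,
      smul_eq_mul, ← pow_succ', Nat.sub_add_cancel hpos]
  simp only [h1, mul_pow, Finset.prod_mul_distrib, ← pow_mul]
  rw [Finset.prod_pow_eq_pow_sum, ← Finset.mul_sum]
  have h2 : N * Fintype.card (BB Q β) = Fintype.card (BB Q β) * (∑ e, m e) +
      Fintype.card (BB Q β) * (N - ∑ e, m e) := by
    rw [← mul_add, Nat.add_sub_cancel' (hN m hm), mul_comm]
  rw [h2, pow_add]
  ring

theorem Fgen_words {β : Q.V → ℕ} (P : MvPolynomial (VI Q β) ℂ) (N : ℕ)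
    (hN : ∀ m ∈ P.support, ∑ e, m e ≤ N) {n : Type*} [Fintype n] [DecidableEq n]
    (hn : Fintype.card n = N * Fintype.card (BB Q β)) :
    ∃ c : (n → Option Q.A × BB Q β × BB Q β) → ℂ, ∀ Y : Option Q.A → Matrix (BB Q β) (BB Q β) ℂ,
      Fgen (RingHom.id ℂ) P N Y = wsum c Y := by
  let Yg : Option Q.A → Matrix (BB Q β) (BB Q β) (MvPolynomial (Option Q.A × BB Q β × BB Q β) ℂ) :=
    fun a => Matrix.of fun i j => MvPolynomial.X (a, i, j)
  let PF := Fgen MvPolynomial.C P N Yg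
  have hPF : ∀ x : Option Q.A × BB Q β × BB Q β → ℂ, MvPolynomial.eval x PF
      = Fgen (RingHom.id ℂ) P N (fun a => Matrix.of fun i j => x (a, i, j)) := by
    intro x
    simp only [PF]
    rw [Fgen_map]
    congr 1
    · ext z; simp
    · funext a; ext i j; simp [Yg]
  obtain ⟨c, hc⟩ := exists_words (n := n) PF (by
    intro t x
    rw [hPF, hPF, hn, ← Fgen_smul P N hN]
    congr 1)
  refine ⟨c, fun Y => ?_⟩
  have := hc (fun i => Y i.1 i.2.1 i.2.2)
  rw [hPF] at this
  exact this

end EmbThm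


namespace EmbThm
open Finset
variable {Q : FinQuiver}

theorem Fgen_mul_right {β : Q.V → ℕ} (P : MvPolynomial (VI Q β) ℂ) (N : ℕ)
    (hN : ∀ m ∈ P.support, ∑ e, m e ≤ N)
    (Y : Option Q.A → Matrix (BB Q β) (BB Q β) ℂ) (g : Matrix (BB Q β) (BB Q β) ℂ) :
    Fgen (RingHom.id ℂ) P N (fun a => Y a * g) = g.det ^ N * Fgen (RingHom.id ℂ) P N Y := by
  unfold Fgen
  rw [Finset.mul_sum]
  refine Finset.sum_congr rfl (fun m hm => ?_)
  have h1 : ∀ a, Y a * g * (Y none * g).adjugate = g.det • (Y a * (Y none).adjugate) := by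
    intro a
    rw [Matrix.adjugate_mul_distrib, Matrix.mul_assoc, ← Matrix.mul_assoc g, Matrix.mul_adjugate,
      Matrix.smul_mul, Matrix.one_mul, Matrix.mul_smul]
  simp only [h1, Matrix.smul_apply, smul_eq_mul, mul_pow, Finset.prod_mul_distrib,
    Finset.prod_pow_eq_pow_sum, Matrix.det_mul]
  rw [show N = ∑ e, m e + (N - ∑ e, m e) from (Nat.add_sub_cancel' (hN m hm)).symm, pow_add]
  simp only [Nat.add_sub_cancel_left]
  ring

/-- the family of big matrices, with the identity as the extra one -/
noncomputable def XX {β : Q.V → ℕ} (W : Q.Rep β) : Option Q.A → Matrix (BB Q β) (BB Q β) ℂ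
  | none => 1
  | some a => hat W a

theorem Fgen_one {β : Q.V → ℕ} (P : MvPolynomial (VI Q β) ℂ) (N : ℕ) (W : Q.Rep β)
    (Y : Option Q.A → Matrix (BB Q β) (BB Q β) ℂ) (h0 : Y none = 1)
    (h1 : ∀ a i j, Y (some a) ⟨Q.h a, i⟩ ⟨Q.t a, j⟩ = W a i j) :
    Fgen (RingHom.id ℂ) P N Y = MvPolynomial.eval (fun i => W i.1 i.2.1 i.2.2) P := by
  unfold Fgen
  rw [MvPolynomial.eval_eq']
  refine Finset.sum_congr rfl (fun m _ => ?_)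
  simp [h0, h1]

theorem mul_hat_mul {β : Q.V → ℕ} (W : Q.Rep β) (h g : Matrix (BB Q β) (BB Q β) ℂ) (a : Q.A)
    (s t : BB Q β) : (h * hat W a * g) s t = ∑ j, ∑ i, h s ⟨Q.h a, i⟩ * W a i j * g ⟨Q.t a, j⟩ t := by
  simp only [Matrix.mul_apply, hat, Matrix.of_apply, Finset.mul_sum, Finset.sum_mul]
  rw [Finset.sum_comm]
  simp only [Finset.sum_comm (s := univ (α := BB Q β)) (t := univ (α := Fin (β (Q.h a)))),
    Finset.sum_comm (s := univ (α := BB Q β)) (t := univ (α := Fin (β (Q.t a))))]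
  rw [Finset.sum_comm]
  refine Finset.sum_congr rfl (fun j _ => Finset.sum_congr rfl (fun i _ => ?_))
  rw [Finset.sum_eq_single (⟨Q.h a, i⟩ : BB Q β)]
  · rw [Finset.sum_eq_single (⟨Q.t a, j⟩ : BB Q β)]
    · simp
    · intro b _ hb; simp [hb]
    · simp
  · intro b _ hb; simp [hb]
  · simp

theorem Fgen_inv {β : Q.V → ℕ} {σ : Q.V → ℤ} (f : Q.Rep β → ℂ)
    (P : MvPolynomial (VI Q β) ℂ)
    (hP : ∀ W : Q.Rep β, f W = MvPolynomial.eval (fun i => W i.1 i.2.1 i.2.2) P)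
    (hf : ∀ (g : Q.GLb β) (W : Q.Rep β), f (Q.invAct g W) = Q.detWeight σ g * f W)
    (N : ℕ) (hN : ∀ m ∈ P.support, ∑ e, m e ≤ N) (W : Q.Rep β)
    (h : Matrix (BB Q β) (BB Q β) ℂ) (hbd : IsBD h) (hdet : h.det ≠ 0) :
    Fgen (RingHom.id ℂ) P N (fun a => h * XX W a)
      = (∏ x, (blk h x).det ^ (N : ℤ) * (blk h x).det ^ (-σ x)) * f W := by
  have hd : ∀ x, IsUnit (blk h x).det := by
    intro x
    rw [hbd.det] at hdet
    exact isUnit_iff_ne_zero.2 (Finset.prod_ne_zero_iff.1 hdet x (mem_univ _))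
  let h' : Matrix (BB Q β) (BB Q β) ℂ := Matrix.blockDiagonal' (fun x => (blk h x)⁻¹)
  have hh' : h * h' = 1 := by
    conv_lhs => rw [hbd.eq]
    simp only [h', ← Matrix.blockDiagonal'_mul, Matrix.mul_nonsing_inv _ (hd _)]
    exact Matrix.blockDiagonal'_one
  have hh'' : h' * h = 1 := mul_eq_one_comm.1 hh'
  let γ : Q.GLb β := fun x => ⟨(blk h x)⁻¹, blk h x, Matrix.nonsing_inv_mul _ (hd x),
    Matrix.mul_nonsing_inv _ (hd x)⟩
  have e1 : (fun a => h * XX W a) = fun a => (h * XX W a * h') * h := by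
    funext a
    rw [Matrix.mul_assoc, hh'', Matrix.mul_one]
  rw [e1, Fgen_mul_right P N hN, Fgen_one P N (Q.invAct γ W), ← hP, hf, hbd.det, ← mul_assoc]
  · congr 1
    unfold FinQuiver.detWeight
    rw [← Finset.prod_pow, ← Finset.prod_mul_distrib]
    refine Finset.prod_congr rfl (fun x _ => ?_)
    simp only [γ, zpow_natCast]
    rw [Matrix.det_nonsing_inv, Ring.inverse_eq_inv', inv_zpow']
  · simp only [XX]; rw [Matrix.mul_one, hh']
  · intro a i j
    simp only [XX]
    rw [mul_hat_mul]
    simp only [FinQuiver.invAct, Matrix.mul_apply, Finset.sum_mul]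
    refine Finset.sum_congr rfl (fun j' _ => Finset.sum_congr rfl (fun i' _ => ?_))
    simp only [h', Matrix.blockDiagonal'_apply_eq]
    rfl

abbrev P1 (Q : FinQuiver) (α : Q.V → ℕ) : Type := (a : Q.A) × Fin (α (Q.t a))
abbrev P0 (Q : FinQuiver) (α : Q.V → ℕ) : Type := (x : Q.V) × Fin (α x)
abbrev C1 (Q : FinQuiver) (α β : Q.V → ℕ) : Type := (s : P1 Q α) × Fin (β (Q.h s.1))
abbrev C0 (Q : FinQuiver) (α β : Q.V → ℕ) : Type := (s : P0 Q α) × Fin (β s.1)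

theorem prod_P1 {α : Q.V → ℕ} (d : Q.V → ℂ) (hd : ∀ x, d x ≠ 0) (N : ℕ) (hN : ∀ x, α x ≤ N) :
    ∏ x, d x ^ (N : ℤ) * d x ^ (-(Q.weightOf α x)) = (∏ s : P1 Q α, d (Q.h s.1)) *
      ∏ s : P0 Q (fun x => N - α x), d s.1 := by
  rw [Fintype.prod_sigma, Fintype.prod_sigma]
  simp only [Finset.prod_const, card_univ, Fintype.card_fin]
  have h1 : ∏ a : Q.A, d (Q.h a) ^ α (Q.t a)
      = ∏ x, ∏ a : Q.A, (if Q.h a = x then d x ^ (α (Q.t a)) else 1) := by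
    rw [Finset.prod_comm]
    refine Finset.prod_congr rfl (fun a _ => ?_)
    simp
  rw [h1, ← Finset.prod_mul_distrib]
  refine Finset.prod_congr rfl (fun x _ => ?_)
  have h2 : ∏ a : Q.A, (if Q.h a = x then d x ^ (α (Q.t a)) else 1)
      = d x ^ (∑ a : Q.A, (if Q.h a = x then (α (Q.t a)) else 0)) := by
    rw [← Finset.prod_pow_eq_pow_sum]
    refine Finset.prod_congr rfl (fun a _ => ?_)
    split_ifs <;> simp
  rw [h2, ← pow_add, ← zpow_add₀ (hd x), ← zpow_natCast]
  congr 1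
  unfold FinQuiver.weightOf
  push_cast [Nat.cast_sub (hN x)]
  ring

theorem Fgen_all {α β : Q.V → ℕ} (f : Q.Rep β → ℂ)
    (P : MvPolynomial (VI Q β) ℂ)
    (hP : ∀ W : Q.Rep β, f W = MvPolynomial.eval (fun i => W i.1 i.2.1 i.2.2) P)
    (hf : ∀ (g : Q.GLb β) (W : Q.Rep β), f (Q.invAct g W) = Q.detWeight (Q.weightOf α) g * f W)
    (N : ℕ) (hN : ∀ m ∈ P.support, ∑ e, m e ≤ N) (hN' : ∀ x, α x ≤ N) (W : Q.Rep β)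
    (h : Matrix (BB Q β) (BB Q β) ℂ) (hbd : IsBD h) :
    Fgen (RingHom.id ℂ) P N (fun a => h * XX W a)
      = ((∏ s : P1 Q α, (blk h (Q.h s.1)).det) *
      ∏ s : P0 Q (fun x => N - α x), (blk h s.1).det) * f W := by
  let ht : ℂ → Matrix (BB Q β) (BB Q β) ℂ := fun t => h + t • 1
  have hct : Continuous ht := by fun_prop
  have hbdt : ∀ t, IsBD (ht t) := by
    intro t s s' hs
    have : s ≠ s' := fun h => hs (by rw [h])
    simp [ht, hbd s s' hs, Matrix.one_apply_ne this]
  have hcb : ∀ x, Continuous (fun t => (blk (ht t) x).det) := by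
    intro x
    apply Continuous.matrix_det
    apply continuous_matrix
    intro i j
    simp only [blk, Matrix.of_apply]
    exact hct.matrix_elem _ _
  have hfin : {t : ℂ | (ht t).det = 0}.Finite := by
    have : {t : ℂ | (ht t).det = 0} ⊆ {t | ((-h).charpoly).IsRoot t} := by
      intro t ht0
      simp only [Set.mem_ofPred_eq, Polynomial.IsRoot.def, Matrix.eval_charpoly] at ht0 ⊢
      rw [← ht0]
      congr 1
      simp only [ht, Matrix.scalar_apply, sub_neg_eq_add]
      rw [add_comm, Matrix.smul_one_eq_diagonal]
    exact Set.Finite.subset (Polynomial.finite_setOfPred_isRoot (Matrix.charpoly_monic _).ne_zero) this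
  have hdense : Dense {t : ℂ | (ht t).det ≠ 0} := by
    have := hfin.countable.dense_compl ℂ
    exact this
  have hF : Continuous (fun t => Fgen (RingHom.id ℂ) P N (fun a => ht t * XX W a)) := by
    unfold Fgen
    refine continuous_finsetSum _ (fun m _ => ?_)
    have h0 : Continuous (fun t => ht t * XX W none) := hct.matrix_mul continuous_const
    refine Continuous.mul (Continuous.mul continuous_const ?_) (h0.matrix_det.pow _)
    refine continuous_finsetProd _ (fun e _ => ?_)
    refine Continuous.pow ?_ _
    exact ((hct.matrix_mul continuous_const).matrix_mul h0.matrix_adjugate).matrix_elem _ _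
  have hG : Continuous (fun t => ((∏ s : P1 Q α, (blk (ht t) (Q.h s.1)).det) *
      ∏ s : P0 Q (fun x => N - α x), (blk (ht t) s.1).det) * f W) := by
    refine Continuous.mul (Continuous.mul ?_ ?_) continuous_const
    · exact continuous_finsetProd _ (fun s _ => hcb _)
    · exact continuous_finsetProd _ (fun s _ => hcb _)
  have := Continuous.ext_on hdense hF hG (by
    intro t htd
    have htd' : (ht t).det ≠ 0 := htd
    simp only
    rw [Fgen_inv f P hP hf N hN W _ (hbdt t) htd']
    congr 1
    refine prod_P1 _ (fun x => ?_) N hN'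
    rw [(hbdt t).det] at htd'
    exact (Finset.prod_ne_zero_iff.1 htd' x (mem_univ _)))
  have h0 := congrFun this 0
  have hz : ht 0 = h := by simp [ht]
  simp only [hz] at h0
  exact h0

end EmbThm


namespace EmbThm
open Finset
variable {Q : FinQuiver}

def brow {α m β : Q.V → ℕ} : C1 Q α β ⊕ C0 Q m β → P1 Q α ⊕ P0 Q m
  | .inl p => .inl p.1
  | .inr p => .inr p.1

def krow {α m β : Q.V → ℕ} : C1 Q α β ⊕ C0 Q m β → BB Q β
  | .inl p => ⟨Q.h p.1.1, p.2⟩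
  | .inr p => ⟨p.1.1, p.2⟩

def bcol {α m β : Q.V → ℕ} : C0 Q α β ⊕ C0 Q m β → P0 Q α ⊕ P0 Q m
  | .inl p => .inl p.1
  | .inr p => .inr p.1

def lcol {α m β : Q.V → ℕ} : C0 Q α β ⊕ C0 Q m β → BB Q β
  | .inl p => ⟨p.1.1, p.2⟩
  | .inr p => ⟨p.1.1, p.2⟩

/-- matrix of a coefficient family -/
noncomputable def Mv {α m β : Q.V → ℕ} (v : Option Q.A → (P1 Q α ⊕ P0 Q m) → (P0 Q α ⊕ P0 Q m) → ℂ)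
    (W : Q.Rep β) : Matrix (C1 Q α β ⊕ C0 Q m β) (C0 Q α β ⊕ C0 Q m β) ℂ :=
  Matrix.of fun p q => ∑ a, v a (brow p) (bcol q) * XX W a (krow p) (lcol q)

theorem chi_row {α m β : Q.V → ℕ} (h : Matrix (BB Q β) (BB Q β) ℂ) :
    chi (brow (α := α) (m := m) (β := β)) krow h = (∏ s : P1 Q α, (blk h (Q.h s.1)).det) *
      ∏ s : P0 Q m, (blk h s.1).det := by
  rw [← det_multi (fun s : P1 Q α => Q.h s.1), ← det_multi (fun s : P0 Q m => s.1),
    ← Matrix.det_fromBlocks_zero₂₁ _ 0]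
  unfold chi
  congr 1
  ext p q
  rcases p with p | p <;> rcases q with q | q <;> simp [brow, krow]

theorem chi_col {α m β : Q.V → ℕ} (h : Matrix (BB Q β) (BB Q β) ℂ) :
    chi (bcol (α := α) (m := m) (β := β)) lcol h = (∏ s : P0 Q α, (blk h s.1).det) *
      ∏ s : P0 Q m, (blk h s.1).det := by
  rw [← det_multi (fun s : P0 Q α => s.1), ← det_multi (fun s : P0 Q m => s.1),
    ← Matrix.det_fromBlocks_zero₂₁ _ 0]
  unfold chi
  congr 1
  ext p q
  rcases p with p | p <;> rcases q with q | q <;> simp [bcol, lcol]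

theorem chi_equiv {n n' Bl K : Type*} [Fintype n] [DecidableEq n] [Fintype n'] [DecidableEq n']
    [DecidableEq Bl] (e : n' ≃ n) (b : n → Bl)
    (k : n → K) (h : Matrix K K ℂ) : chi (fun p => b (e p)) (fun p => k (e p)) h = chi b k h := by
  unfold chi
  rw [← Matrix.det_submatrix_equiv_self e]
  rfl

theorem hm_BD {n : Type*} {β : Q.V → ℕ} (k k' : n → BB Q β) (S : Finset n)
    (h : ∀ r, (k r).1 = (k' r).1) : IsBD (hm k k' S) := by
  intro s t hst
  simp only [hm, Matrix.of_apply]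
  refine Finset.sum_eq_zero (fun r _ => ?_)
  by_cases h1 : k r = s
  · by_cases h2 : k' r = t
    · exact absurd (by rw [← h1, ← h2, h]) hst
    · simp [h2]
  · simp [h1]

theorem card_C (α β : Q.V → ℕ) : ((Fintype.card (C0 Q α β) : ℤ) - Fintype.card (C1 Q α β))
    = ∑ x, Q.weightOf α x * β x := by
  rw [Fintype.card_sigma, Fintype.card_sigma, Fintype.sum_sigma, Fintype.sum_sigma]
  simp only [Fintype.card_fin, sum_const, card_univ, smul_eq_mul]
  unfold FinQuiver.weightOf
  simp only [sub_mul, Finset.sum_sub_distrib, Finset.sum_mul]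
  push_cast
  congr 1
  rw [Finset.sum_comm]
  refine Finset.sum_congr rfl (fun a _ => ?_)
  simp

theorem prod_zpow_sum {ι : Type*} (s : Finset ι) (c : ℂ) (hc : c ≠ 0) (k : ι → ℤ) :
    ∏ x ∈ s, c ^ k x = c ^ (∑ x ∈ s, k x) := by
  classical
  induction s using Finset.induction_on with
  | empty => simp
  | insert a s ha ih => rw [Finset.prod_insert ha, Finset.sum_insert ha, ih, zpow_add₀ hc]

theorem weight_zero {β : Q.V → ℕ} {σ : Q.V → ℤ} {f : Q.Rep β → ℂ} (hf : f ∈ Q.SIw β σ)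
    (h0 : f ≠ 0) : ∑ x, σ x * β x = 0 := by
  obtain ⟨_, hf⟩ := hf
  obtain ⟨W, hW⟩ := Function.ne_iff.1 h0
  let g : Q.GLb β := fun x => ⟨(2:ℂ) • 1, (2⁻¹:ℂ) • 1, by simp [smul_smul], by simp [smul_smul]⟩
  have h1 := hf g W
  have h2 : Q.invAct g W = W := by
    funext a
    unfold FinQuiver.invAct
    have e1 : ((g (Q.h a))⁻¹).val = (2⁻¹ : ℂ) • 1 := rfl
    have e2 : (g (Q.t a)).val = (2 : ℂ) • 1 := rfl
    rw [e1, e2]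
    simp [smul_smul]
  have h3 : Q.detWeight σ g = (2:ℂ) ^ (∑ x, σ x * β x) := by
    unfold FinQuiver.detWeight
    rw [← prod_zpow_sum _ _ (by norm_num)]
    refine Finset.prod_congr rfl (fun x _ => ?_)
    simp only [g, Matrix.det_smul, Matrix.det_one, mul_one, Fintype.card_fin]
    rw [mul_comm, zpow_mul, zpow_natCast]
  rw [h2, h3] at h1
  have h4 : (2:ℂ) ^ (∑ x, σ x * β x) = 1 := by
    have : ((2:ℂ) ^ (∑ x, σ x * β x) - 1) * f W = 0 := by rw [sub_mul, ← h1]; ring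
    rcases mul_eq_zero.1 this with h | h
    · exact sub_eq_zero.1 h
    · exact absurd h hW
  have h5 : (2:ℝ) ^ (∑ x, σ x * β x) = 1 := by
    have := congrArg norm h4
    rw [norm_zpow] at this
    simpa using this
  exact zpow_right_injective₀ (by norm_num : (0:ℝ) < 2) (by norm_num) (by simpa using h5)

theorem exists_e0 {α β : Q.V → ℕ} {f : Q.Rep β → ℂ} (hf : f ∈ Q.SIw β (Q.weightOf α))
    (h0 : f ≠ 0) : Nonempty (C1 Q α β ≃ C0 Q α β) := by
  have h1 := weight_zero hf h0
  have h2 := card_C α β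
  refine ⟨Fintype.equivOfCardEq ?_⟩
  omega

theorem span_Mv {α β : Q.V → ℕ} {f : Q.Rep β → ℂ} (hf : f ∈ Q.SIw β (Q.weightOf α))
    (e0 : C1 Q α β ≃ C0 Q α β) : ∃ m : Q.V → ℕ,
    f ∈ Submodule.span ℂ (Set.range fun v : Option Q.A → (P1 Q α ⊕ P0 Q m) → (P0 Q α ⊕ P0 Q m) → ℂ =>
      fun W => ((Mv v W).submatrix id (Equiv.sumCongr e0 (Equiv.refl (C0 Q m β)))).det) := by
  obtain ⟨⟨P, hP⟩, hf⟩ := hf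
  let N : ℕ := ∑ x, α x + ∑ m ∈ P.support, ∑ e, m e
  have hN' : ∀ x, α x ≤ N := fun x => by
    have := Finset.single_le_sum (f := α) (fun y _ => Nat.zero_le _) (mem_univ x)
    omega
  have hN : ∀ m ∈ P.support, ∑ e, m e ≤ N := fun m hm => by
    have := Finset.single_le_sum (f := fun m : VI Q β →₀ ℕ => ∑ e, m e)
      (fun y _ => Nat.zero_le _) hm
    exact le_trans this (Nat.le_add_left _ _)
  let m : Q.V → ℕ := fun x => N - α x
  let e := Equiv.sumCongr e0 (Equiv.refl (C0 Q m β))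
  refine ⟨m, ?_⟩
  have hcard : Fintype.card (C1 Q α β ⊕ C0 Q m β) = N * Fintype.card (BB Q β) := by
    rw [Fintype.card_congr e, Fintype.card_sum, Fintype.card_sigma, Fintype.card_sigma,
      Fintype.sum_sigma, Fintype.sum_sigma, Fintype.card_sigma, ← Finset.sum_add_distrib,
      Finset.mul_sum]
    refine Finset.sum_congr rfl (fun x _ => ?_)
    simp only [Fintype.card_fin, sum_const, card_univ, smul_eq_mul, m]
    rw [← add_mul, Nat.add_sub_cancel' (hN' x)]
  obtain ⟨c, hc⟩ := Fgen_words P N hN hcard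
  have key := lemmaA (WW := Q.Rep β) (brow (α := α) (m := m) (β := β)) krow
    (fun p => bcol (α := α) (m := m) (β := β) (e p)) (fun p => lcol (e p)) (by
      rintro (⟨s, i⟩ | ⟨s, i⟩) (⟨t, j⟩ | ⟨t, j⟩) h1 h2
      · simp only [brow, Sum.inl.injEq] at h1
        subst h1
        simp only [krow, Sigma.mk.injEq, heq_eq_eq, true_and] at h2
        rw [h2]
      · simp [brow] at h1
      · simp [brow] at h1
      · simp only [brow, Sum.inr.injEq] at h1
        subst h1
        simp only [krow, Sigma.mk.injEq, heq_eq_eq, true_and] at h2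
        rw [h2])
    (by
      intro p q
      suffices ∀ p q, bcol (α := α) (m := m) (β := β) p = bcol q →
          lcol p = lcol q → p = q from fun h1 h2 => e.injective (this _ _ h1 h2)
      rintro (⟨s, i⟩ | ⟨s, i⟩) (⟨t, j⟩ | ⟨t, j⟩) h1 h2
      · simp only [bcol, Sum.inl.injEq] at h1
        subst h1
        simp only [lcol, Sigma.mk.injEq, heq_eq_eq, true_and] at h2
        rw [h2]
      · simp [bcol] at h1
      · simp [bcol] at h1
      · simp only [bcol, Sum.inr.injEq] at h1
        subst h1
        simp only [lcol, Sigma.mk.injEq, heq_eq_eq, true_and] at h2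
        rw [h2]) c (fun W => XX W) IsBD IsBD
    (by
      intro π S hπ
      refine hm_BD _ _ _ (fun r => ?_)
      have hk : ∀ p q : C1 Q α β ⊕ C0 Q m β, brow p = brow q → (krow p).1 = (krow q).1 := by
        rintro (⟨s, i⟩ | ⟨s, i⟩) (⟨t, j⟩ | ⟨t, j⟩) h1
        · simp only [brow, Sum.inl.injEq] at h1
          simp [krow, h1]
        · simp [brow] at h1
        · simp [brow] at h1
        · simp only [brow, Sum.inr.injEq] at h1
          simp [krow, h1]
      exact hk _ _ (hπ r).symm)
    (by
      intro π S hπ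
      refine hm_BD _ _ _ (fun r => ?_)
      have hk : ∀ p q : C0 Q α β ⊕ C0 Q m β, bcol p = bcol q → (lcol p).1 = (lcol q).1 := by
        rintro (⟨s, i⟩ | ⟨s, i⟩) (⟨t, j⟩ | ⟨t, j⟩) h1
        · simp only [bcol, Sum.inl.injEq] at h1
          simp [lcol, h1]
        · simp [bcol] at h1
        · simp [bcol] at h1
        · simp only [bcol, Sum.inr.injEq] at h1
          simp [lcol, h1]
      exact hk _ _ (hπ r))
    (by
      intro W h g hh hg
      have hfW : f W = wsum c (XX W) := by
        rw [← hc, Fgen_one P N W, hP]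
        · rfl
        · intro a i j; exact hat_apply W a i j
      rw [← hc, Fgen_mul_right P N hN (fun a => h * XX W a), Fgen_all f P hP hf N hN hN' W h hh,
        hfW, chi_row, chi_equiv e, chi_col]
      have : g.det ^ N = (∏ s : P0 Q α, (blk g s.1).det) * ∏ s : P0 Q m, (blk g s.1).det := by
        rw [hg.det, Fintype.prod_sigma, Fintype.prod_sigma, ← Finset.prod_pow,
          ← Finset.prod_mul_distrib]
        refine Finset.prod_congr rfl (fun x _ => ?_)
        have hpc : ∀ (n : ℕ) (c : ℂ), ∏ _x : Fin n, c = c ^ n := by simp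
        change _ = (∏ _y : Fin (α x), (blk g x).det) * ∏ _y : Fin (m x), (blk g x).det
        rw [hpc, hpc]
        rw [← pow_add, Nat.add_sub_cancel' (hN' x)]
      rw [this]
      ring)
  have hfW : f = fun W => wsum c (XX W) := by
    funext W
    rw [← hc, Fgen_one P N W, hP]
    · rfl
    · intro a i j; exact hat_apply W a i j
  rw [hfW]
  exact key

end EmbThm


namespace EmbThm
open Finset
variable {Q : FinQuiver}

theorem interp {X n : Type*} [Fintype n] [DecidableEq n] (S : Submodule ℂ (X → ℂ))
    (A B : X → Matrix n n ℂ) (bad : Set ℂ) (hbad : bad.Finite)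
    (h : ∀ t, t ∉ bad → (fun x => (A x + t • B x).det) ∈ S) : (fun x => (A x).det) ∈ S := by
  obtain ⟨s, hs, hc⟩ := hbad.infinite_compl.exists_subset_card_eq (Fintype.card n + 1)
  let p : X → Polynomial ℂ := fun x =>
    ((Polynomial.X : Polynomial ℂ) • (B x).map Polynomial.C + (A x).map Polynomial.C).det
  have hp : ∀ x t, (p x).eval t = (A x + t • B x).det := by
    intro x t
    have h1 : (p x).eval t = Polynomial.evalRingHom t (p x) := rfl
    rw [h1, RingHom.map_det]
    congr 1
    ext i j
    simp [add_comm]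
    ring
  have hd : ∀ x, (p x).degree < s.card := by
    intro x
    rw [hc]
    refine lt_of_le_of_lt Polynomial.degree_le_natDegree ?_
    have := Polynomial.natDegree_det_X_add_C_le (B x) (A x)
    exact_mod_cast Nat.lt_succ_of_le this
  have hL : ∀ x, p x = Lagrange.interpolate s id (fun i => (p x).eval i) := fun x =>
    Lagrange.eq_interpolate (fun _ _ _ _ h => h) (hd x)
  have hfin : (fun x => (A x).det) = ∑ i ∈ s, ((Lagrange.basis s id i).eval 0) •
      (fun x => (A x + i • B x).det) := by
    funext x
    have h0 := hp x 0
    rw [zero_smul, add_zero] at h0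
    rw [← h0, hL x, Lagrange.interpolate_apply, Polynomial.eval_finsetSum, Finset.sum_apply]
    refine Finset.sum_congr rfl (fun i _ => ?_)
    simp [hp, mul_comm]
  rw [hfin]
  exact S.sum_mem (fun i hi => S.smul_mem _ (h i (hs hi)))

theorem sum_block {n S V B : Type*} [Fintype n] [Fintype S] [DecidableEq S] [DecidableEq B]
    (b : n → S) (k : n → B) (π : S → V) (κ : B → V)
    (h2 : ∀ s l, κ l = π s → ∃ p, b p = s ∧ k p = l)
    (hinj : ∀ p q, b p = b q → k p = k q → p = q) (R : S → ℂ) (l : B)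
    (hR : ∀ s, π s ≠ κ l → R s = 0) (G : S → B → ℂ) :
    ∑ p, (R (b p) * if l = k p then 1 else 0) * G (b p) (k p) = ∑ s, R s * G s l := by
  classical
  rw [← Finset.sum_fiberwise (s := univ) (g := b)]
  refine Finset.sum_congr rfl (fun s _ => ?_)
  by_cases hs : κ l = π s
  · obtain ⟨p, hp1, hp2⟩ := h2 s l hs
    rw [Finset.sum_eq_single p]
    · simp [hp1, hp2]
    · intro q hq hqp
      rw [Finset.mem_filter] at hq
      rw [if_neg, mul_zero, zero_mul]
      rintro h
      exact hqp (hinj _ _ (hq.2.trans hp1.symm) (h.symm.trans hp2.symm))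
    · intro h
      exact absurd (by simp [hp1]) h
  · rw [hR s (Ne.symm hs), zero_mul]
    refine Finset.sum_eq_zero (fun p hp => ?_)
    rw [Finset.mem_filter] at hp
    rw [hp.2, hR s (Ne.symm hs), zero_mul, zero_mul]

def pR {α m : Q.V → ℕ} : P1 Q α ⊕ P0 Q m → Q.V
  | .inl p => Q.h p.1
  | .inr p => p.1

def pC {α m : Q.V → ℕ} : P0 Q α ⊕ P0 Q m → Q.V
  | .inl p => p.1
  | .inr p => p.1

noncomputable def bigR {α m : Q.V → ℕ} (β : Q.V → ℕ)
    (R : Matrix (P1 Q α ⊕ P0 Q m) (P1 Q α ⊕ P0 Q m) ℂ) :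
    Matrix (C1 Q α β ⊕ C0 Q m β) (C1 Q α β ⊕ C0 Q m β) ℂ :=
  Matrix.of fun p p' => R (brow p) (brow p') * if krow p = krow p' then 1 else 0

noncomputable def bigC {α m : Q.V → ℕ} (β : Q.V → ℕ)
    (R : Matrix (P0 Q α ⊕ P0 Q m) (P0 Q α ⊕ P0 Q m) ℂ) :
    Matrix (C0 Q α β ⊕ C0 Q m β) (C0 Q α β ⊕ C0 Q m β) ℂ :=
  Matrix.of fun p p' => R (bcol p) (bcol p') * if lcol p' = lcol p then 1 else 0

theorem kr1 {α m β : Q.V → ℕ} (p : C1 Q α β ⊕ C0 Q m β) : (krow p).1 = pR (brow p) := by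
  rcases p with p | p <;> rfl

theorem kc1 {α m β : Q.V → ℕ} (p : C0 Q α β ⊕ C0 Q m β) : (lcol p).1 = pC (bcol p) := by
  rcases p with p | p <;> rfl

theorem brow_inj {α m β : Q.V → ℕ} (p q : C1 Q α β ⊕ C0 Q m β) (h1 : brow p = brow q)
    (h2 : krow p = krow q) : p = q := by
  rcases p with ⟨s, i⟩ | ⟨s, i⟩ <;> rcases q with ⟨t, j⟩ | ⟨t, j⟩
  · simp only [brow, Sum.inl.injEq] at h1
    subst h1
    simp only [krow, Sigma.mk.injEq, heq_eq_eq, true_and] at h2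
    rw [h2]
  · simp [brow] at h1
  · simp [brow] at h1
  · simp only [brow, Sum.inr.injEq] at h1
    subst h1
    simp only [krow, Sigma.mk.injEq, heq_eq_eq, true_and] at h2
    rw [h2]

theorem bcol_inj {α m β : Q.V → ℕ} (p q : C0 Q α β ⊕ C0 Q m β) (h1 : bcol p = bcol q)
    (h2 : lcol p = lcol q) : p = q := by
  rcases p with ⟨s, i⟩ | ⟨s, i⟩ <;> rcases q with ⟨t, j⟩ | ⟨t, j⟩
  · simp only [bcol, Sum.inl.injEq] at h1
    subst h1
    simp only [lcol, Sigma.mk.injEq, heq_eq_eq, true_and] at h2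
    rw [h2]
  · simp [bcol] at h1
  · simp [bcol] at h1
  · simp only [bcol, Sum.inr.injEq] at h1
    subst h1
    simp only [lcol, Sigma.mk.injEq, heq_eq_eq, true_and] at h2
    rw [h2]

theorem Mv_left {α m β : Q.V → ℕ} (v : Option Q.A → Matrix (P1 Q α ⊕ P0 Q m) (P0 Q α ⊕ P0 Q m) ℂ)
    (R : Matrix (P1 Q α ⊕ P0 Q m) (P1 Q α ⊕ P0 Q m) ℂ) (hR : ∀ s s', pR s ≠ pR s' → R s s' = 0)
    (W : Q.Rep β) : Mv (fun a => R * v a) W = bigR β R * Mv v W := by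
  ext p q
  have := sum_block (brow (α := α) (m := m) (β := β)) krow pR Sigma.fst (by
      rintro (s | s) ⟨x, i⟩ h
      · simp only [pR] at h
        subst h
        exact ⟨.inl ⟨s, i⟩, rfl, rfl⟩
      · simp only [pR] at h
        subst h
        exact ⟨.inr ⟨s, i⟩, rfl, rfl⟩) brow_inj (R (brow p)) (krow p) (by
      intro s hs
      refine hR _ _ ?_
      rw [← kr1]
      exact hs.symm) (fun s k => ∑ a, v a s (bcol q) * XX W a k (lcol q))
  simp only [Mv, bigR, Matrix.mul_apply, Matrix.of_apply]
  rw [this]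
  simp only [Finset.mul_sum, Finset.sum_mul]
  rw [Finset.sum_comm]
  simp only [mul_assoc]

theorem Mv_right {α m β : Q.V → ℕ} (v : Option Q.A → Matrix (P1 Q α ⊕ P0 Q m) (P0 Q α ⊕ P0 Q m) ℂ)
    (R : Matrix (P0 Q α ⊕ P0 Q m) (P0 Q α ⊕ P0 Q m) ℂ) (hR : ∀ s s', pC s ≠ pC s' → R s s' = 0)
    (W : Q.Rep β) : Mv (fun a => v a * R) W = Mv v W * bigC β R := by
  ext p q
  have := sum_block (bcol (α := α) (m := m) (β := β)) lcol pC Sigma.fst (by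
      rintro (s | s) ⟨x, i⟩ h
      · simp only [pC] at h
        subst h
        exact ⟨.inl ⟨s, i⟩, rfl, rfl⟩
      · simp only [pC] at h
        subst h
        exact ⟨.inr ⟨s, i⟩, rfl, rfl⟩) bcol_inj (fun s => R s (bcol q)) (lcol q) (by
      intro s hs
      refine hR _ _ ?_
      rw [← kc1]
      exact hs) (fun s k => ∑ a, v a (brow p) s * XX W a (krow p) k)
  simp only [Mv, bigC, Matrix.mul_apply, Matrix.of_apply]
  simp only [mul_comm (∑ a, v a _ _ * _)]
  rw [this]
  simp only [Finset.mul_sum, Finset.sum_mul]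
  rw [Finset.sum_comm]
  refine Finset.sum_congr rfl (fun a _ => Finset.sum_congr rfl (fun b _ => ?_))
  ring

/-- the determinant attached to a coefficient family -/
noncomputable def Dd {α m β : Q.V → ℕ} (e0 : C1 Q α β ≃ C0 Q α β)
    (v : Option Q.A → Matrix (P1 Q α ⊕ P0 Q m) (P0 Q α ⊕ P0 Q m) ℂ) (W : Q.Rep β) : ℂ :=
  ((Mv v W).submatrix id (Equiv.sumCongr e0 (Equiv.refl (C0 Q m β)))).det

theorem Dd_mul {α m β : Q.V → ℕ} (e0 : C1 Q α β ≃ C0 Q α β)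
    (v : Option Q.A → Matrix (P1 Q α ⊕ P0 Q m) (P0 Q α ⊕ P0 Q m) ℂ)
    (R : Matrix (P1 Q α ⊕ P0 Q m) (P1 Q α ⊕ P0 Q m) ℂ) (hR : ∀ s s', pR s ≠ pR s' → R s s' = 0)
    (C : Matrix (P0 Q α ⊕ P0 Q m) (P0 Q α ⊕ P0 Q m) ℂ) (hC : ∀ s s', pC s ≠ pC s' → C s s' = 0)
    (W : Q.Rep β) : Dd e0 (fun a => R * v a * C) W =
      ((bigR β R).det * (bigC β C).det) * Dd e0 v W := by
  unfold Dd
  rw [Mv_right _ C hC, Mv_left _ R hR]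
  set e := Equiv.sumCongr e0 (Equiv.refl (C0 Q m β))
  have : (bigR β R * Mv v W * bigC β C).submatrix id e
      = bigR β R * (Mv v W).submatrix id e * (bigC β C).submatrix e e := by
    rw [← Matrix.submatrix_mul_equiv _ _ id e e, ← Matrix.submatrix_mul_equiv _ _ id (Equiv.refl _) e]
    rfl
  rw [this, Matrix.det_mul, Matrix.det_mul, Matrix.det_submatrix_equiv_self]
  ring

/-- distinguished column -/
def colOf {α m : Q.V → ℕ} : P1 Q α ⊕ P0 Q m → P0 Q α ⊕ P0 Q m
  | .inl p => .inl ⟨Q.t p.1, p.2⟩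
  | .inr p => .inr p

def arrOf {α m : Q.V → ℕ} : P1 Q α ⊕ P0 Q m → Option Q.A
  | .inl p => some p.1
  | .inr _ => none

theorem colarr_inj {α m : Q.V → ℕ} (s s' : P1 Q α ⊕ P0 Q m) (h1 : colOf s = colOf s')
    (h2 : arrOf s = arrOf s') : s = s' := by
  rcases s with ⟨a, r⟩ | s <;> rcases s' with ⟨a', r'⟩ | s'
  · simp only [arrOf, Option.some.injEq] at h2
    subst h2
    simp only [colOf, Sum.inl.injEq, Sigma.mk.injEq, heq_eq_eq, true_and] at h1
    rw [h1]
  · simp [colOf] at h1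
  · simp [colOf] at h1
  · simpa [colOf] using h1

noncomputable def KK {α m : Q.V → ℕ} (v : Option Q.A → Matrix (P1 Q α ⊕ P0 Q m) (P0 Q α ⊕ P0 Q m) ℂ) :
    Matrix (P1 Q α ⊕ P0 Q m) (P1 Q α ⊕ P0 Q m) ℂ :=
  Matrix.of fun s s' => if pR s = pR s' then v (arrOf s') s (colOf s') else 0

theorem KK_mul {α m : Q.V → ℕ} (v : Option Q.A → Matrix (P1 Q α ⊕ P0 Q m) (P0 Q α ⊕ P0 Q m) ℂ)
    (R : Matrix (P1 Q α ⊕ P0 Q m) (P1 Q α ⊕ P0 Q m) ℂ) (hR : ∀ s s', pR s ≠ pR s' → R s s' = 0) :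
    KK (fun a => R * v a) = R * KK v := by
  ext s s'
  simp only [KK, Matrix.of_apply, Matrix.mul_apply]
  by_cases h : pR s = pR s'
  · rw [if_pos h]
    refine Finset.sum_congr rfl (fun s'' _ => ?_)
    by_cases h' : pR s = pR s''
    · rw [if_pos (h'.symm.trans h)]
    · rw [hR _ _ h', zero_mul, zero_mul]
  · rw [if_neg h]
    symm
    refine Finset.sum_eq_zero (fun s'' _ => ?_)
    by_cases h' : pR s = pR s''
    · rw [if_neg (fun h2 => h (h'.trans h2)), mul_zero]
    · rw [hR _ _ h', zero_mul]

structure Nrm {α m : Q.V → ℕ} (rk : Q.V → ℕ) (n : ℕ)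
    (v : Option Q.A → Matrix (P1 Q α ⊕ P0 Q m) (P0 Q α ⊕ P0 Q m) ℂ) : Prop where
  k1 : ∀ s s', rk (pR s) < n → KK v s s' = (1 : Matrix _ _ ℂ) s s'
  k2 : ∀ x j r, rk x < n → v none (.inr ⟨x, j⟩) (.inl ⟨x, r⟩) = 0

/-- inverse of a block diagonal matrix is block diagonal -/
theorem inv_block {S V : Type*} [Fintype S] [DecidableEq S] [DecidableEq V] (π : S → V)
    (K : Matrix S S ℂ) (hK : ∀ s s', π s ≠ π s' → K s s' = 0) (hdet : IsUnit K.det) :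
    ∀ s s', π s ≠ π s' → K⁻¹ s s' = 0 := by
  let R : Matrix S S ℂ := Matrix.of fun s s' => if π s = π s' then K⁻¹ s s' else 0
  have h1 : R * K = 1 := by
    ext s s'
    simp only [Matrix.mul_apply, R, Matrix.of_apply]
    by_cases h : π s = π s'
    · have h2 := congrFun (congrFun (Matrix.nonsing_inv_mul K hdet) s) s'
      rw [← h2, Matrix.mul_apply]
      refine Finset.sum_congr rfl (fun s'' _ => ?_)
      by_cases h' : π s = π s''
      · rw [if_pos h']
      · rw [if_neg h', hK s'' s' (fun h2 => h' (h.trans h2.symm)), mul_zero, mul_zero]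
    · rw [Matrix.one_apply_ne (fun h2 => h (by rw [h2]))]
      refine Finset.sum_eq_zero (fun s'' _ => ?_)
      by_cases h' : π s = π s''
      · rw [hK s'' s' (fun h2 => h (h'.trans h2)), mul_zero]
      · rw [if_neg h', zero_mul]
  have h2 : K⁻¹ = R := Matrix.inv_eq_left_inv h1
  intro s s' h
  rw [h2]
  simp [R, h]

end EmbThm


namespace EmbThm
open Finset
variable {Q : FinQuiver}

/-- column operation -/
noncomputable def LL {α m : Q.V → ℕ} (v : Option Q.A → Matrix (P1 Q α ⊕ P0 Q m) (P0 Q α ⊕ P0 Q m) ℂ) :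
    Matrix (P0 Q α ⊕ P0 Q m) (P0 Q α ⊕ P0 Q m) ℂ :=
  Matrix.fromBlocks 0 0 (Matrix.of fun p q => if p.1 = q.1 then v none (.inr p) (.inl q) else 0) 0

theorem LL_sq {α m : Q.V → ℕ} (v : Option Q.A → Matrix (P1 Q α ⊕ P0 Q m) (P0 Q α ⊕ P0 Q m) ℂ) :
    LL v * LL v = 0 := by
  simp [LL, Matrix.fromBlocks_multiply, ← Matrix.fromBlocks_zero]

theorem LL_block {α m : Q.V → ℕ} (v : Option Q.A → Matrix (P1 Q α ⊕ P0 Q m) (P0 Q α ⊕ P0 Q m) ℂ)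
    (s s' : P0 Q α ⊕ P0 Q m) (h : pC s ≠ pC s') : LL v s s' = 0 := by
  rcases s with s | s <;> rcases s' with s' | s' <;> simp only [LL, Matrix.fromBlocks_apply₁₁,
    Matrix.fromBlocks_apply₁₂, Matrix.fromBlocks_apply₂₁, Matrix.fromBlocks_apply₂₂, Matrix.zero_apply]
  exact if_neg h

theorem mul_LL_inr {α m : Q.V → ℕ} (v : Option Q.A → Matrix (P1 Q α ⊕ P0 Q m) (P0 Q α ⊕ P0 Q m) ℂ)
    (w : Matrix (P1 Q α ⊕ P0 Q m) (P0 Q α ⊕ P0 Q m) ℂ) (s) (q : P0 Q m) :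
    (w * LL v) s (.inr q) = 0 := by
  rw [Matrix.mul_apply]
  refine Finset.sum_eq_zero (fun t _ => ?_)
  rcases t with t | t <;> simp [LL]

theorem mul_LL_inl {α m : Q.V → ℕ} (v : Option Q.A → Matrix (P1 Q α ⊕ P0 Q m) (P0 Q α ⊕ P0 Q m) ℂ)
    (w : Matrix (P1 Q α ⊕ P0 Q m) (P0 Q α ⊕ P0 Q m) ℂ) (s) (q : P0 Q α) :
    (w * LL v) s (.inl q) =
      ∑ p : P0 Q m, w s (.inr p) * (if p.1 = q.1 then v none (.inr p) (.inl q) else 0) := by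
  rw [Matrix.mul_apply, Fintype.sum_sum_type]
  simp [LL]

theorem step_inv {α m β : Q.V → ℕ} (e0 : C1 Q α β ≃ C0 Q α β) (rk : Q.V → ℕ)
    (hrk : ∀ a, rk (Q.t a) < rk (Q.h a)) (n : ℕ)
    (v : Option Q.A → Matrix (P1 Q α ⊕ P0 Q m) (P0 Q α ⊕ P0 Q m) ℂ) (hv : Nrm rk n v)
    (hK : IsUnit (KK v).det) : ∃ (c : ℂ)
      (v' : Option Q.A → Matrix (P1 Q α ⊕ P0 Q m) (P0 Q α ⊕ P0 Q m) ℂ), Nrm rk (n+1) v' ∧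
      ∀ W : Q.Rep β, Dd e0 v W = c * Dd e0 v' W := by
  have hKb : ∀ s s', pR s ≠ pR s' → KK v s s' = 0 := by
    intro s s' h
    simp [KK, h]
  have hKi := inv_block pR (KK v) hKb hK
  let v1 : Option Q.A → Matrix (P1 Q α ⊕ P0 Q m) (P0 Q α ⊕ P0 Q m) ℂ := fun a => (KK v)⁻¹ * v a
  have hK1 : KK v1 = 1 := by
    rw [KK_mul v _ hKi, Matrix.nonsing_inv_mul _ hK]
  have hrow : ∀ s s', rk (pR s) < n → (KK v)⁻¹ s s' = (1 : Matrix (P1 Q α ⊕ P0 Q m) (P1 Q α ⊕ P0 Q m) ℂ) s s' := by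
    intro s s' hs
    have h1 := congrFun (congrFun (Matrix.mul_nonsing_inv _ hK) s) s'
    rw [← h1, Matrix.mul_apply]
    simp only [hv.k1 s _ hs]
    rw [← Matrix.mul_apply, Matrix.one_mul]
  have hk2 : ∀ x j r, rk x < n → v1 none (.inr ⟨x, j⟩) (.inl ⟨x, r⟩) = 0 := by
    intro x j r hx
    simp only [v1, Matrix.mul_apply]
    have : ∀ s', (KK v)⁻¹ (.inr ⟨x, j⟩) s' = (1 : Matrix (P1 Q α ⊕ P0 Q m) (P1 Q α ⊕ P0 Q m) ℂ) (.inr ⟨x, j⟩) s' :=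
      fun s' => hrow _ _ hx
    simp only [this]
    rw [← Matrix.mul_apply, Matrix.one_mul]
    exact hv.k2 x j r hx
  let v2 : Option Q.A → Matrix (P1 Q α ⊕ P0 Q m) (P0 Q α ⊕ P0 Q m) ℂ := fun a => v1 a * (1 - LL v1)
  have hv2 : ∀ a, v a = KK v * v2 a * (1 + LL v1) := by
    intro a
    have h1 : (1 - LL v1) * (1 + LL v1) = 1 := by
      have := LL_sq v1
      rw [sub_mul, mul_add, mul_add, this]
      simp
    simp only [v2, v1] at h1 ⊢
    rw [Matrix.mul_assoc, Matrix.mul_assoc, h1, Matrix.mul_one, ← Matrix.mul_assoc,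
      Matrix.mul_nonsing_inv _ hK, Matrix.one_mul]
  have hrr : ∀ s x j, pR s = x → v1 none s (.inr ⟨x, j⟩) = (1 : Matrix (P1 Q α ⊕ P0 Q m) (P1 Q α ⊕ P0 Q m) ℂ) s (.inr ⟨x, j⟩) := by
    intro s x j hs
    have := congrFun (congrFun hK1 s) (.inr ⟨x, j⟩)
    rw [← this]
    simp only [KK, Matrix.of_apply]
    exact (if_pos hs).symm
  refine ⟨(bigR β (KK v)).det * (bigC β (1 + LL v1)).det, v2, ⟨?_, ?_⟩, fun W => ?_⟩
  · intro s s' hs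
    rw [← hK1]
    simp only [KK, Matrix.of_apply]
    by_cases h : pR s = pR s'
    · rw [if_pos h, if_pos h]
      simp only [v2, Matrix.mul_sub, Matrix.mul_one, Matrix.sub_apply]
      rw [sub_eq_self]
      rcases s' with ⟨a, r⟩ | s'
      · simp only [colOf, mul_LL_inl]
        refine Finset.sum_eq_zero (fun p _ => ?_)
        split_ifs with hp
        · obtain ⟨x, j⟩ := p
          simp only at hp
          subst hp
          have h3 := hrk a
          have h4 : pR (Sum.inl ⟨a, r⟩ : P1 Q α ⊕ P0 Q m) = Q.h a := rfl
          rw [h, h4] at hs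
          rw [hk2 _ _ _ (by omega), mul_zero]
        · rw [mul_zero]
      · exact mul_LL_inr _ _ _ _
    · rw [if_neg h, if_neg h]
  · intro x j r _
    simp only [v2, Matrix.mul_sub, Matrix.mul_one, Matrix.sub_apply]
    rw [sub_eq_zero, mul_LL_inl, Finset.sum_eq_single ⟨x, j⟩]
    · rw [hrr (Sum.inr ⟨x, j⟩) x j rfl]
      simp
    · rintro ⟨y, j'⟩ _ hne
      split_ifs with hp
      · simp only at hp
        subst hp
        rw [hrr (Sum.inr ⟨y, j⟩) y j' rfl, Matrix.one_apply_ne, zero_mul]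
        simpa using hne.symm
      · rw [mul_zero]
    · simp
  · have : v = fun a => KK v * v2 a * (1 + LL v1) := funext hv2
    conv_lhs => rw [this]
    refine Dd_mul e0 v2 (KK v) hKb (1 + LL v1) ?_ W
    intro s s' h
    rw [Matrix.add_apply, LL_block _ _ _ h, Matrix.one_apply_ne (fun h' => h (by rw [h'])), add_zero]

theorem Mv_add_smul {α m β : Q.V → ℕ}
    (v w : Option Q.A → Matrix (P1 Q α ⊕ P0 Q m) (P0 Q α ⊕ P0 Q m) ℂ) (t : ℂ) (W : Q.Rep β) :
    Mv (fun a => v a + t • w a) W = Mv v W + t • Mv w W := by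
  ext p q
  simp only [Mv, Matrix.of_apply, Matrix.add_apply, Matrix.smul_apply, smul_eq_mul, add_mul,
    Finset.sum_add_distrib, Finset.mul_sum, mul_assoc]

theorem step_gen {α m β : Q.V → ℕ} (e0 : C1 Q α β ≃ C0 Q α β) (rk : Q.V → ℕ)
    (hrk : ∀ a, rk (Q.t a) < rk (Q.h a)) (n : ℕ)
    (v : Option Q.A → Matrix (P1 Q α ⊕ P0 Q m) (P0 Q α ⊕ P0 Q m) ℂ) (hv : Nrm rk n v) :
    (Dd e0 v : Q.Rep β → ℂ) ∈ Submodule.span ℂ (Set.image (fun v W => Dd e0 v W)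
      {v : Option Q.A → Matrix (P1 Q α ⊕ P0 Q m) (P0 Q α ⊕ P0 Q m) ℂ | Nrm rk (n+1) v}) := by
  let w : Option Q.A → Matrix (P1 Q α ⊕ P0 Q m) (P0 Q α ⊕ P0 Q m) ℂ := fun a =>
    Matrix.of fun s q => if n ≤ rk (pR s) ∧ arrOf s = a ∧ colOf s = q then 1 else 0
  let J : Matrix (P1 Q α ⊕ P0 Q m) (P1 Q α ⊕ P0 Q m) ℂ :=
    Matrix.diagonal fun s => if n ≤ rk (pR s) then 1 else 0
  have hwK : ∀ t : ℂ, KK (fun a => v a + t • w a) = KK v + t • J := by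
    intro t
    ext s s'
    simp only [KK, Matrix.of_apply, Matrix.add_apply, Matrix.smul_apply, w, J, Matrix.diagonal_apply]
    by_cases h : pR s = pR s'
    · rw [if_pos h, if_pos h]
      by_cases h' : s = s'
      · subst h'; simp
      · have : ¬ (n ≤ rk (pR s) ∧ arrOf s = arrOf s' ∧ colOf s = colOf s') :=
          fun h2 => h' (colarr_inj _ _ h2.2.2 h2.2.1)
        rw [if_neg this, if_neg h']
    · have h' : s ≠ s' := fun h2 => h (by rw [h2])
      rw [if_neg h, if_neg h, if_neg h']
      simp
  have hN : ∀ t : ℂ, Nrm rk n (fun a => v a + t • w a) := by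
    intro t
    refine ⟨fun s s' hs => ?_, fun x j r hx => ?_⟩
    · rw [hwK, Matrix.add_apply, hv.k1 s s' hs]
      simp [J, Matrix.diagonal_apply, not_le.2 hs]
    · simp only [Matrix.add_apply, Matrix.smul_apply, w, Matrix.of_apply]
      rw [if_neg, hv.k2 x j r hx]
      · simp
      · rintro ⟨h1, -⟩
        exact absurd hx (not_lt.2 h1)
  have hbad : {t : ℂ | ¬ IsUnit (KK (fun a => v a + t • w a)).det}.Finite := by
    have hsub : {t : ℂ | ¬ IsUnit (KK (fun a => v a + t • w a)).det} ⊆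
        {t | ((-(KK v)).charpoly).IsRoot t} ∪ {0} := by
      intro t ht
      simp only [Set.mem_union, Set.mem_ofPred_eq, Set.mem_singleton_iff, isUnit_iff_ne_zero, ne_eq,
        not_not] at ht ⊢
      left
      by_contra hne
      have hu : (KK v + t • (1 : Matrix (P1 Q α ⊕ P0 Q m) (P1 Q α ⊕ P0 Q m) ℂ)).det ≠ 0 := by
        intro h
        apply hne
        rw [Polynomial.IsRoot.def, Matrix.eval_charpoly, ← h]
        congr 1
        simp only [Matrix.scalar_apply, sub_neg_eq_add]
        rw [add_comm, Matrix.smul_one_eq_diagonal]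
      rw [hwK] at ht
      obtain ⟨z, hz0, hz⟩ := Matrix.exists_mulVec_eq_zero_iff.2 ht
      apply hu
      refine Matrix.exists_mulVec_eq_zero_iff.1 ⟨z, hz0, ?_⟩
      funext s
      have hzs := congrFun hz s
      rw [Matrix.add_mulVec, Matrix.smul_mulVec, Pi.add_apply, Pi.smul_apply, Matrix.mulVec_diagonal]
        at hzs
      rw [Matrix.add_mulVec, Matrix.smul_mulVec, Pi.add_apply, Pi.smul_apply, Matrix.one_mulVec]
      by_cases hs : n ≤ rk (pR s)
      · rw [if_pos hs, one_mul] at hzs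
        exact hzs
      · rw [if_neg hs, zero_mul, smul_zero, add_zero] at hzs
        have h3 : (KK v).mulVec z s = z s := by
          have h4 : (KK v).mulVec z s = (1 : Matrix (P1 Q α ⊕ P0 Q m) (P1 Q α ⊕ P0 Q m) ℂ).mulVec z s := by
            simp only [Matrix.mulVec, dotProduct, hv.k1 s _ (not_le.1 hs)]
          rw [h4, Matrix.one_mulVec]
        rw [hzs, ← h3, hzs]
        simp
    exact ((Polynomial.finite_setOfPred_isRoot (Matrix.charpoly_monic _).ne_zero).union
      (Set.finite_singleton _)).subset hsub
  have := interp (Submodule.span ℂ (Set.image (fun v W => Dd e0 v W)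
      {v : Option Q.A → Matrix (P1 Q α ⊕ P0 Q m) (P0 Q α ⊕ P0 Q m) ℂ | Nrm rk (n+1) v}))
      (fun W : Q.Rep β => (Mv v W).submatrix id (Equiv.sumCongr e0 (Equiv.refl (C0 Q m β))))
      (fun W : Q.Rep β => (Mv w W).submatrix id (Equiv.sumCongr e0 (Equiv.refl (C0 Q m β))))
      _ hbad (by
        intro t ht
        simp only [Set.mem_ofPred_eq, not_not] at ht
        obtain ⟨c, v', hv', h⟩ := step_inv e0 rk hrk n _ (hN t) ht
        have h2 : (fun W : Q.Rep β => ((Mv v W).submatrix id (Equiv.sumCongr e0 (Equiv.refl (C0 Q m β)))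
          + t • (Mv w W).submatrix id (Equiv.sumCongr e0 (Equiv.refl (C0 Q m β)))).det)
          = c • (fun W => Dd e0 v' W) := by
          funext W
          rw [Pi.smul_apply, smul_eq_mul, ← h W]
          unfold Dd
          rw [Mv_add_smul]
          rfl
        rw [h2]
        exact Submodule.smul_mem _ _ (Submodule.subset_span ⟨v', hv', rfl⟩))
  exact this

end EmbThm


namespace EmbThm
open Finset
variable {Q : FinQuiver}

/-- matrix of the map `φ ↦ φ V - W φ` -/
noncomputable def dmat {α β : Q.V → ℕ} (V : Q.Rep α) (W : Q.Rep β) :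
    Matrix (C1 Q α β) (C0 Q α β) ℂ :=
  Matrix.of fun p q =>
    hat V p.1.1 q.1 ⟨Q.t p.1.1, p.1.2⟩ *
      (if (⟨Q.h p.1.1, p.2⟩ : BB Q β) = ⟨q.1.1, q.2⟩ then 1 else 0) -
    (if q.1 = ⟨Q.t p.1.1, p.1.2⟩ then 1 else 0) * hat W p.1.1 ⟨Q.h p.1.1, p.2⟩ ⟨q.1.1, q.2⟩

noncomputable def cV {α β : Q.V → ℕ} (e0 : C1 Q α β ≃ C0 Q α β) (V : Q.Rep α) (W : Q.Rep β) : ℂ :=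
  ((dmat V W).submatrix id e0).det

theorem Dd_full {α m β : Q.V → ℕ} (e0 : C1 Q α β ≃ C0 Q α β) (rk : Q.V → ℕ)
    (hrk : ∀ a, rk (Q.t a) < rk (Q.h a)) (n : ℕ) (hn : ∀ x, rk x < n)
    (v : Option Q.A → Matrix (P1 Q α ⊕ P0 Q m) (P0 Q α ⊕ P0 Q m) ℂ) (hv : Nrm rk n v) :
    ∃ (c : ℂ) (V : Q.Rep α), ∀ W : Q.Rep β, Dd e0 v W = c * cV e0 V W := by
  have hK : ∀ s s', pR s = pR s' → v (arrOf s') s (colOf s')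
      = (1 : Matrix (P1 Q α ⊕ P0 Q m) (P1 Q α ⊕ P0 Q m) ℂ) s s' := by
    intro s s' h
    rw [← hv.k1 s s' (hn _)]
    simp [KK, h]
  let V : Q.Rep α := fun a => Matrix.of fun r' r => - v none (.inl ⟨a, r⟩) (.inl ⟨Q.h a, r'⟩)
  refine ⟨(-1) ^ Fintype.card (C1 Q α β), V, fun W => ?_⟩
  have h21 : ∀ p q, Mv v W (.inr p) (.inl q) = 0 := by
    rintro ⟨⟨x, j⟩, i⟩ ⟨⟨y, r⟩, k⟩
    simp only [Mv, Matrix.of_apply, brow, bcol, krow, lcol]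
    refine Finset.sum_eq_zero (fun a _ => ?_)
    rcases a with _ | a
    · simp only [XX]
      by_cases h : x = y
      · subst h
        rw [hv.k2 _ _ _ (hn _), zero_mul]
      · rw [Matrix.one_apply_ne, mul_zero]
        intro h'
        exact h (congrArg Sigma.fst h')
    · simp only [XX]
      by_cases h : x = Q.h a ∧ y = Q.t a
      · obtain ⟨rfl, rfl⟩ := h
        have := hK (.inr ⟨Q.h a, j⟩) (.inl ⟨a, r⟩) rfl
        simp only [arrOf, colOf] at this
        rw [this, Matrix.one_apply_ne (by simp), zero_mul]
      · rw [hat_zero _ _ _ _ h, mul_zero]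
  have h22 : (Matrix.of fun p q => Mv v W (.inr p) (.inr q)).det = 1 := by
    have hdiag : ∀ (x y : Q.V) (j : Fin (m x)) (i : Fin (β x)) (r : Fin (m y)) (k : Fin (β y)),
        rk x ≤ rk y → Mv v W (.inr ⟨⟨x, j⟩, i⟩) (.inr ⟨⟨y, r⟩, k⟩) =
        (1 : Matrix (C0 Q m β) (C0 Q m β) ℂ) ⟨⟨x, j⟩, i⟩ ⟨⟨y, r⟩, k⟩ := by
      intro x y j i r k hxy
      simp only [Mv, Matrix.of_apply, brow, bcol, krow, lcol]
      rw [Fintype.sum_option, Finset.sum_eq_zero, add_zero]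
      · simp only [XX]
        by_cases h : x = y
        · subst h
          have := hK (.inr ⟨x, j⟩) (.inr ⟨x, r⟩) rfl
          simp only [arrOf, colOf] at this
          rw [this]
          by_cases hj : j = r
          · subst hj
            by_cases hi : i = k
            · subst hi; simp
            · rw [Matrix.one_apply_eq, one_mul,
                Matrix.one_apply_ne (fun h => hi (by simpa using h)),
                Matrix.one_apply_ne (fun h => hi (by simpa using h))]
          · rw [Matrix.one_apply_ne (fun h => hj (by simpa using h)), zero_mul,
              Matrix.one_apply_ne]
            intro h
            simp only [Sigma.mk.injEq, heq_eq_eq, true_and] at h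
            exact hj h.1
        · rw [Matrix.one_apply_ne (fun h' => h (congrArg Sigma.fst h')), mul_zero, Matrix.one_apply_ne]
          intro h'
          exact h (congrArg (fun z => z.1.1) h')
      · intro a _
        simp only [XX]
        rw [hat_zero, mul_zero]
        rintro ⟨rfl, rfl⟩
        have := hrk a
        omega
    have hbt : (Matrix.of fun p q => Mv v W (.inr p) (.inr q)).BlockTriangular
        (fun p : C0 Q m β => OrderDual.toDual (rk p.1.1)) := by
      rintro ⟨⟨x, j⟩, i⟩ ⟨⟨y, r⟩, k⟩ h
      have h' : rk x < rk y := h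
      rw [Matrix.of_apply, hdiag _ _ _ _ _ _ h'.le, Matrix.one_apply_ne]
      rintro h2
      have h3 := congrArg (fun z => rk z.1.1) h2
      simp only at h3
      omega
    rw [hbt.det]
    refine Finset.prod_eq_one (fun z _ => ?_)
    have : (Matrix.of fun p q => Mv v W (.inr p) (.inr q)).toSquareBlock
        (fun p : C0 Q m β => OrderDual.toDual (rk p.1.1)) z = 1 := by
      ext ⟨⟨⟨x, j⟩, i⟩, hx⟩ ⟨⟨⟨y, r⟩, k⟩, hy⟩
      have h' : rk x ≤ rk y := by
        have := hx.trans hy.symm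
        exact le_of_eq this
      simp only [Matrix.toSquareBlock_def, Matrix.of_apply]
      rw [hdiag _ _ _ _ _ _ h', Matrix.one_apply, Matrix.one_apply]
      simp only [Subtype.mk.injEq]
    rw [this, Matrix.det_one]
  have h11 : ∀ p q, Mv v W (.inl p) (.inl q) = - dmat V W p q := by
    rintro ⟨⟨a, r⟩, i⟩ ⟨⟨y, r'⟩, j⟩
    simp only [Mv, Matrix.of_apply, brow, bcol, krow, lcol, dmat]
    rw [Fintype.sum_option, neg_sub, sub_eq_neg_add]
    congr 1
    · simp only [XX]
      rw [Matrix.one_apply, ← neg_mul]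
      by_cases h : (⟨Q.h a, i⟩ : BB Q β) = ⟨y, j⟩
      · rw [if_pos h, mul_one, mul_one]
        have h1 := congrArg Sigma.fst h
        simp only at h1
        subst h1
        rw [hat_apply]
        simp [V]
      · rw [if_neg h, mul_zero, mul_zero]
    · simp only [XX]
      rw [Finset.sum_eq_single a]
      · by_cases h : y = Q.t a
        · subst h
          have := hK (.inl ⟨a, r⟩) (.inl ⟨a, r'⟩) rfl
          simp only [arrOf, colOf] at this
          rw [this]
          congr 1
          rw [Matrix.one_apply]
          simp only [Sum.inl.injEq, Sigma.mk.injEq, heq_eq_eq, true_and]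
          simp only [eq_comm]
        · rw [hat_zero _ _ _ _ (fun h' => h h'.2), mul_zero, mul_zero]
      · intro b _ hb
        by_cases h : Q.h a = Q.h b ∧ y = Q.t b
        · obtain ⟨h1, rfl⟩ := h
          have := hK (.inl ⟨a, r⟩) (.inl ⟨b, r'⟩) h1
          simp only [arrOf, colOf] at this
          rw [this, Matrix.one_apply_ne, zero_mul]
          intro h2
          simp only [Sum.inl.injEq, Sigma.mk.injEq] at h2
          exact hb h2.1.symm
        · rw [hat_zero _ _ _ _ h, mul_zero]
      · simp
  unfold Dd cV
  have hfb : (Mv v W).submatrix id (Equiv.sumCongr e0 (Equiv.refl (C0 Q m β))) =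
      Matrix.fromBlocks (-((dmat V W).submatrix id e0))
        (Matrix.of fun p q => Mv v W (.inl p) (.inr q)) 0
        (Matrix.of fun p q => Mv v W (.inr p) (.inr q)) := by
    ext p q
    rcases p with p | p <;> rcases q with q | q
    · simp [h11]
    · simp
    · simp [h21]
    · simp
  rw [hfb, Matrix.det_fromBlocks_zero₂₁, h22, mul_one, Matrix.det_neg]

theorem span_cV {α β : Q.V → ℕ} (rk : Q.V → ℕ)
    (hrk : ∀ a, rk (Q.t a) < rk (Q.h a)) {f : Q.Rep β → ℂ} (hf : f ∈ Q.SIw β (Q.weightOf α))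
    (e0 : C1 Q α β ≃ C0 Q α β) :
    f ∈ Submodule.span ℂ (Set.range fun V : Q.Rep α => fun W => cV e0 V W) := by
  obtain ⟨m, hm⟩ := span_Mv hf e0
  have hn : ∀ x, rk x < ∑ y, rk y + 1 := by
    intro x
    have := Finset.single_le_sum (f := rk) (fun y _ => Nat.zero_le _) (mem_univ x)
    omega
  have key : ∀ (k n : ℕ), n + k = ∑ y, rk y + 1 → ∀ v : Option Q.A → Matrix (P1 Q α ⊕ P0 Q m)
      (P0 Q α ⊕ P0 Q m) ℂ, Nrm rk n v → (Dd e0 v : Q.Rep β → ℂ) ∈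
      Submodule.span ℂ (Set.range fun V : Q.Rep α => fun W => cV e0 V W) := by
    intro k
    induction k with
    | zero =>
      intro n hnk v hv
      obtain ⟨c, V, hc⟩ := Dd_full e0 rk hrk n (by intro x; have := hn x; omega) v hv
      have : (Dd e0 v : Q.Rep β → ℂ) = c • fun W => cV e0 V W := by
        funext W; exact hc W
      rw [this]
      exact Submodule.smul_mem _ _ (Submodule.subset_span ⟨V, rfl⟩)
    | succ k ih =>
      intro n hnk v hv
      have := step_gen (β := β) e0 rk hrk n v hv
      refine Submodule.span_le.2 ?_ this
      rintro _ ⟨v', hv', rfl⟩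
      exact ih (n+1) (by omega) v' hv'
  refine Submodule.span_le.2 ?_ hm
  rintro _ ⟨v, rfl⟩
  exact key _ 0 (zero_add _) v ⟨fun s s' h => absurd h (Nat.not_lt_zero _),
    fun x j r h => absurd h (Nat.not_lt_zero _)⟩

end EmbThm


namespace EmbThm
open Finset
variable {Q : FinQuiver}

abbrev H0 (Q : FinQuiver) (α β : Q.V → ℕ) : Type := ∀ x : Q.V, Matrix (Fin (β x)) (Fin (α x)) ℂ
abbrev H1 (Q : FinQuiver) (α β : Q.V → ℕ) : Type :=
  ∀ a : Q.A, Matrix (Fin (β (Q.h a))) (Fin (α (Q.t a))) ℂ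

/-- the map `φ ↦ φ V - W φ` -/
noncomputable def dl {α β : Q.V → ℕ} (V : Q.Rep α) (W : Q.Rep β) : H0 Q α β →ₗ[ℂ] H1 Q α β where
  toFun φ a := φ (Q.h a) * V a - W a * φ (Q.t a)
  map_add' φ ψ := by
    funext a
    simp only [Pi.add_apply, Matrix.add_mul, Matrix.mul_add]
    abel
  map_smul' c φ := by
    funext a
    simp [smul_sub]

theorem dl_apply {α β : Q.V → ℕ} (V : Q.Rep α) (W : Q.Rep β) (φ : H0 Q α β) (a : Q.A) :
    dl V W φ a = φ (Q.h a) * V a - W a * φ (Q.t a) := rfl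

def vec0 (Q : FinQuiver) (α β : Q.V → ℕ) : H0 Q α β ≃ₗ[ℂ] (C0 Q α β → ℂ) where
  toFun φ q := φ q.1.1 q.2 q.1.2
  invFun z x := Matrix.of fun i j => z ⟨⟨x, j⟩, i⟩
  map_add' _ _ := rfl
  map_smul' _ _ := rfl
  left_inv _ := rfl
  right_inv _ := rfl

def vec1 (Q : FinQuiver) (α β : Q.V → ℕ) : H1 Q α β ≃ₗ[ℂ] (C1 Q α β → ℂ) where
  toFun φ q := φ q.1.1 q.2 q.1.2
  invFun z x := Matrix.of fun i j => z ⟨⟨x, j⟩, i⟩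
  map_add' _ _ := rfl
  map_smul' _ _ := rfl
  left_inv _ := rfl
  right_inv _ := rfl

theorem vec0_apply {α β : Q.V → ℕ} (φ : H0 Q α β) (q : C0 Q α β) :
    vec0 Q α β φ q = φ q.1.1 q.2 q.1.2 := rfl

theorem vec1_apply {α β : Q.V → ℕ} (φ : H1 Q α β) (q : C1 Q α β) :
    vec1 Q α β φ q = φ q.1.1 q.2 q.1.2 := rfl

theorem dmat_mulVec {α β : Q.V → ℕ} (V : Q.Rep α) (W : Q.Rep β) (φ : H0 Q α β) :
    (dmat V W).mulVec (vec0 Q α β φ) = vec1 Q α β (dl V W φ) := by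
  funext ⟨⟨a, r⟩, i⟩
  simp only [Matrix.mulVec, dotProduct, dmat, Matrix.of_apply, vec0_apply, vec1_apply, sub_mul, Finset.sum_sub_distrib, dl_apply, Matrix.sub_apply]
  congr 1
  · rw [Fintype.sum_sigma, Fintype.sum_sigma, Finset.sum_eq_single (Q.h a)]
    · rw [Matrix.mul_apply]
      refine Finset.sum_congr rfl (fun q _ => ?_)
      rw [Finset.sum_eq_single i]
      · rw [hat_apply]; simp [mul_comm]
      · intro j _ hj
        rw [if_neg]
        · simp
        · intro h
          simp only [Sigma.mk.injEq, heq_eq_eq, true_and] at h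
          exact hj h.symm
      · simp
    · intro x _ hx
      refine Finset.sum_eq_zero (fun q _ => Finset.sum_eq_zero (fun j _ => ?_))
      rw [if_neg]
      · simp
      · intro h
        exact hx (congrArg Sigma.fst h).symm
    · simp
  · rw [Fintype.sum_sigma, Finset.sum_eq_single ⟨Q.t a, r⟩]
    · rw [Matrix.mul_apply]
      refine Finset.sum_congr rfl (fun j _ => ?_)
      rw [hat_apply]; simp
    · intro x _ hx
      refine Finset.sum_eq_zero (fun j _ => ?_)
      rw [if_neg hx]; simp
    · simp

theorem dmat_ext {α β : Q.V → ℕ} (M N : Matrix (C1 Q α β) (C0 Q α β) ℂ)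
    (h : ∀ φ : H0 Q α β, M.mulVec (vec0 Q α β φ) = N.mulVec (vec0 Q α β φ)) : M = N := by
  refine Matrix.mulVec_injective ?_
  funext z
  have := h ((vec0 Q α β).symm z)
  simpa using this

theorem dl_inj_iff {α β : Q.V → ℕ} (V : Q.Rep α) (W : Q.Rep β) (e0 : C1 Q α β ≃ C0 Q α β) :
    cV e0 V W ≠ 0 ↔ Function.Injective (dl V W) := by
  have h1 : Function.Injective (dl V W) ↔ ∀ φ, dl V W φ = 0 → φ = 0 :=
    injective_iff_map_eq_zero _
  rw [h1, ne_eq, cV, ← Matrix.exists_mulVec_eq_zero_iff, not_exists]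
  have h2 : ∀ z : C1 Q α β → ℂ, ((dmat V W).submatrix id e0).mulVec z
      = vec1 Q α β (dl V W ((vec0 Q α β).symm (z ∘ e0.symm))) := by
    intro z
    rw [← dmat_mulVec, LinearEquiv.apply_symm_apply]
    rw [Matrix.submatrix_mulVec_equiv]
    rfl
  constructor
  · intro h φ hφ
    by_contra hne
    refine h (vec0 Q α β φ ∘ e0) ⟨?_, ?_⟩
    · intro h0
      apply hne
      apply (vec0 Q α β).injective
      rw [map_zero]
      funext q
      have := congrFun h0 (e0.symm q)
      simpa using this
    · rw [h2]
      have : (vec0 Q α β φ ∘ e0) ∘ e0.symm = vec0 Q α β φ := by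
        funext q; simp
      rw [this, LinearEquiv.symm_apply_apply, hφ, map_zero]
  · rintro h z ⟨hz, h0⟩
    rw [h2] at h0
    have := h _ ((vec1 Q α β).injective (by rw [h0, map_zero]))
    apply hz
    have h3 : z ∘ e0.symm = 0 := (vec0 Q α β).symm.injective (by rw [this, map_zero])
    funext p
    have := congrFun h3 (e0 p)
    simpa using this

/-! polynomial functions -/

section poly
variable {β : Q.V → ℕ}

theorem pf_const (c : ℂ) : Q.IsPolyFun (fun _ : Q.Rep β => c) := ⟨MvPolynomial.C c, fun W => by simp⟩

theorem pf_coord (a : Q.A) (i j) : Q.IsPolyFun (fun W : Q.Rep β => W a i j) :=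
  ⟨MvPolynomial.X ⟨a, i, j⟩, fun W => by simp⟩

theorem pf_add {f g : Q.Rep β → ℂ} (hf : Q.IsPolyFun f) (hg : Q.IsPolyFun g) :
    Q.IsPolyFun (fun W => f W + g W) := by
  obtain ⟨P, hP⟩ := hf
  obtain ⟨R, hR⟩ := hg
  exact ⟨P + R, fun W => by simp [hP, hR]⟩

theorem pf_mul {f g : Q.Rep β → ℂ} (hf : Q.IsPolyFun f) (hg : Q.IsPolyFun g) :
    Q.IsPolyFun (fun W => f W * g W) := by
  obtain ⟨P, hP⟩ := hf
  obtain ⟨R, hR⟩ := hg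
  exact ⟨P * R, fun W => by simp [hP, hR]⟩

theorem pf_sub {f g : Q.Rep β → ℂ} (hf : Q.IsPolyFun f) (hg : Q.IsPolyFun g) :
    Q.IsPolyFun (fun W => f W - g W) := by
  obtain ⟨P, hP⟩ := hf
  obtain ⟨R, hR⟩ := hg
  exact ⟨P - R, fun W => by simp [hP, hR]⟩

theorem pf_sum {ι : Type*} (s : Finset ι) (f : ι → Q.Rep β → ℂ) (h : ∀ i, Q.IsPolyFun (f i)) :
    Q.IsPolyFun (fun W => ∑ i ∈ s, f i W) := by
  choose P hP using h
  exact ⟨∑ i ∈ s, P i, fun W => by simp [hP]⟩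

theorem pf_prod {ι : Type*} (s : Finset ι) (f : ι → Q.Rep β → ℂ) (h : ∀ i, Q.IsPolyFun (f i)) :
    Q.IsPolyFun (fun W => ∏ i ∈ s, f i W) := by
  choose P hP using h
  exact ⟨∏ i ∈ s, P i, fun W => by simp [hP]⟩

theorem pf_det {n : Type*} [Fintype n] [DecidableEq n] (M : Q.Rep β → Matrix n n ℂ)
    (h : ∀ i j, Q.IsPolyFun (fun W => M W i j)) : Q.IsPolyFun (fun W => (M W).det) := by
  simp only [Matrix.det_apply']
  exact pf_sum _ _ (fun σ => pf_mul (pf_const _) (pf_prod _ _ (fun i => h _ _)))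

theorem pf_comp {Q' : FinQuiver} {γ : Q'.V → ℕ} (Φ : Q.Rep β → Q'.Rep γ)
    (h : ∀ a i j, Q.IsPolyFun (fun W => Φ W a i j)) {f : Q'.Rep γ → ℂ} (hf : Q'.IsPolyFun f) :
    Q.IsPolyFun (fun W => f (Φ W)) := by
  obtain ⟨P, hP⟩ := hf
  choose R hR using h
  refine ⟨MvPolynomial.bind₁ (fun i => R i.1 i.2.1 i.2.2) P, fun W => ?_⟩
  refine (hP _).trans ?_
  have : (MvPolynomial.eval fun i => W i.1 i.2.1 i.2.2) (MvPolynomial.bind₁ (fun i => R i.1 i.2.1 i.2.2) P)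
      = MvPolynomial.eval (fun i => Φ W i.1 i.2.1 i.2.2) P := by
    rw [← MvPolynomial.coe_aeval_eq_eval, ← MvPolynomial.coe_aeval_eq_eval]
    simp only [RingHom.coe_coe]
    rw [MvPolynomial.aeval_bind₁]
    congr 2
    funext i
    refine Eq.trans ?_ (hR _ _ _ W).symm
    exact DFunLike.congr_fun (MvPolynomial.coe_aeval_eq_eval _) _
  rw [this]

theorem pf_hat (a : Q.A) (s t : BB Q β) : Q.IsPolyFun (fun W : Q.Rep β => hat W a s t) := by
  simp only [hat, Matrix.of_apply]
  exact pf_sum _ _ (fun i => pf_sum _ _ (fun j => pf_mul (pf_const _) (pf_coord _ _ _)))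

end poly

theorem pf_cV {α β : Q.V → ℕ} (e0 : C1 Q α β ≃ C0 Q α β) (V : Q.Rep α) :
    Q.IsPolyFun (fun W : Q.Rep β => cV e0 V W) := by
  refine pf_det _ (fun p q => ?_)
  simp only [Matrix.submatrix_apply, dmat, Matrix.of_apply]
  exact pf_sub (pf_const _) (pf_mul (pf_const _) (pf_hat _ _ _))

theorem pf_cV_left {α β : Q.V → ℕ} (e0 : C1 Q α β ≃ C0 Q α β) (W : Q.Rep β) :
    Q.IsPolyFun (fun V : Q.Rep α => cV e0 V W) := by
  refine pf_det _ (fun p q => ?_)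
  simp only [Matrix.submatrix_apply, dmat, Matrix.of_apply]
  exact pf_sub (pf_mul (pf_hat _ _ _) (pf_const _)) (pf_const _)

theorem dmat_inv {α β : Q.V → ℕ} (V : Q.Rep α) (W : Q.Rep β) (g : Q.GLb β) :
    dmat V (Q.invAct g W) =
      (Matrix.blockDiagonal' fun s : P1 Q α => ((g (Q.h s.1))⁻¹).val) * dmat V W *
      (Matrix.blockDiagonal' fun s : P0 Q α => (g s.1).val) := by
  apply dmat_ext
  intro φ
  have h0 : (Matrix.blockDiagonal' fun s : P0 Q α => (g s.1).val).mulVec (vec0 Q α β φ) =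
      vec0 Q α β (fun x => (g x).val * φ x) := by
    funext ⟨⟨x, q⟩, i⟩
    simp only [Matrix.mulVec, dotProduct, vec0_apply]
    rw [Fintype.sum_sigma, Finset.sum_eq_single ⟨x, q⟩]
    · simp only [Matrix.blockDiagonal'_apply_eq, Matrix.mul_apply]
    · intro s _ hs
      refine Finset.sum_eq_zero (fun j _ => ?_)
      rw [Matrix.blockDiagonal'_apply_ne _ _ _ hs.symm, zero_mul]
    · simp
  have h1 : ∀ ξ, (Matrix.blockDiagonal' fun s : P1 Q α => ((g (Q.h s.1))⁻¹).val).mulVec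
      (vec1 Q α β ξ) = vec1 Q α β (fun a => ((g (Q.h a))⁻¹).val * ξ a) := by
    intro ξ
    funext ⟨⟨x, q⟩, i⟩
    simp only [Matrix.mulVec, dotProduct, vec1_apply]
    rw [Fintype.sum_sigma, Finset.sum_eq_single ⟨x, q⟩]
    · simp only [Matrix.blockDiagonal'_apply_eq, Matrix.mul_apply]
    · intro s _ hs
      refine Finset.sum_eq_zero (fun j _ => ?_)
      rw [Matrix.blockDiagonal'_apply_ne _ _ _ hs.symm, zero_mul]
    · simp
  rw [← Matrix.mulVec_mulVec, h0, ← Matrix.mulVec_mulVec, dmat_mulVec, dmat_mulVec, h1]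
  congr 1
  funext a
  simp only [dl_apply, FinQuiver.invAct, Matrix.mul_sub, ← Matrix.mul_assoc]
  rw [Units.inv_mul, Matrix.one_mul]

theorem cV_mem {α β : Q.V → ℕ} (e0 : C1 Q α β ≃ C0 Q α β) (V : Q.Rep α) :
    (fun W : Q.Rep β => cV e0 V W) ∈ Q.SIw β (Q.weightOf α) := by
  refine ⟨pf_cV e0 V, fun g W => ?_⟩
  simp only [cV]
  rw [dmat_inv]
  have h1 : ((Matrix.blockDiagonal' fun s : P1 Q α => ((g (Q.h s.1))⁻¹).val) * dmat V W *
      (Matrix.blockDiagonal' fun s : P0 Q α => (g s.1).val)).submatrix id e0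
      = (Matrix.blockDiagonal' fun s : P1 Q α => ((g (Q.h s.1))⁻¹).val) * (dmat V W).submatrix id e0 *
        (Matrix.blockDiagonal' fun s : P0 Q α => (g s.1).val).submatrix e0 e0 := by
    rw [← Matrix.submatrix_mul_equiv _ _ id e0 e0, ← Matrix.submatrix_mul_equiv _ _ id (Equiv.refl _) e0]
    rfl
  rw [h1, Matrix.det_mul, Matrix.det_mul, Matrix.det_submatrix_equiv_self, det_bd, det_bd]
  have hd : ∀ x, (g x).val.det ≠ 0 := fun x => ((Matrix.isUnit_iff_isUnit_det _).1 (g x).isUnit).ne_zero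
  have h2 : ∀ x, ((g x)⁻¹).val.det = ((g x).val.det)⁻¹ := by
    intro x
    rw [Matrix.coe_units_inv, Matrix.det_nonsing_inv, Ring.inverse_eq_inv']
  have h3 : Q.detWeight (Q.weightOf α) g = (∏ s : P1 Q α, ((g (Q.h s.1))⁻¹).val.det) *
      ∏ s : P0 Q α, (g s.1).val.det := by
    have h4 := prod_P1 (α := α) (fun x => (g x).val.det) hd (∑ y, α y)
      (fun x => Finset.single_le_sum (f := α) (fun y _ => Nat.zero_le _) (mem_univ x))
    have h5 : Q.detWeight (Q.weightOf α) g * (∏ x, (g x).val.det ^ ((∑ y, α y : ℕ) : ℤ) *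
        (g x).val.det ^ (-(Q.weightOf α x))) = ∏ x, (g x).val.det ^ (∑ y, α y) := by
      unfold FinQuiver.detWeight
      rw [← Finset.prod_mul_distrib]
      refine Finset.prod_congr rfl (fun x _ => ?_)
      rw [mul_comm, mul_assoc, ← zpow_add₀ (hd x), neg_add_cancel, zpow_zero, mul_one, zpow_natCast]
    have hpc : ∀ (n : ℕ) (c : ℂ), ∏ _x : Fin n, c = c ^ n := by simp
    have h6 : (∏ s : P0 Q α, (g s.1).val.det) * (∏ s : P0 Q (fun x => (∑ y, α y) - α x), (g s.1).val.det)
        = ∏ x, (g x).val.det ^ (∑ y, α y) := by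
      rw [Fintype.prod_sigma, Fintype.prod_sigma, ← Finset.prod_mul_distrib]
      refine Finset.prod_congr rfl (fun x _ => ?_)
      have h7 : α x ≤ ∑ y, α y :=
        Finset.single_le_sum (f := α) (fun y _ => Nat.zero_le _) (mem_univ x)
      change (∏ _y : Fin (α x), (g x).val.det) * (∏ _y : Fin ((∑ y, α y) - α x), (g x).val.det) = _
      rw [hpc, hpc, ← pow_add, Nat.add_sub_cancel' h7]
    simp only [h2, Finset.prod_inv_distrib]
    rw [h4] at h5
    have hA : (∏ s : P1 Q α, (g (Q.h s.1)).val.det) ≠ 0 := Finset.prod_ne_zero_iff.2 (fun s _ => hd _)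
    have hB : (∏ s : P0 Q (fun x => (∑ y, α y) - α x), (g s.1).val.det) ≠ 0 :=
      Finset.prod_ne_zero_iff.2 (fun s _ => hd _)
    rw [← h6] at h5
    have h8 := mul_right_cancel₀ hB (by rw [← h5]; ring :
      (Q.detWeight (Q.weightOf α) g * ∏ s : P1 Q α, (g (Q.h s.1)).val.det) *
        (∏ s : P0 Q (fun x => (∑ y, α y) - α x), (g s.1).val.det)
      = (∏ s : P0 Q α, (g s.1).val.det) * (∏ s : P0 Q (fun x => (∑ y, α y) - α x), (g s.1).val.det))
    rw [← h8]
    field_simp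
  rw [h3]
  ring

end EmbThm


namespace EmbThm
open Finset
variable {Q : FinQuiver}

section dens
attribute [local instance] Matrix.linftyOpNormedAddCommGroup Matrix.linftyOpNormedSpace
  Matrix.linftyOpNormedRing Matrix.linftyOpNormedAlgebra

theorem matmul_deriv {p q r : ℕ} {E : Type*} [NormedAddCommGroup E] [NormedSpace ℂ E]
    (A : E → Matrix (Fin p) (Fin q) ℂ) (B : E → Matrix (Fin q) (Fin r) ℂ) (A' : E →L[ℂ] Matrix (Fin p) (Fin q) ℂ)
    (B' : E →L[ℂ] Matrix (Fin q) (Fin r) ℂ) (x : E) (hA : HasStrictFDerivAt A A' x) (hB : HasStrictFDerivAt B B' x) :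
    ∃ C' : E →L[ℂ] Matrix (Fin p) (Fin r) ℂ, HasStrictFDerivAt (fun y => A y * B y) C' x ∧
      ∀ v, C' v = A x * B' v + A' v * B x := by
  let L : Matrix (Fin p) (Fin q) ℂ →ₗ[ℂ] Matrix (Fin q) (Fin r) ℂ →ₗ[ℂ] Matrix (Fin p) (Fin r) ℂ :=
    LinearMap.mk₂ ℂ (fun M N => M * N) (fun _ _ _ => Matrix.add_mul _ _ _) (fun _ _ _ => Matrix.smul_mul _ _ _)
      (fun _ _ _ => Matrix.mul_add _ _ _) (fun _ _ _ => Matrix.mul_smul _ _ _)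
  have h := L.toContinuousBilinearMap.hasStrictFDerivAt_of_bilinear hA hB
  exact ⟨_, h, fun v => rfl⟩

theorem exists_nhds {β : Q.V → ℕ} (W0 : Q.Rep β) {ι : Type} [Fintype ι]
    (l : (ι → ℂ) →ₗ[ℂ] H1 Q β β)
    (hs : ∀ ξ : H1 Q β β, ∃ X u, dl W0 W0 X + l u = ξ) :
    {W : H1 Q β β | ∃ (g : Q.GLb β) (u : ι → ℂ), W = Q.invAct g (fun a => W0 a + l u a)} ∈ @nhds (H1 Q β β) _ W0 := by
  let E := (∀ x : Q.V, Matrix (Fin (β x)) (Fin (β x)) ℂ) × (ι → ℂ)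
  let F : E → H1 Q β β := fun p a =>
    NormedSpace.exp (p.1 (Q.h a)) * (W0 a + l p.2 a) * NormedSpace.exp (-(p.1 (Q.t a)))
  have hF : ∃ F' : E →L[ℂ] H1 Q β β, HasStrictFDerivAt F F' 0 ∧
      ∀ v, F' v = dl W0 W0 v.1 + l v.2 := by
    have key : ∀ a : Q.A, ∃ C' : E →L[ℂ] Matrix (Fin (β (Q.h a))) (Fin (β (Q.t a))) ℂ,
        HasStrictFDerivAt (fun p : E => F p a) C' 0 ∧ ∀ v, C' v = dl W0 W0 v.1 a + l v.2 a := by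
      intro a
      have pr : ∀ x : Q.V, HasStrictFDerivAt (fun p : E => p.1 x)
          ((ContinuousLinearMap.proj x).comp (ContinuousLinearMap.fst ℂ (∀ x : Q.V, Matrix (Fin (β x)) (Fin (β x)) ℂ) (ι → ℂ)) :
            E →L[ℂ] Matrix (Fin (β x)) (Fin (β x)) ℂ) 0 := fun x =>
        ContinuousLinearMap.hasStrictFDerivAt ((ContinuousLinearMap.proj x).comp (ContinuousLinearMap.fst ℂ (∀ x : Q.V, Matrix (Fin (β x)) (Fin (β x)) ℂ) (ι → ℂ)) :
            E →L[ℂ] Matrix (Fin (β x)) (Fin (β x)) ℂ)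
      have e1 : ∀ x : Q.V, HasStrictFDerivAt (fun p : E => NormedSpace.exp (p.1 x))
          ((ContinuousLinearMap.proj x).comp (ContinuousLinearMap.fst ℂ (∀ x : Q.V, Matrix (Fin (β x)) (Fin (β x)) ℂ) (ι → ℂ)) :
            E →L[ℂ] Matrix (Fin (β x)) (Fin (β x)) ℂ) 0 := by
        intro x
        have h0 := hasStrictFDerivAt_exp_zero (𝕂 := ℂ) (𝔸 := Matrix (Fin (β x)) (Fin (β x)) ℂ)
        have := HasStrictFDerivAt.comp (g := NormedSpace.exp) (f := fun p : E => p.1 x) (0 : E) h0 (pr x)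
        exact this
      have e2 : ∀ x : Q.V, HasStrictFDerivAt (fun p : E => NormedSpace.exp (-(p.1 x)))
          (-((ContinuousLinearMap.proj x).comp (ContinuousLinearMap.fst ℂ (∀ x : Q.V, Matrix (Fin (β x)) (Fin (β x)) ℂ) (ι → ℂ)) :
            E →L[ℂ] Matrix (Fin (β x)) (Fin (β x)) ℂ)) 0 := by
        intro x
        have h0 := hasStrictFDerivAt_exp_zero (𝕂 := ℂ) (𝔸 := Matrix (Fin (β x)) (Fin (β x)) ℂ)
        have hz : -((0 : E).1 x) = 0 := neg_zero
        have h0' : HasStrictFDerivAt NormedSpace.exp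
            (1 : Matrix (Fin (β x)) (Fin (β x)) ℂ →L[ℂ] Matrix (Fin (β x)) (Fin (β x)) ℂ) (-((0 : E).1 x)) := by
          rw [hz]; exact h0
        have := HasStrictFDerivAt.comp (g := NormedSpace.exp) (f := fun p : E => -(p.1 x)) (0 : E)
          h0' (pr x).neg
        exact this
      let lc : E →L[ℂ] Matrix (Fin (β (Q.h a))) (Fin (β (Q.t a))) ℂ :=
        (ContinuousLinearMap.proj a).comp ((LinearMap.toContinuousLinearMap l).comp
          (ContinuousLinearMap.snd ℂ (∀ x : Q.V, Matrix (Fin (β x)) (Fin (β x)) ℂ) (ι → ℂ)))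
      have e3 : HasStrictFDerivAt (fun p : E => W0 a + l p.2 a) lc 0 :=
        (lc.hasStrictFDerivAt (x := 0)).const_add (W0 a)
      obtain ⟨C1', h1, h1'⟩ := matmul_deriv _ _ _ _ _ (e1 (Q.h a)) e3
      obtain ⟨C2', h2, h2'⟩ := matmul_deriv _ _ _ _ _ h1 (e2 (Q.t a))
      refine ⟨C2', h2, fun v => ?_⟩
      refine (h2' v).trans ((congrArg₂ (· + ·) rfl (congrArg (· * _) (h1' v))).trans ?_)
      have gen : ∀ (A L Z : Matrix (Fin (β (Q.h a))) (Fin (β (Q.t a))) ℂ)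
          (X : Matrix (Fin (β (Q.h a))) (Fin (β (Q.h a))) ℂ) (Y : Matrix (Fin (β (Q.t a))) (Fin (β (Q.t a))) ℂ),
          Z = 0 → NormedSpace.exp (0 : Matrix (Fin (β (Q.h a))) (Fin (β (Q.h a))) ℂ) * (A + Z) * (-Y) +
          (NormedSpace.exp (0 : Matrix (Fin (β (Q.h a))) (Fin (β (Q.h a))) ℂ) * L + X * (A + Z)) *
            NormedSpace.exp (-(0 : Matrix (Fin (β (Q.t a))) (Fin (β (Q.t a))) ℂ)) = X * A - A * Y + L := by
        intro A L Z X Y hZ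
        rw [hZ, neg_zero, NormedSpace.exp_zero, NormedSpace.exp_zero, add_zero, Matrix.one_mul,
          Matrix.one_mul, Matrix.mul_one, Matrix.mul_neg]
        abel
      exact gen (W0 a) (l v.2 a) (l 0 a) (v.1 (Q.h a)) (v.1 (Q.t a)) (by rw [map_zero]; rfl)
    choose C' hC hC' using key
    refine ⟨ContinuousLinearMap.pi C', hasStrictFDerivAt_pi.2 hC, fun v => ?_⟩
    funext a
    exact hC' a v
  obtain ⟨F', hF1, hF2⟩ := hF
  have hr : F'.range = ⊤ := by
    rw [LinearMap.range_eq_top]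
    intro ξ
    obtain ⟨X, u, h⟩ := hs ξ
    exact ⟨(X, u), (hF2 _).trans h⟩
  have := hF1.map_nhds_eq_of_surj hr
  have hF0 : F 0 = W0 := by
    funext a
    have z1 : (0 : E).1 = 0 := rfl
    have z2 : (0 : E).2 = 0 := rfl
    simp only [F, z1, z2, Pi.zero_apply, neg_zero, NormedSpace.exp_zero, map_zero, add_zero, Matrix.one_mul, Matrix.mul_one]
  rw [hF0] at this
  have h2 : Set.range F ∈ @nhds (H1 Q β β) _ W0 := by
    have h3 : Set.range F ∈ Filter.map F (nhds 0) := Filter.mem_map.2 (Filter.univ_mem' (fun p => ⟨p, rfl⟩))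
    exact (congrArg (fun l => Set.range F ∈ l) this).mp h3
  refine Filter.mem_of_superset h2 ?_
  rintro _ ⟨p, rfl⟩
  have hinv : ∀ x, NormedSpace.exp (-(p.1 x)) * NormedSpace.exp (p.1 x) = 1 := by
    intro x
    rw [← Matrix.exp_add_of_commute (-(p.1 x)) (p.1 x) (Commute.neg_left (Commute.refl (p.1 x)))]
    simp
  have hinv' : ∀ x, NormedSpace.exp (p.1 x) * NormedSpace.exp (-(p.1 x)) = 1 := by
    intro x
    rw [← Matrix.exp_add_of_commute (p.1 x) (-(p.1 x)) (Commute.neg_right (Commute.refl (p.1 x)))]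
    simp
  exact ⟨fun x => ⟨NormedSpace.exp (-(p.1 x)), NormedSpace.exp (p.1 x), hinv x, hinv' x⟩, p.2, rfl⟩

theorem pf_eq_zero {β : Q.V → ℕ} (f : Q.Rep β → ℂ) (hf : Q.IsPolyFun f) (W0 : Q.Rep β)
    (S : Set (H1 Q β β)) (hS : S ∈ @nhds (H1 Q β β) _ W0) (h0 : ∀ W ∈ S, f W = 0) : f = 0 := by
  obtain ⟨P, hP⟩ := hf
  funext W
  let D : H1 Q β β := fun a => W a - W0 a
  let R : Polynomial ℂ := MvPolynomial.aeval (fun i : (a : Q.A) × (Fin (β (Q.h a)) × Fin (β (Q.t a))) =>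
    Polynomial.C (W0 i.1 i.2.1 i.2.2) + Polynomial.X * Polynomial.C (D i.1 i.2.1 i.2.2)) P
  have hR : ∀ t : ℂ, R.eval t = f (fun a => W0 a + t • D a) := by
    intro t
    refine Eq.trans ?_ (hP _).symm
    rw [← Polynomial.coe_evalRingHom]
    simp only [R]
    rw [MvPolynomial.aeval_def, MvPolynomial.eval₂_eq', MvPolynomial.eval_eq']
    rw [map_sum]
    refine Finset.sum_congr rfl (fun d _ => ?_)
    rw [map_mul, map_prod]
    simp only [Polynomial.algebraMap_eq, Polynomial.coe_evalRingHom, Polynomial.eval_C, Polynomial.eval_pow,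
      Polynomial.eval_add, Polynomial.eval_mul, Polynomial.eval_X]
    rfl
  have hc : Continuous (fun t : ℂ => (fun a => W0 a + t • D a : H1 Q β β)) := by
    refine continuous_pi (fun a => ?_)
    exact continuous_const.add (continuous_id.smul continuous_const)
  have hn : {t : ℂ | R.eval t = 0} ∈ nhds (0 : ℂ) := by
    have h1 := hc.continuousAt (x := 0)
    have h2 : (fun a => W0 a + (0:ℂ) • D a : H1 Q β β) = W0 := by
      funext a; simp
    have h3 : S ∈ nhds (fun a => W0 a + (0:ℂ) • D a : H1 Q β β) := by
      rw [h2]; exact hS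
    refine Filter.mem_of_superset (h1 h3) ?_
    intro t ht
    exact (hR t).trans (h0 _ ht)
  have hR0 : R = 0 := by
    by_contra hne
    have hfin : {t : ℂ | R.eval t = 0}.Finite := Polynomial.finite_setOfPred_isRoot hne
    exact (infinite_of_mem_nhds (0:ℂ) hn) hfin
  have := hR 1
  rw [hR0] at this
  have h4 : (fun a => W0 a + (1:ℂ) • D a : H1 Q β β) = W := by
    funext a; simp [D]
  have h5 : f (fun a => W0 a + (1:ℂ) • D a : H1 Q β β) = f W := congrArg f h4
  rw [← h5]
  simpa using this.symm

/-- density principle -/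
theorem density {β : Q.V → ℕ} (W0 : Q.Rep β) {ι : Type} [Fintype ι]
    (l : (ι → ℂ) →ₗ[ℂ] H1 Q β β)
    (hs : ∀ ξ : H1 Q β β, ∃ X u, dl W0 W0 X + l u = ξ) (f : Q.Rep β → ℂ) (hf : Q.IsPolyFun f)
    (h0 : ∀ (g : Q.GLb β) (u : ι → ℂ), f (Q.invAct g (fun a => W0 a + l u a)) = 0) : f = 0 := by
  refine pf_eq_zero f hf W0 _ (exists_nhds W0 l hs) ?_
  rintro _ ⟨g, u, rfl⟩
  exact h0 g u

theorem density_orbit {β : Q.V → ℕ} (W0 : Q.Rep β) (hs : Function.Surjective (dl W0 W0))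
    (f : Q.Rep β → ℂ) (hf : Q.IsPolyFun f)
    (h0 : ∀ g : Q.GLb β, f (Q.invAct g W0) = 0) : f = 0 := by
  refine density W0 (ι := Empty) 0 ?_ f hf ?_
  · intro ξ
    obtain ⟨X, hX⟩ := hs ξ
    exact ⟨X, 0, by simpa using hX⟩
  · intro g u
    have : (fun a => W0 a + (0 : (Empty → ℂ) →ₗ[ℂ] H1 Q β β) u a : Q.Rep β) = W0 := by
      funext a; simp
    rw [this]
    exact h0 g

end dens

end EmbThm


namespace EmbThm
open Finset
variable {Q : FinQuiver}

theorem exists_path (x y : Q.V) (h : Relation.TransGen (fun u v => ∃ a, Q.t a = u ∧ Q.h a = v) x y) :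
    ∃ (k : ℕ) (c : ℕ → Q.A), Q.t (c 0) = x ∧ Q.h (c k) = y ∧ ∀ i < k, Q.h (c i) = Q.t (c (i + 1)) := by
  induction h using Relation.TransGen.head_induction_on with
  | single h =>
    obtain ⟨a, h1, h2⟩ := h
    exact ⟨0, fun _ => a, h1, h2, fun i hi => absurd hi (Nat.not_lt_zero _)⟩
  | head h _ ih =>
    obtain ⟨a, h1, h2⟩ := h
    obtain ⟨k, c, e1, e2, e3⟩ := ih
    refine ⟨k + 1, fun i => Nat.casesOn i a (fun j => c j), h1, e2, ?_⟩
    intro i hi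
    cases i with
    | zero => exact h2.trans e1.symm
    | succ j => exact e3 j (by omega)

theorem exists_rk (hac : Q.Acyclic) : ∃ rk : Q.V → ℕ, ∀ a, rk (Q.t a) < rk (Q.h a) := by
  classical
  let R : Q.V → Q.V → Prop := fun u v => ∃ a, Q.t a = u ∧ Q.h a = v
  have hirr : ∀ x, ¬ Relation.TransGen R x x := by
    intro x hx
    obtain ⟨k, c, e1, e2, e3⟩ := exists_path x x hx
    refine hac ⟨k, fun i => c i.val, fun i => ?_⟩
    by_cases hi : i = Fin.last k
    · subst hi
      simp only [Fin.last_add_one, Fin.val_last, Fin.val_zero]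
      rw [e1, e2]
    · have : (i + 1).val = i.val + 1 := by
        rw [Fin.val_add_one, if_neg hi]
      simp only [this]
      refine e3 _ ?_
      have := i.2
      have h2 : i.val ≠ k := fun h => hi (Fin.ext h)
      omega
  refine ⟨fun x => (univ.filter (fun y => Relation.TransGen R y x)).card, fun a => ?_⟩
  apply Finset.card_lt_card
  have hs : R (Q.t a) (Q.h a) := ⟨a, rfl, rfl⟩
  rw [Finset.ssubset_iff_of_subset]
  · refine ⟨Q.t a, ?_, ?_⟩
    · simp only [mem_filter, mem_univ, true_and]
      exact Relation.TransGen.single hs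
    · simp only [mem_filter, mem_univ, true_and]
      exact hirr _
  · intro y hy
    simp only [mem_filter, mem_univ, true_and] at hy ⊢
    exact hy.tail hs

theorem finrank_H0 (α β : Q.V → ℕ) : (Module.finrank ℂ (H0 Q α β) : ℤ) = ∑ x, (α x : ℤ) * β x := by
  rw [Module.finrank_pi_fintype]
  push_cast
  refine Finset.sum_congr rfl (fun x _ => ?_)
  rw [Module.finrank_matrix]
  simp [mul_comm]

theorem finrank_H1 (α β : Q.V → ℕ) :
    (Module.finrank ℂ (H1 Q α β) : ℤ) = ∑ a, (α (Q.t a) : ℤ) * β (Q.h a) := by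
  rw [Module.finrank_pi_fintype]
  push_cast
  refine Finset.sum_congr rfl (fun x _ => ?_)
  rw [Module.finrank_matrix]
  simp [mul_comm]

theorem dl_rank {α β : Q.V → ℕ} (V : Q.Rep α) (W : Q.Rep β) :
    (Module.finrank ℂ (LinearMap.ker (dl V W)) : ℤ) - (Module.finrank ℂ (H1 Q α β)
      - Module.finrank ℂ (LinearMap.range (dl V W))) = Q.euler (natToInt α) (natToInt β) := by
  have h := LinearMap.finrank_range_add_finrank_ker (dl V W)
  have h' : (Module.finrank ℂ (LinearMap.range (dl V W)) : ℤ) + Module.finrank ℂ (LinearMap.ker (dl V W))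
      = Module.finrank ℂ (H0 Q α β) := by exact_mod_cast h
  have h0 := finrank_H0 (Q := Q) α β
  have h1 := finrank_H1 (Q := Q) α β
  simp only [FinQuiver.euler, natToInt]
  linarith

theorem dl_surj_of {α β : Q.V → ℕ} (V : Q.Rep α) (W : Q.Rep β)
    (h : (Module.finrank ℂ (LinearMap.ker (dl V W)) : ℤ) = Q.euler (natToInt α) (natToInt β)) :
    Function.Surjective (dl V W) := by
  have h1 := dl_rank V W
  rw [← LinearMap.range_eq_top]
  apply Submodule.eq_top_of_finrank_eq
  omega

theorem dl_inj_of {α β : Q.V → ℕ} (V : Q.Rep α) (W : Q.Rep β) (hs : Function.Surjective (dl V W))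
    (h : Q.euler (natToInt α) (natToInt β) ≤ 0) :
    Function.Injective (dl V W) := by
  have h1 := dl_rank V W
  rw [LinearMap.range_eq_top.2 hs, finrank_top] at h1
  rw [← LinearMap.ker_eq_bot]
  apply Submodule.finrank_eq_zero.1
  omega

theorem mem_ker_dl {α β : Q.V → ℕ} (V : Q.Rep α) (W : Q.Rep β) (φ : H0 Q α β) :
    dl V W φ = 0 ↔ Q.IsHom V W φ := by
  constructor
  · intro h a
    have := congrFun h a
    rw [dl_apply] at this
    exact sub_eq_zero.1 this
  · intro h
    funext a
    rw [dl_apply]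
    exact sub_eq_zero.2 (h a)

theorem schur_surj {α : Q.V → ℕ} (V : Q.Rep α) (hV : Q.IsSchur V)
    (he : Q.euler (natToInt α) (natToInt α) = 1) : Function.Surjective (dl V V) := by
  apply dl_surj_of
  have : LinearMap.ker (dl V V) = Q.homSpace V V := by
    ext φ
    exact mem_ker_dl V V φ
  rw [this, he]
  exact_mod_cast hV

theorem schur_end {α : Q.V → ℕ} (V : Q.Rep α) (hV : Q.IsSchur V) :
    (∀ φ : H0 Q α α, dl V V φ = 0 → ∃ c : ℂ, ∀ x, φ x = c • 1) ∧ ∃ x, 0 < α x := by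
  obtain ⟨⟨v, hv⟩, hne, hall⟩ := finrank_eq_one_iff'.1 hV
  have hv0 : v ≠ 0 := fun h => hne (Subtype.ext h)
  have hsp : ∀ φ : H0 Q α α, Q.IsHom V V φ → ∃ c : ℂ, c • v = φ := by
    intro φ hφ
    obtain ⟨c, hc⟩ := hall ⟨φ, hφ⟩
    exact ⟨c, congrArg Subtype.val hc⟩
  have h1 : Q.IsHom V V (fun x => (1 : Matrix (Fin (α x)) (Fin (α x)) ℂ)) := by
    intro a
    exact (Matrix.one_mul _).trans (Matrix.mul_one _).symm
  have hone : (fun x => (1 : Matrix (Fin (α x)) (Fin (α x)) ℂ)) ≠ 0 := by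
    intro h
    apply hv0
    funext x
    have := congrFun h x
    rw [← Matrix.mul_one (v x)]
    simp only [Pi.zero_apply] at this ⊢
    rw [this, Matrix.mul_zero]
  obtain ⟨c, hc⟩ := hsp _ h1
  have hc0 : c ≠ 0 := by
    rintro rfl
    rw [zero_smul] at hc
    exact hone hc.symm
  constructor
  · intro φ hφ
    obtain ⟨d, hd⟩ := hsp φ ((mem_ker_dl _ _ _).1 hφ)
    refine ⟨d * c⁻¹, fun x => ?_⟩
    have h2 := congrFun hc x
    simp only [Pi.smul_apply] at h2
    rw [← hd, ← h2, smul_smul, mul_assoc, inv_mul_cancel₀ hc0, mul_one]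
    rfl
  · by_contra hno
    push Not at hno
    apply hone
    funext x
    have : α x = 0 := Nat.le_zero.1 (hno x)
    ext i j
    exact absurd i.2 (by omega)

theorem circ_bij {α β : Q.V → ℕ} (hac : Q.Acyclic) (hc : Q.circ α β ≠ 0) (V : Q.Rep α) (W : Q.Rep β)
    (hV : Function.Surjective (dl V V)) (hW : Function.Surjective (dl W W)) :
    Function.Bijective (dl V W) ∧ Q.euler (natToInt α) (natToInt β) = 0 := by
  obtain ⟨rk, hrk⟩ := exists_rk hac
  have hex : ∃ f ∈ Q.SIw β (Q.weightOf α), f ≠ 0 := by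
    by_contra hno
    push Not at hno
    apply hc
    have : Subsingleton (Q.SIw β (Q.weightOf α)) :=
      ⟨fun a b => Subtype.ext ((hno _ a.2).trans (hno _ b.2).symm)⟩
    exact Module.finrank_zero_of_subsingleton
  obtain ⟨f, hf, h0⟩ := hex
  obtain ⟨e0⟩ := exists_e0 hf h0
  have hsp := span_cV rk hrk hf e0
  have h1 : ∃ V' W', cV e0 V' W' ≠ 0 := by
    by_contra hno
    push Not at hno
    apply h0
    have : Set.range (fun V : Q.Rep α => fun W => cV e0 V W) ⊆ {0} := by
      rintro _ ⟨V', rfl⟩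
      funext W'
      exact hno V' W'
    have := Submodule.span_mono this hsp
    simpa using this
  obtain ⟨V', W', h1⟩ := h1
  have h2 : cV e0 V' W ≠ 0 := by
    intro h2
    have := density_orbit W hW (fun W => cV e0 V' W) (pf_cV e0 V') (fun g => by
      refine ((cV_mem e0 V').2 g W).trans ?_
      simp only [h2, mul_zero])
    exact h1 (congrFun this W')
  have h3 : Function.Injective (dl V W) := by
    by_contra hni
    have := density_orbit V hV (fun V => cV e0 V W) (pf_cV_left e0 W) (fun g => by
      by_contra hg
      apply hni
      have hg := (dl_inj_iff _ _ _).1 hg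
      rw [injective_iff_map_eq_zero] at hg ⊢
      intro φ hφ
      have h5 := hg (fun x => φ x * (g x).val) (by
        funext a
        have h6 := congrFun hφ a
        rw [dl_apply] at h6
        have h6 := sub_eq_zero.1 h6
        rw [dl_apply]
        refine sub_eq_zero.2 ?_
        simp only [FinQuiver.invAct]
        rw [Matrix.mul_assoc (φ _), ← Matrix.mul_assoc (g _).val, ← Matrix.mul_assoc (g _).val, Units.mul_inv, Matrix.one_mul,
          ← Matrix.mul_assoc, h6, Matrix.mul_assoc])
      funext x
      have h7 : φ x * (g x).val = 0 := congrFun h5 x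
      calc φ x = φ x * ((g x).val * ((g x)⁻¹).val) := by rw [Units.mul_inv, Matrix.mul_one]
        _ = 0 := by rw [← Matrix.mul_assoc, h7, Matrix.zero_mul])
    exact h2 (congrFun this V')
  have hd : Module.finrank ℂ (H0 Q α β) = Module.finrank ℂ (H1 Q α β) := by
    rw [(vec0 Q α β).finrank_eq, (vec1 Q α β).finrank_eq, Module.finrank_pi, Module.finrank_pi]
    exact (Fintype.card_congr e0).symm
  refine ⟨⟨h3, (LinearMap.injective_iff_surjective_of_finrank_eq_finrank hd).1 h3⟩, ?_⟩
  have e1 := finrank_H0 (Q := Q) α β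
  have e2 := finrank_H1 (Q := Q) α β
  rw [hd] at e1
  simp only [FinQuiver.euler, natToInt]
  linarith

theorem exists_qinv {m n : ℕ} (f : Matrix (Fin m) (Fin n) ℂ) :
    ∃ s : Matrix (Fin n) (Fin m) ℂ, f * s * f = f := by
  let F := Matrix.toLin' f
  obtain ⟨s0, hs0⟩ := F.rangeRestrict.exists_rightInverse_of_surjective F.range_rangeRestrict
  obtain ⟨s, hs⟩ := LinearMap.exists_extend s0
  refine ⟨LinearMap.toMatrix' s, ?_⟩
  apply Matrix.toLin'.injective
  rw [Matrix.toLin'_mul, Matrix.toLin'_mul, Matrix.toLin'_toMatrix']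
  refine LinearMap.ext (fun w => ?_)
  have h1 : s (F w) = s0 (F.rangeRestrict w) := LinearMap.congr_fun hs (F.rangeRestrict w)
  have h2 := LinearMap.congr_fun hs0 (F.rangeRestrict w)
  have h3 := congrArg Subtype.val h2
  change F (s (F w)) = F w
  rw [h1]
  exact h3

theorem hom_zero {α β : Q.V → ℕ} (M : Q.Rep α) (N : Q.Rep β)
    (hM : Function.Surjective (dl M M)) (hN : Function.Surjective (dl N N))
    (eM : ∀ φ : H0 Q α α, dl M M φ = 0 → ∃ c : ℂ, ∀ x, φ x = c • 1)
    (eN : ∀ φ : H0 Q β β, dl N N φ = 0 → ∃ c : ℂ, ∀ x, φ x = c • 1)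
    (hNM : Function.Surjective (dl N M)) (he : Q.euler (natToInt α) (natToInt β) ≤ 0) :
    Function.Injective (dl M N) := by
  rw [injective_iff_map_eq_zero]
  intro f hf0
  by_contra hne
  have hf : ∀ a, f (Q.h a) * M a = N a * f (Q.t a) := (mem_ker_dl _ _ _).1 hf0
  have hfin : Function.Surjective (dl M N) → False := by
    intro hs
    apply hne
    apply dl_inj_of M N hs he
    rw [hf0, map_zero]
  choose s hs using fun x => exists_qinv (f x)
  obtain ⟨ψ, hψ0⟩ := hNM (fun a => s (Q.h a) * N a * (1 - f (Q.t a) * s (Q.t a)))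
  have hψ : ∀ a, ψ (Q.h a) * N a = M a * ψ (Q.t a) + s (Q.h a) * N a * (1 - f (Q.t a) * s (Q.t a)) := by
    intro a
    have := congrFun hψ0 a
    rw [dl_apply] at this
    rw [← this]
    exact (add_sub_cancel _ _).symm
  have hz : ∀ x, (1 - f x * s x) * f x = 0 := by
    intro x
    rw [Matrix.sub_mul, Matrix.one_mul, hs, sub_self]
  obtain ⟨c, hc⟩ := eM (fun x => ψ x * f x) (by
    rw [mem_ker_dl]
    intro a
    change ψ (Q.h a) * f (Q.h a) * M a = M a * (ψ (Q.t a) * f (Q.t a))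
    refine (Matrix.mul_assoc _ _ _).trans ?_
    refine (congrArg (ψ (Q.h a) * ·) (hf a)).trans ?_
    refine (Matrix.mul_assoc _ _ _).symm.trans ?_
    refine (congrArg (· * f (Q.t a)) (hψ a)).trans ?_
    rw [Matrix.add_mul, Matrix.mul_assoc _ (1 - _), hz, Matrix.mul_zero, add_zero, Matrix.mul_assoc])
  obtain ⟨c', hc'⟩ := eN (fun x => f x * ψ x - f x * s x) (by
    rw [mem_ker_dl]
    intro a
    change (f (Q.h a) * ψ (Q.h a) - f (Q.h a) * s (Q.h a)) * N a = N a * (f (Q.t a) * ψ (Q.t a) - f (Q.t a) * s (Q.t a))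
    have k1 : f (Q.h a) * (ψ (Q.h a) * N a) = f (Q.h a) * (M a * ψ (Q.t a)) +
        f (Q.h a) * (s (Q.h a) * N a * (1 - f (Q.t a) * s (Q.t a))) := by
      rw [← Matrix.mul_add]
      exact congrArg (f (Q.h a) * ·) (hψ a)
    have k2 : f (Q.h a) * (M a * ψ (Q.t a)) = N a * (f (Q.t a) * ψ (Q.t a)) := by
      refine (Matrix.mul_assoc _ _ _).symm.trans ?_
      refine (congrArg (· * ψ (Q.t a)) (hf a)).trans ?_
      exact Matrix.mul_assoc _ _ _
    have k3 : f (Q.h a) * (s (Q.h a) * N a * (f (Q.t a) * s (Q.t a))) = N a * (f (Q.t a) * s (Q.t a)) := by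
      have k4 : N a * (f (Q.t a) * s (Q.t a)) = f (Q.h a) * (M a * s (Q.t a)) := by
        refine (Matrix.mul_assoc _ _ _).symm.trans ?_
        refine (congrArg (· * s (Q.t a)) (hf a).symm).trans ?_
        exact Matrix.mul_assoc _ _ _
      refine (congrArg (f (Q.h a) * ·) (Matrix.mul_assoc _ _ _)).trans ?_
      refine (congrArg (fun z => f (Q.h a) * (s (Q.h a) * z)) k4).trans ?_
      rw [k4]
      rw [← Matrix.mul_assoc, ← Matrix.mul_assoc, hs]
    rw [Matrix.mul_sub, Matrix.mul_one, Matrix.mul_sub, k2, k3] at k1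
    rw [Matrix.sub_mul, Matrix.mul_assoc, k1, Matrix.mul_sub, Matrix.mul_assoc]
    abel)
  have inj_case : ∀ p : H0 Q β α, (∀ x, p x * f x = 1) → False := by
    intro p hp
    apply hfin
    intro ξ
    obtain ⟨χ, hχ⟩ := hN (fun a => ξ a * p (Q.t a))
    refine ⟨fun x => χ x * f x, ?_⟩
    funext a
    have h1 := congrFun hχ a
    rw [dl_apply] at h1 ⊢
    have h2 : (χ (Q.h a) * N a - N a * χ (Q.t a)) * f (Q.t a) = ξ a := by
      rw [h1, Matrix.mul_assoc, hp, Matrix.mul_one]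
    rw [← h2, Matrix.sub_mul, Matrix.mul_assoc, Matrix.mul_assoc, Matrix.mul_assoc]
    exact congrArg (fun z => χ (Q.h a) * z - N a * (χ (Q.t a) * f (Q.t a))) (hf a)
  have surj_case : (∀ x, f x * s x = 1) → False := by
    intro hp
    apply hfin
    intro ξ
    obtain ⟨χ, hχ⟩ := hM (fun a => s (Q.h a) * ξ a)
    refine ⟨fun x => f x * χ x, ?_⟩
    funext a
    have h1 := congrFun hχ a
    rw [dl_apply] at h1 ⊢
    have h2 : f (Q.h a) * (χ (Q.h a) * M a - M a * χ (Q.t a)) = ξ a := by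
      rw [h1, ← Matrix.mul_assoc, hp, Matrix.one_mul]
    rw [← h2, Matrix.mul_sub, ← Matrix.mul_assoc, ← Matrix.mul_assoc, ← Matrix.mul_assoc]
    exact congrArg (fun z => f (Q.h a) * χ (Q.h a) * M a - z * χ (Q.t a)) (hf a).symm
  by_cases h0 : c = 0
  · apply surj_case
    have hne' : ∃ x, f x ≠ 0 := by
      by_contra hno
      push Not at hno
      exact hne (funext hno)
    obtain ⟨x0, hx0⟩ := hne'
    have hψf : ∀ x, ψ x * f x = 0 := by
      intro x
      have := hc x
      rw [h0, zero_smul] at this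
      exact this
    have hc1 : c' = -1 := by
      have h1 := congrArg (· * f x0) (hc' x0)
      simp only [Matrix.sub_mul, hs, Matrix.smul_mul, Matrix.one_mul] at h1
      rw [Matrix.mul_assoc, hψf, Matrix.mul_zero, zero_sub] at h1
      have h2 : (c' + 1) • f x0 = 0 := by
        rw [add_smul, ← h1, one_smul, neg_add_cancel]
      rcases smul_eq_zero.1 h2 with h3 | h3
      · linear_combination h3
      · exact absurd h3 hx0
    intro x
    have h1 := hc' x
    simp only [hc1, neg_smul, one_smul] at h1
    have h2 : f x * ψ x = f x * s x - 1 := by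
      rw [sub_eq_iff_eq_add] at h1
      rw [h1]; abel
    have h3 : f x * s x * (f x * ψ x) = f x * ψ x := by
      rw [← Matrix.mul_assoc, hs]
    rw [h2, Matrix.mul_sub, Matrix.mul_one, ← Matrix.mul_assoc, hs, sub_self] at h3
    exact (sub_eq_zero.1 h3.symm)
  · refine inj_case (fun x => c⁻¹ • ψ x) (fun x => ?_)
    have := hc x
    rw [Matrix.smul_mul, this, smul_smul, inv_mul_cancel₀ h0, one_smul]

end EmbThm


namespace EmbThm
open Finset
variable {Q : FinQuiver}

/-- the abstract quiver on `Fin N` with `n i j` arrows from `i` to `j` -/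
abbrev QN {N : ℕ} (n : Fin N → Fin N → ℕ) : FinQuiver where
  V := Fin N
  A := (i : Fin N) × (j : Fin N) × Fin (n i j)
  t := fun a => a.1
  h := fun a => a.2.1

abbrev Iv {N : ℕ} (ε : Fin N → Q.V → ℕ) (α : Fin N → ℕ) : Q.V → ℕ := fun x => ∑ i, α i * ε i x

abbrev KB {N : ℕ} (α : Fin N → ℕ) : Type := (i : Fin N) × Fin (α i)

abbrev TT {N : ℕ} (ε : Fin N → Q.V → ℕ) (α : Fin N → ℕ) (x : Q.V) : Type :=
  (k : KB α) × Fin (ε k.1 x)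

section blocks
variable {N : ℕ} (ε : Fin N → Q.V → ℕ)

def eT1 (α : Fin N → ℕ) (x : Q.V) :
    TT ε α x ≃ (i : Fin N) × (Fin (α i) × Fin (ε i x)) where
  toFun p := ⟨p.1.1, p.1.2, p.2⟩
  invFun p := ⟨⟨p.1, p.2.1⟩, p.2.2⟩
  left_inv _ := rfl
  right_inv _ := rfl

def eT (α : Fin N → ℕ) (x : Q.V) : TT ε α x ≃ Fin (Iv ε α x) :=
  (eT1 ε α x).trans ((Equiv.sigmaCongrRight (fun _ => finProdFinEquiv)).trans finSigmaFinEquiv)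

variable {ε} {α β γ : Fin N → ℕ}

def blkM {x y : Q.V} (M : Matrix (Fin (Iv ε β y)) (Fin (Iv ε α x)) ℂ) (k : KB α) (l : KB β) :
    Matrix (Fin (ε l.1 y)) (Fin (ε k.1 x)) ℂ :=
  Matrix.of fun e' e => M (eT ε β y ⟨l, e'⟩) (eT ε α x ⟨k, e⟩)

def mkM {x y : Q.V} (b : ∀ (k : KB α) (l : KB β), Matrix (Fin (ε l.1 y)) (Fin (ε k.1 x)) ℂ) :
    Matrix (Fin (Iv ε β y)) (Fin (Iv ε α x)) ℂ :=
  Matrix.of fun p q => b ((eT ε α x).symm q).1 ((eT ε β y).symm p).1 ((eT ε β y).symm p).2 ((eT ε α x).symm q).2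

theorem mkM_apply {x y : Q.V} (b : ∀ (k : KB α) (l : KB β), Matrix (Fin (ε l.1 y)) (Fin (ε k.1 x)) ℂ)
    (p : TT ε β y) (q : TT ε α x) :
    mkM b (eT ε β y p) (eT ε α x q) = b q.1 p.1 p.2 q.2 := by
  simp only [mkM, Matrix.of_apply]
  rw [Equiv.symm_apply_apply, Equiv.symm_apply_apply]

theorem blkM_mkM {x y : Q.V} (b : ∀ (k : KB α) (l : KB β), Matrix (Fin (ε l.1 y)) (Fin (ε k.1 x)) ℂ)
    (k : KB α) (l : KB β) : blkM (mkM b) k l = b k l := by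
  ext e' e
  simp only [blkM, Matrix.of_apply, mkM_apply]

theorem blkM_ext {x y : Q.V} (M M' : Matrix (Fin (Iv ε β y)) (Fin (Iv ε α x)) ℂ)
    (h : ∀ k l, blkM M k l = blkM M' k l) : M = M' := by
  ext p q
  obtain ⟨⟨l, e'⟩, rfl⟩ := (eT ε β y).surjective p
  obtain ⟨⟨k, e⟩, rfl⟩ := (eT ε α x).surjective q
  exact congrFun (congrFun (h k l) e') e

theorem blkM_add {x y : Q.V} (M M' : Matrix (Fin (Iv ε β y)) (Fin (Iv ε α x)) ℂ) (k : KB α) (l : KB β) :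
    blkM (M + M') k l = blkM M k l + blkM M' k l := rfl

theorem blkM_sub {x y : Q.V} (M M' : Matrix (Fin (Iv ε β y)) (Fin (Iv ε α x)) ℂ) (k : KB α) (l : KB β) :
    blkM (M - M') k l = blkM M k l - blkM M' k l := rfl

theorem blkM_smul {x y : Q.V} (c : ℂ) (M : Matrix (Fin (Iv ε β y)) (Fin (Iv ε α x)) ℂ) (k : KB α) (l : KB β) :
    blkM (c • M) k l = c • blkM M k l := rfl

theorem blkM_zero {x y : Q.V} (k : KB α) (l : KB β) :
    blkM (0 : Matrix (Fin (Iv ε β y)) (Fin (Iv ε α x)) ℂ) k l = 0 := rfl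

theorem blkM_mul {x y z : Q.V} (M : Matrix (Fin (Iv ε β z)) (Fin (Iv ε γ y)) ℂ)
    (M' : Matrix (Fin (Iv ε γ y)) (Fin (Iv ε α x)) ℂ) (k : KB α) (l : KB β) :
    blkM (M * M') k l = ∑ m : KB γ, blkM M m l * blkM M' k m := by
  ext e' e
  simp only [blkM, Matrix.of_apply, Matrix.mul_apply, Matrix.sum_apply]
  rw [← Equiv.sum_comp (eT ε γ y), Fintype.sum_sigma]

end blocks

/-- the block data coming from an exceptional sequence -/
structure BD (Q : FinQuiver) {N : ℕ} (ε : Fin N → Q.V → ℕ) (n : Fin N → Fin N → ℕ) where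
  E : ∀ i, Q.Rep (ε i)
  ξ : ∀ i j, Fin (n i j) → H1 Q (ε i) (ε j)
  hn : ∀ i j, j ≤ i → n i j = 0
  surj : ∀ i j (ζ : H1 Q (ε i) (ε j)), ∃ φ, ∃ η : Fin (n i j) → ℂ,
    dl (E i) (E j) φ + ∑ r, η r • ξ i j r = ζ
  inj : ∀ i j φ, ∀ η : Fin (n i j) → ℂ, i ≠ j → dl (E i) (E j) φ + ∑ r, η r • ξ i j r = 0 → φ = 0 ∧ η = 0
  x0 : Fin N → Q.V
  y0 : ∀ i, Fin (ε i (x0 i))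
  injd : ∀ i φ, dl (E i) (E i) φ = 0 → φ (x0 i) (y0 i) (y0 i) = 0 → φ = 0

namespace BD
variable {N : ℕ} {ε : Fin N → Q.V → ℕ} {n : Fin N → Fin N → ℕ} (B : BD Q ε n) {α β γ : Fin N → ℕ}

/-- block-diagonal part -/
def Dg (k l : KB α) (a : Q.A) : Matrix (Fin (ε l.1 (Q.h a))) (Fin (ε k.1 (Q.t a))) ℂ :=
  Matrix.of fun e' e => Matrix.blockDiagonal' (fun k : KB α => B.E k.1 a) ⟨l, e'⟩ ⟨k, e⟩

theorem Dg_self (k : KB α) (a : Q.A) : B.Dg k k a = B.E k.1 a := by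
  ext e' e
  simp only [Dg, Matrix.of_apply, Matrix.blockDiagonal'_apply_eq]

theorem Dg_ne (k l : KB α) (h : k ≠ l) (a : Q.A) : B.Dg k l a = 0 := by
  ext e' e
  simp only [Dg, Matrix.of_apply]
  exact Matrix.blockDiagonal'_apply_ne _ _ _ h.symm

/-- off-diagonal part -/
noncomputable def Off (η : H1 (QN n) α β) (k : KB α) (l : KB β) : H1 Q (ε k.1) (ε l.1) :=
  ∑ r : Fin (n k.1 l.1), (η ⟨k.1, l.1, r⟩ : Matrix (Fin (β l.1)) (Fin (α k.1)) ℂ) l.2 k.2 • B.ξ k.1 l.1 r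

noncomputable def Phi (U : (QN n).Rep α) : Q.Rep (Iv ε α) :=
  fun a => mkM fun k l => B.Dg k l a + B.Off U k l a

theorem blk_Phi (U : (QN n).Rep α) (a : Q.A) (k l : KB α) :
    blkM (B.Phi U a) k l = B.Dg k l a + B.Off U k l a := blkM_mkM _ _ _

/-- the key block formula -/
theorem blk_dl (U : (QN n).Rep α) (U' : (QN n).Rep β) (φ : H0 Q (Iv ε α) (Iv ε β)) (a : Q.A)
    (k : KB α) (l : KB β) :
    blkM (dl (B.Phi U) (B.Phi U') φ a) k l =
      dl (B.E k.1) (B.E l.1) (fun x => blkM (φ x) k l) a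
      + ∑ m, blkM (φ (Q.h a)) m l * B.Off U k m a - ∑ m, B.Off U' m l a * blkM (φ (Q.t a)) k m := by
  rw [dl_apply, dl_apply, blkM_sub, blkM_mul, blkM_mul]
  simp only [blk_Phi, Matrix.mul_add, Matrix.add_mul, Finset.sum_add_distrib]
  rw [Finset.sum_eq_single k (fun m _ hm => by rw [Dg_ne _ _ _ hm.symm, Matrix.mul_zero]) (by simp),
    Finset.sum_eq_single l (fun m _ hm => by rw [Dg_ne _ _ _ hm, Matrix.zero_mul]) (by simp), Dg_self, Dg_self]
  abel

noncomputable def J0b (u : H0 (QN n) α β) (x : Q.V) (k : KB α) (l : KB β) :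
    Matrix (Fin (ε l.1 x)) (Fin (ε k.1 x)) ℂ :=
  Matrix.of fun e' e =>
    Matrix.blockDiagonal' (fun i => (u i : Matrix (Fin (β i)) (Fin (α i)) ℂ)) l k *
      (if (⟨l.1, e'⟩ : (i : Fin N) × Fin (ε i x)) = ⟨k.1, e⟩ then 1 else 0)

/-- `u ↦ u ⊗ 1` -/
noncomputable def J0 (ε : Fin N → Q.V → ℕ) (n : Fin N → Fin N → ℕ) (α β : Fin N → ℕ) :
    H0 (QN n) α β →ₗ[ℂ] H0 Q (Iv ε α) (Iv ε β) where
  toFun u x := mkM (J0b u x)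
  map_add' u v := by
    funext x
    ext p q
    have h : (Matrix.blockDiagonal' (fun i => ((u + v) i : Matrix (Fin (β i)) (Fin (α i)) ℂ)))
      = Matrix.blockDiagonal' (fun i => (u i : Matrix (Fin (β i)) (Fin (α i)) ℂ)) +
        Matrix.blockDiagonal' (fun i => (v i : Matrix (Fin (β i)) (Fin (α i)) ℂ)) :=
      Matrix.blockDiagonal'_add _ _
    simp only [mkM, J0b, Matrix.of_apply, Pi.add_apply, Matrix.add_apply] at h ⊢
    rw [h, Matrix.add_apply, add_mul]
  map_smul' c u := by
    funext x
    ext p q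
    have h : (Matrix.blockDiagonal' (fun i => ((c • u) i : Matrix (Fin (β i)) (Fin (α i)) ℂ)))
      = c • Matrix.blockDiagonal' (fun i => (u i : Matrix (Fin (β i)) (Fin (α i)) ℂ)) :=
      Matrix.blockDiagonal'_smul _ _
    simp only [mkM, J0b, Matrix.of_apply, Pi.smul_apply, Matrix.smul_apply, RingHom.id_apply] at h ⊢
    rw [h, Matrix.smul_apply, smul_eq_mul, smul_eq_mul, mul_assoc]

theorem blk_J0_self (u : H0 (QN n) α β) (x : Q.V) (i : Fin N) (a : Fin (α i)) (b : Fin (β i)) :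
    blkM (J0 ε n α β u x) ⟨i, a⟩ ⟨i, b⟩ = (u i : Matrix (Fin (β i)) (Fin (α i)) ℂ) b a • (1 : Matrix (Fin (ε i x)) (Fin (ε i x)) ℂ) := by
  ext e' e
  refine (mkM_apply (J0b u x) ⟨⟨i, b⟩, e'⟩ ⟨⟨i, a⟩, e⟩).trans ?_
  simp only [J0b, Matrix.of_apply, Matrix.blockDiagonal'_apply_eq, Matrix.smul_apply, smul_eq_mul, Matrix.one_apply]
  congr 1
  simp

theorem blk_J0_ne (u : H0 (QN n) α β) (x : Q.V) (k : KB α) (l : KB β) (h : k.1 ≠ l.1) :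
    blkM (J0 ε n α β u x) k l = 0 := by
  ext e' e
  refine (mkM_apply (J0b u x) ⟨l, e'⟩ ⟨k, e⟩).trans ?_
  simp only [J0b, Matrix.of_apply]
  have : Matrix.blockDiagonal' (fun i => (u i : Matrix (Fin (β i)) (Fin (α i)) ℂ)) l k = 0 :=
    Matrix.blockDiagonal'_apply_ne _ _ _ h.symm
  rw [this, zero_mul]
  rfl

theorem Off_add (η η' : H1 (QN n) α β) (k : KB α) (l : KB β) : B.Off (η + η') k l = B.Off η k l + B.Off η' k l := by
  simp only [Off]
  rw [← Finset.sum_add_distrib]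
  refine Finset.sum_congr rfl (fun r _ => ?_)
  rw [← add_smul]
  rfl

theorem Off_smul (c : ℂ) (η : H1 (QN n) α β) (k : KB α) (l : KB β) : B.Off (c • η) k l = c • B.Off η k l := by
  simp only [Off]
  rw [Finset.smul_sum]
  refine Finset.sum_congr rfl (fun r _ => ?_)
  rw [smul_smul]
  rfl

noncomputable def J1 (α β : Fin N → ℕ) : H1 (QN n) α β →ₗ[ℂ] H1 Q (Iv ε α) (Iv ε β) where
  toFun η a := mkM fun k l => B.Off η k l a
  map_add' η η' := by
    funext a
    ext p q
    simp only [mkM, Off_add, Matrix.of_apply, Pi.add_apply, Matrix.add_apply]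
  map_smul' c η := by
    funext a
    ext p q
    simp only [mkM, Off_smul, Matrix.of_apply, Pi.smul_apply, Matrix.smul_apply, RingHom.id_apply]

theorem blk_J1 (η : H1 (QN n) α β) (a : Q.A) (k : KB α) (l : KB β) :
    blkM (B.J1 α β η a) k l = B.Off η k l a :=
  blkM_mkM (fun k l => B.Off η k l a) k l

def Pi0 (α β : Fin N → ℕ) : H0 Q (Iv ε α) (Iv ε β) →ₗ[ℂ] H0 (QN n) α β where
  toFun φ := fun (i : Fin N) => (Matrix.of fun b a => blkM (φ (B.x0 i)) ⟨i, a⟩ ⟨i, b⟩ (B.y0 i) (B.y0 i) :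
    Matrix (Fin (β i)) (Fin (α i)) ℂ)
  map_add' _ _ := rfl
  map_smul' _ _ := rfl

theorem Pi0_J0 (u : H0 (QN n) α β) : B.Pi0 α β (J0 ε n α β u) = u := by
  funext i
  ext b a
  change blkM (J0 ε n α β u (B.x0 i)) ⟨i, a⟩ ⟨i, b⟩ (B.y0 i) (B.y0 i) = _
  refine (congrFun (congrFun (blk_J0_self u (B.x0 i) i a b) (B.y0 i)) (B.y0 i)).trans ?_
  rw [Matrix.smul_apply, Matrix.one_apply_eq, smul_eq_mul, mul_one]

theorem Off_apply (η : H1 (QN n) α β) (k : KB α) (l : KB β) (a : Q.A) :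
    B.Off η k l a = ∑ r : Fin (n k.1 l.1),
      (η ⟨k.1, l.1, r⟩ : Matrix (Fin (β l.1)) (Fin (α k.1)) ℂ) l.2 k.2 • B.ξ k.1 l.1 r a := by
  simp only [Off, Finset.sum_apply, Pi.smul_apply]

theorem sum_swap {ι κ M : Type*} [Fintype ι] [Fintype κ] [AddCommGroup M] [Module ℂ M] (c : ι → ℂ)
    (d : κ → ι → ℂ) (x : κ → M) :
    ∑ v, c v • ∑ r, d r v • x r = ∑ r, (∑ v, c v * d r v) • x r := by
  simp only [Finset.smul_sum, Finset.sum_smul, smul_smul]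
  exact Finset.sum_comm

theorem dl_J0 (U : (QN n).Rep α) (U' : (QN n).Rep β) (u : H0 (QN n) α β) :
    dl (B.Phi U) (B.Phi U') (J0 ε n α β u) = B.J1 α β (dl U U' u) := by
  funext a
  apply blkM_ext
  rintro ⟨i, p⟩ ⟨j, q⟩
  rw [blk_dl, blk_J1]
  have h1 : dl (B.E i) (B.E j) (fun x => blkM (J0 ε n α β u x) ⟨i, p⟩ ⟨j, q⟩) a = 0 := by
    by_cases h : i = j
    · subst h
      have : (fun x => blkM (J0 ε n α β u x) ⟨i, p⟩ ⟨i, q⟩) =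
          (fun x => (u i : Matrix (Fin (β i)) (Fin (α i)) ℂ) q p • (1 : Matrix (Fin (ε i x)) (Fin (ε i x)) ℂ)) := by
        funext x; exact blk_J0_self _ _ _ _ _
      rw [this, dl_apply]
      rw [Matrix.smul_mul, Matrix.mul_smul]
      refine sub_eq_zero.2 (congrArg _ ?_)
      exact (Matrix.one_mul _).trans (Matrix.mul_one _).symm
    · have : (fun x => blkM (J0 ε n α β u x) ⟨i, p⟩ ⟨j, q⟩) = 0 := by
        funext x; exact blk_J0_ne _ _ _ _ h
      rw [this, map_zero]; rfl
  have h2 : ∑ m : KB α, blkM (J0 ε n α β u (Q.h a)) m ⟨j, q⟩ * B.Off U ⟨i, p⟩ m a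
      = ∑ v : Fin (α j), (u j : Matrix (Fin (β j)) (Fin (α j)) ℂ) q v • B.Off U ⟨i, p⟩ ⟨j, v⟩ a := by
    rw [Fintype.sum_sigma, Finset.sum_eq_single j]
    · refine Finset.sum_congr rfl (fun v _ => ?_)
      rw [blk_J0_self, Matrix.smul_mul]
      refine congrArg _ (Matrix.one_mul _)
    · intro j' _ hj'
      refine Finset.sum_eq_zero (fun v _ => ?_)
      rw [blk_J0_ne _ _ _ _ hj', Matrix.zero_mul]
    · simp
  have h3 : ∑ m : KB β, B.Off U' m ⟨j, q⟩ a * blkM (J0 ε n α β u (Q.t a)) ⟨i, p⟩ m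
      = ∑ v : Fin (β i), (u i : Matrix (Fin (β i)) (Fin (α i)) ℂ) v p • B.Off U' ⟨i, v⟩ ⟨j, q⟩ a := by
    rw [Fintype.sum_sigma, Finset.sum_eq_single i]
    · refine Finset.sum_congr rfl (fun v _ => ?_)
      rw [blk_J0_self, Matrix.mul_smul]
      refine congrArg _ (Matrix.mul_one _)
    · intro j' _ hj'
      refine Finset.sum_eq_zero (fun v _ => ?_)
      rw [blk_J0_ne _ _ _ _ hj'.symm, Matrix.mul_zero]
    · simp
  have h4 : ∀ r : Fin (n i j), (dl U U' u ⟨i, j, r⟩ : Matrix (Fin (β j)) (Fin (α i)) ℂ) q p =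
      ∑ v : Fin (α j), (u j : Matrix (Fin (β j)) (Fin (α j)) ℂ) q v *
        (U ⟨i, j, r⟩ : Matrix (Fin (α j)) (Fin (α i)) ℂ) v p -
      ∑ v : Fin (β i), (U' ⟨i, j, r⟩ : Matrix (Fin (β j)) (Fin (β i)) ℂ) q v *
        (u i : Matrix (Fin (β i)) (Fin (α i)) ℂ) v p := fun r => rfl
  rw [h1, h2, h3, zero_add]
  have h5 : B.Off (dl U U' u) ⟨i, p⟩ ⟨j, q⟩ a =
      ∑ r : Fin (n i j), (∑ v : Fin (α j), (u j : Matrix (Fin (β j)) (Fin (α j)) ℂ) q v *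
        (U ⟨i, j, r⟩ : Matrix (Fin (α j)) (Fin (α i)) ℂ) v p) • B.ξ i j r a -
      ∑ r : Fin (n i j), (∑ v : Fin (β i), (U' ⟨i, j, r⟩ : Matrix (Fin (β j)) (Fin (β i)) ℂ) q v *
        (u i : Matrix (Fin (β i)) (Fin (α i)) ℂ) v p) • B.ξ i j r a := by
    rw [Off_apply, ← Finset.sum_sub_distrib]
    refine Finset.sum_congr rfl (fun r _ => ?_)
    rw [← sub_smul]
    exact congrArg (fun z : ℂ => z • B.ξ i j r a) (h4 r)
  refine Eq.trans ?_ h5.symm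
  refine congrArg₂ (fun y z => y - z) ?_ ?_
  · refine Eq.trans (Finset.sum_congr rfl (fun v _ => ?_))
      (sum_swap (fun v : Fin (α j) => (u j : Matrix (Fin (β j)) (Fin (α j)) ℂ) q v)
        (fun (r : Fin (n i j)) v => (U ⟨i, j, r⟩ : Matrix (Fin (α j)) (Fin (α i)) ℂ) v p) (fun r => B.ξ i j r a))
    exact congrArg (fun z => (u j : Matrix (Fin (β j)) (Fin (α j)) ℂ) q v • z) (B.Off_apply U ⟨i, p⟩ ⟨j, v⟩ a)
  · refine Eq.trans (Finset.sum_congr rfl (fun v _ => ?_))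
      ((sum_swap (fun v : Fin (β i) => (u i : Matrix (Fin (β i)) (Fin (α i)) ℂ) v p)
        (fun (r : Fin (n i j)) v => (U' ⟨i, j, r⟩ : Matrix (Fin (β j)) (Fin (β i)) ℂ) q v)
        (fun r => B.ξ i j r a)).trans (Finset.sum_congr rfl (fun r _ => ?_)))
    · exact congrArg (fun z => (u i : Matrix (Fin (β i)) (Fin (α i)) ℂ) v p • z) (B.Off_apply U' ⟨i, v⟩ ⟨j, q⟩ a)
    · exact congrArg (fun z : ℂ => z • B.ξ i j r a) (Finset.sum_congr rfl (fun v _ => mul_comm _ _))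

end BD
end EmbThm


namespace EmbThm
open Finset
variable {Q : FinQuiver}
namespace BD
variable {N : ℕ} {ε : Fin N → Q.V → ℕ} {n : Fin N → Fin N → ℕ} (B : BD Q ε n) {α β γ : Fin N → ℕ}

theorem Off_eq_zero (η : H1 (QN n) α β) (k : KB α) (l : KB β) (h : l.1 ≤ k.1) : B.Off η k l = 0 := by
  have : IsEmpty (Fin (n k.1 l.1)) := by rw [B.hn _ _ h]; infer_instance
  exact Fintype.sum_empty _

theorem Th_inj (U : (QN n).Rep α) (U' : (QN n).Rep β) (φ : H0 Q (Iv ε α) (Iv ε β)) (η : H1 (QN n) α β)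
    (h : dl (B.Phi U) (B.Phi U') φ + B.J1 α β η = 0) (hP : B.Pi0 α β φ = 0) : φ = 0 ∧ η = 0 := by
  have key : ∀ m : ℕ, ∀ (k : KB α) (l : KB β), l.1.val + (N - k.1.val) = m →
      (∀ x, blkM (φ x) k l = 0) ∧
      (∀ r, (η ⟨k.1, l.1, r⟩ : Matrix (Fin (β l.1)) (Fin (α k.1)) ℂ) l.2 k.2 = 0) := by
    intro m
    induction m using Nat.strong_induction_on with
    | _ m ih =>
    rintro k l hm
    have hb : dl (B.E k.1) (B.E l.1) (fun x => blkM (φ x) k l) + B.Off η k l = 0 := by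
      funext a
      have h1 : blkM (dl (B.Phi U) (B.Phi U') φ a + B.J1 α β η a) k l = 0 := by
        have : dl (B.Phi U) (B.Phi U') φ a + B.J1 α β η a = 0 := congrFun h a
        rw [this]; rfl
      rw [blkM_add, blk_dl, blk_J1] at h1
      have h2 : ∑ m, blkM (φ (Q.h a)) m l * B.Off U k m a = 0 := by
        refine Finset.sum_eq_zero (fun m' _ => ?_)
        by_cases hk : m'.1 ≤ k.1
        · exact (congrArg (fun z => blkM (φ (Q.h a)) m' l * z) (congrFun (B.Off_eq_zero U k m' hk) a)).trans (Matrix.mul_zero _)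
        · push Not at hk
          rw [(ih (l.1.val + (N - m'.1.val)) (by have := m'.1.2; have : k.1.val < m'.1.val := hk; omega) m' l rfl).1]
          exact Matrix.zero_mul _
      have h3 : ∑ m, B.Off U' m l a * blkM (φ (Q.t a)) k m = 0 := by
        refine Finset.sum_eq_zero (fun m' _ => ?_)
        by_cases hk : l.1 ≤ m'.1
        · exact (congrArg (fun z => z * blkM (φ (Q.t a)) k m') (congrFun (B.Off_eq_zero U' m' l hk) a)).trans (Matrix.zero_mul _)
        · push Not at hk
          rw [(ih (m'.1.val + (N - k.1.val)) (by have : m'.1.val < l.1.val := hk; omega) k m' rfl).1]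
          exact Matrix.mul_zero _
      rw [h2, h3, add_zero, sub_zero] at h1
      exact h1
    by_cases hkl : k.1 = l.1
    · obtain ⟨i, p⟩ := k
      obtain ⟨j, q⟩ := l
      simp only at hkl
      subst hkl
      constructor
      · rw [B.Off_eq_zero η ⟨i, p⟩ ⟨i, q⟩ le_rfl, add_zero] at hb
        have := B.injd i _ hb (congrFun (congrFun (congrFun hP i) q) p)
        intro x
        exact congrFun this x
      · intro r
        have h0 : n i i = 0 := B.hn _ _ le_rfl
        have h1 : r.val < n i i := r.2
        omega
    · have := B.inj k.1 l.1 _ _ hkl hb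
      exact ⟨fun x => congrFun this.1 x, fun r => congrFun this.2 r⟩
  constructor
  · funext x
    exact blkM_ext _ _ (fun k l => (key _ k l rfl).1 x)
  · funext ⟨i, j, r⟩
    ext q p
    exact (key _ ⟨i, p⟩ ⟨j, q⟩ rfl).2 r

def Z0 (n : Fin N → Fin N → ℕ) (α : Fin N → ℕ) : (QN n).Rep α := fun _ => 0

theorem Off_Z0 (k l : KB α) : B.Off (Z0 n α) k l = 0 := by
  refine Finset.sum_eq_zero (fun r _ => ?_)
  exact zero_smul ℂ _

theorem blk_Z0 (a : Q.A) (k l : KB α) : blkM (B.Phi (Z0 n α) a) k l = B.Dg k l a :=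
  (B.blk_Phi (Z0 n α) a k l).trans
    ((congrArg (fun z : H1 Q (ε k.1) (ε l.1) => B.Dg k l a + z a) (B.Off_Z0 k l)).trans (add_zero _))

theorem blk_dlZ0 (φ : H0 Q (Iv ε α) (Iv ε α)) (a : Q.A) (k l : KB α) :
    blkM (dl (B.Phi (Z0 n α)) (B.Phi (Z0 n α)) φ a) k l =
      dl (B.E k.1) (B.E l.1) (fun x => blkM (φ x) k l) a := by
  refine (B.blk_dl (Z0 n α) (Z0 n α) φ a k l).trans ?_
  have h2 : ∑ m, blkM (φ (Q.h a)) m l * B.Off (Z0 n α) k m a = 0 :=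
    Finset.sum_eq_zero (fun m' _ => (congrArg (fun z => blkM (φ (Q.h a)) m' l * z)
      (congrFun (B.Off_Z0 k m') a)).trans (Matrix.mul_zero _))
  have h3 : ∑ m, B.Off (Z0 n α) m l a * blkM (φ (Q.t a)) k m = 0 :=
    Finset.sum_eq_zero (fun m' _ => (congrArg (fun z => z * blkM (φ (Q.t a)) k m')
      (congrFun (B.Off_Z0 m' l) a)).trans (Matrix.zero_mul _))
  rw [h2, h3, add_zero, sub_zero]

theorem Phi_eq (U : (QN n).Rep α) (a : Q.A) : B.Phi U a = B.Phi (Z0 n α) a + B.J1 α α U a := by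
  apply blkM_ext
  intro k l
  exact (B.blk_Phi U a k l).trans (congrArg₂ (fun y z => y + z) (B.blk_Z0 a k l).symm (B.blk_J1 U a k l).symm)

theorem subm (ζ : H1 Q (Iv ε α) (Iv ε α)) :
    ∃ X, ∃ u : H1 (QN n) α α, dl (B.Phi (Z0 n α)) (B.Phi (Z0 n α)) X + B.J1 α α u = ζ := by
  choose φ η h using fun (k l : KB α) => B.surj k.1 l.1 (fun a => blkM (ζ a) k l)
  refine ⟨fun x => mkM fun k l => φ k l x,
    fun (e : (i : Fin N) × (j : Fin N) × Fin (n i j)) =>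
      (Matrix.of fun q p => η ⟨e.1, p⟩ ⟨e.2.1, q⟩ e.2.2 : Matrix (Fin (α e.2.1)) (Fin (α e.1)) ℂ), ?_⟩
  funext a
  apply blkM_ext
  intro k l
  refine (blkM_add _ _ _ _).trans ?_
  refine (congrArg₂ (fun y z => y + z) (B.blk_dlZ0 _ a k l) (B.blk_J1 _ a k l)).trans ?_
  refine Eq.trans ?_ (congrFun (h k l) a)
  have : (fun x => blkM (mkM fun k l => φ k l x) k l) = φ k l := by
    funext x; exact blkM_mkM (fun k l => φ k l x) k l
  rw [this]
  rfl

end BD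
end EmbThm


namespace EmbThm
open Finset
variable {Q : FinQuiver}

theorem det_factor {c d : Type*} [Fintype c] [DecidableEq c] [Fintype d] [DecidableEq d]
    (D : Matrix c c ℂ) (J : Matrix c d ℂ) (P : Matrix d c ℂ) (K : Matrix c d ℂ) (D' : Matrix d d ℂ)
    (h1 : D * K = J * D') (h2 : P * K = 1) :
    D.det = (Matrix.fromBlocks D J P 0).det * ((-1) ^ Fintype.card d * D'.det) := by
  have h : Matrix.fromBlocks D J P 0 * Matrix.fromBlocks 1 K 0 (-D') = Matrix.fromBlocks D 0 P 1 := by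
    rw [Matrix.fromBlocks_multiply]
    simp [h1, h2]
  have h' := congrArg Matrix.det h
  rw [Matrix.det_mul, Matrix.det_fromBlocks_zero₂₁, Matrix.det_fromBlocks_zero₁₂, Matrix.det_neg] at h'
  simpa using h'.symm

theorem pf_nonvanishing {β : Q.V → ℕ} {f : Q.Rep β → ℂ} (hf : Q.IsPolyFun f) (h : ∀ W, f W ≠ 0) :
    ∃ c : ℂ, c ≠ 0 ∧ ∀ W, f W = c := by
  obtain ⟨P, hP⟩ := hf
  refine ⟨f (fun _ => 0), h _, fun W => ?_⟩
  let R : Polynomial ℂ := MvPolynomial.aeval (fun i : (a : Q.A) × (Fin (β (Q.h a)) × Fin (β (Q.t a))) =>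
    Polynomial.X * Polynomial.C (W i.1 i.2.1 i.2.2)) P
  have hR : ∀ t : ℂ, R.eval t = f (fun a => t • W a) := by
    intro t
    refine Eq.trans ?_ (hP _).symm
    change (Polynomial.evalRingHom t) (MvPolynomial.aeval _ P) = _
    rw [MvPolynomial.aeval_def, ← MvPolynomial.coe_eval₂Hom, ← RingHom.comp_apply, MvPolynomial.comp_eval₂Hom]
    change _ = MvPolynomial.eval₂ _ _ P
    rw [MvPolynomial.coe_eval₂Hom]
    congr 1
    · ext; simp
    · funext i
      change Polynomial.eval t _ = _
      rw [Polynomial.eval_mul, Polynomial.eval_X, Polynomial.eval_C]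
      rfl
  have hdeg : R.degree = 0 := by
    by_contra hd
    obtain ⟨t, ht⟩ := IsAlgClosed.exists_root R hd
    exact h _ ((hR t).symm.trans ht)
  have h1 := Polynomial.eq_C_of_degree_eq_zero hdeg
  have e1 : R.eval 1 = R.eval 0 := by rw [h1]; simp
  rw [hR, hR] at e1
  have a1 : (fun a => (1 : ℂ) • W a) = W := by funext a; exact one_smul _ _
  have a0 : (fun a => (0 : ℂ) • W a) = (fun _ => 0 : Q.Rep β) := by funext a; exact zero_smul _ _
  exact ((congrArg f a1).symm.trans e1).trans (congrArg f a0)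

namespace BD
variable {N : ℕ} {ε : Fin N → Q.V → ℕ} {n : Fin N → Fin N → ℕ} (B : BD Q ε n) {α β γ : Fin N → ℕ}

noncomputable def J1m (α β : Fin N → ℕ) : Matrix (C1 Q (Iv ε α) (Iv ε β)) (C1 (QN n) α β) ℂ :=
  LinearMap.toMatrix' ((vec1 Q (Iv ε α) (Iv ε β)).toLinearMap ∘ₗ B.J1 α β ∘ₗ (vec1 (QN n) α β).symm.toLinearMap)

noncomputable def J0m (ε : Fin N → Q.V → ℕ) (n : Fin N → Fin N → ℕ) (α β : Fin N → ℕ) :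
    Matrix (C0 Q (Iv ε α) (Iv ε β)) (C0 (QN n) α β) ℂ :=
  LinearMap.toMatrix' ((vec0 Q (Iv ε α) (Iv ε β)).toLinearMap ∘ₗ J0 ε n α β ∘ₗ (vec0 (QN n) α β).symm.toLinearMap)

noncomputable def Pm (α β : Fin N → ℕ) : Matrix (C0 (QN n) α β) (C0 Q (Iv ε α) (Iv ε β)) ℂ :=
  LinearMap.toMatrix' ((vec0 (QN n) α β).toLinearMap ∘ₗ B.Pi0 α β ∘ₗ (vec0 Q (Iv ε α) (Iv ε β)).symm.toLinearMap)

theorem J1m_mulVec (z : C1 (QN n) α β → ℂ) :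
    (B.J1m α β).mulVec z = vec1 Q (Iv ε α) (Iv ε β) (B.J1 α β ((vec1 (QN n) α β).symm z)) :=
  LinearMap.toMatrix'_mulVec _ _

theorem J0m_mulVec (z : C0 (QN n) α β → ℂ) :
    (J0m ε n α β).mulVec z = vec0 Q (Iv ε α) (Iv ε β) (J0 ε n α β ((vec0 (QN n) α β).symm z)) :=
  LinearMap.toMatrix'_mulVec _ _

theorem Pm_mulVec (z : C0 Q (Iv ε α) (Iv ε β) → ℂ) :
    (B.Pm α β).mulVec z = vec0 (QN n) α β (B.Pi0 α β ((vec0 Q (Iv ε α) (Iv ε β)).symm z)) :=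
  LinearMap.toMatrix'_mulVec _ _

theorem dmat_mulVec' {Q : FinQuiver} {α β : Q.V → ℕ} (V : Q.Rep α) (W : Q.Rep β) (z : C0 Q α β → ℂ) :
    (dmat V W).mulVec z = vec1 Q α β (dl V W ((vec0 Q α β).symm z)) := by
  rw [← dmat_mulVec, LinearEquiv.apply_symm_apply]

theorem rel1 (U : (QN n).Rep α) (U' : (QN n).Rep β) :
    dmat (B.Phi U) (B.Phi U') * J0m ε n α β = B.J1m α β * dmat U U' := by
  refine Matrix.mulVec_injective ?_
  funext z
  rw [← Matrix.mulVec_mulVec, ← Matrix.mulVec_mulVec, J0m_mulVec, J1m_mulVec, dmat_mulVec', dmat_mulVec',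
    LinearEquiv.symm_apply_apply, LinearEquiv.symm_apply_apply, dl_J0]

theorem rel2 : B.Pm α β * J0m ε n α β = 1 := by
  refine Matrix.mulVec_injective ?_
  funext z
  rw [← Matrix.mulVec_mulVec, J0m_mulVec, Pm_mulVec, LinearEquiv.symm_apply_apply, Pi0_J0, Matrix.one_mulVec,
    LinearEquiv.apply_symm_apply]

noncomputable def ThM (e0 : C1 Q (Iv ε α) (Iv ε β) ≃ C0 Q (Iv ε α) (Iv ε β))
    (e1 : C1 (QN n) α β ≃ C0 (QN n) α β) (U : (QN n).Rep α) (U' : (QN n).Rep β) :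
    Matrix (C1 Q (Iv ε α) (Iv ε β) ⊕ C0 (QN n) α β) (C1 Q (Iv ε α) (Iv ε β) ⊕ C0 (QN n) α β) ℂ :=
  Matrix.fromBlocks ((dmat (B.Phi U) (B.Phi U')).submatrix id e0) ((B.J1m α β).submatrix id e1.symm)
    ((B.Pm α β).submatrix id e0) 0

theorem ThM_det (e0 : C1 Q (Iv ε α) (Iv ε β) ≃ C0 Q (Iv ε α) (Iv ε β))
    (e1 : C1 (QN n) α β ≃ C0 (QN n) α β) (U : (QN n).Rep α) (U' : (QN n).Rep β) :
    (B.ThM e0 e1 U U').det ≠ 0 := by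
  rw [← isUnit_iff_ne_zero, ← Matrix.isUnit_iff_isUnit_det, ← Matrix.mulVec_injective_iff_isUnit]
  refine (injective_iff_map_eq_zero (Matrix.mulVecLin _)).2 ?_
  intro v hv
  rw [Matrix.mulVecLin_apply] at hv
  have hs : ∀ (p : Type) [Fintype p] (M : Matrix p (C0 Q (Iv ε α) (Iv ε β)) ℂ) (z : C1 Q (Iv ε α) (Iv ε β) → ℂ),
      (M.submatrix id e0).mulVec z = M.mulVec (z ∘ e0.symm) := by
    intro p _ M z
    have := Matrix.submatrix_mulVec_equiv M z id e0
    simpa using this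
  have hs' : ((B.J1m α β).submatrix id e1.symm).mulVec (v ∘ Sum.inr) =
      (B.J1m α β).mulVec ((v ∘ Sum.inr) ∘ e1) := by
    have := Matrix.submatrix_mulVec_equiv (B.J1m α β) (v ∘ Sum.inr) id e1.symm
    simpa using this
  rw [ThM, Matrix.fromBlocks_mulVec, hs', hs, hs, Matrix.zero_mulVec, add_zero, dmat_mulVec', J1m_mulVec, Pm_mulVec] at hv
  have hv1 : ∀ p, (vec1 Q (Iv ε α) (Iv ε β) (dl (B.Phi U) (B.Phi U') ((vec0 Q (Iv ε α) (Iv ε β)).symm ((v ∘ Sum.inl) ∘ e0.symm))) +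
      vec1 Q (Iv ε α) (Iv ε β) (B.J1 α β ((vec1 (QN n) α β).symm ((v ∘ Sum.inr) ∘ e1)))) p = 0 :=
    fun p => congrFun hv (Sum.inl p)
  have hv2 : ∀ p, (vec0 (QN n) α β (B.Pi0 α β ((vec0 Q (Iv ε α) (Iv ε β)).symm ((v ∘ Sum.inl) ∘ e0.symm)))) p = 0 :=
    fun p => congrFun hv (Sum.inr p)
  have hv1' := funext hv1
  rw [← map_add] at hv1'
  have w1 := (vec1 Q (Iv ε α) (Iv ε β)).map_eq_zero_iff.1 hv1'
  have w2 := (vec0 (QN n) α β).map_eq_zero_iff.1 (funext hv2)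
  obtain ⟨r1, r2⟩ := B.Th_inj U U' _ _ w1 w2
  have r1' := (vec0 Q (Iv ε α) (Iv ε β)).symm.map_eq_zero_iff.1 r1
  have r2' := (vec1 (QN n) α β).symm.map_eq_zero_iff.1 r2
  funext p
  rcases p with p | p
  · have := congrFun r1' (e0 p)
    simpa using this
  · have := congrFun r2' (e1.symm p)
    simpa using this

theorem pf_Phi (a : Q.A) (i j) : (QN n).IsPolyFun (fun U : (QN n).Rep α => B.Phi U a i j) := by
  obtain ⟨⟨l, e'⟩, rfl⟩ := (eT ε α (Q.h a)).surjective i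
  obtain ⟨⟨k, e⟩, rfl⟩ := (eT ε α (Q.t a)).surjective j
  have : (fun U : (QN n).Rep α => B.Phi U a (eT ε α (Q.h a) ⟨l, e'⟩) (eT ε α (Q.t a) ⟨k, e⟩)) =
      fun U => B.Dg k l a e' e + ∑ r : Fin (n k.1 l.1), (U ⟨k.1, l.1, r⟩ : Matrix (Fin (α l.1)) (Fin (α k.1)) ℂ) l.2 k.2
        * B.ξ k.1 l.1 r a e' e := by
    funext U
    refine (congrFun (congrFun (B.blk_Phi U a k l) e') e).trans ?_
    refine congrArg (fun z => B.Dg k l a e' e + z) ?_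
    refine (congrFun (congrFun (B.Off_apply U k l a) e') e).trans ?_
    exact Matrix.sum_apply _ _ _ _
  rw [this]
  refine pf_add (pf_const _) (pf_sum _ _ (fun r => pf_mul ?_ (pf_const _)))
  exact pf_coord (Q := QN n) (β := α) ⟨k.1, l.1, r⟩ l.2 k.2

theorem cV_Phi (e0 : C1 Q (Iv ε α) (Iv ε β) ≃ C0 Q (Iv ε α) (Iv ε β))
    (e1 : C1 (QN n) α β ≃ C0 (QN n) α β) (U : (QN n).Rep α) :
    ∃ c : ℂ, c ≠ 0 ∧ ∀ U' : (QN n).Rep β, cV e0 (B.Phi U) (B.Phi U') = c * cV e1 U U' := by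
  have hpf : (QN n).IsPolyFun (fun U' => (B.ThM e0 e1 U U').det) := by
    refine pf_det _ (fun i j => ?_)
    rcases i with i | i <;> rcases j with j | j
    · exact pf_comp (Q := QN n) (fun U' : (QN n).Rep β => B.Phi U') (B.pf_Phi)
        (f := fun W => dmat (B.Phi U) W i (e0 j)) (pf_sub (pf_const _) (pf_mul (pf_const _) (pf_hat _ _ _)))
    · exact pf_const _
    · exact pf_const _
    · exact pf_const _
  obtain ⟨c, hc, h⟩ := pf_nonvanishing hpf (B.ThM_det e0 e1 U)
  refine ⟨c * (-1) ^ Fintype.card (C0 (QN n) α β), mul_ne_zero hc (pow_ne_zero _ (by norm_num)), fun U' => ?_⟩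
  have key := det_factor ((dmat (B.Phi U) (B.Phi U')).submatrix id e0) ((B.J1m α β).submatrix id e1.symm)
    ((B.Pm α β).submatrix id e0) ((J0m ε n α β).submatrix e0 id) ((dmat U U').submatrix e1.symm id)
    (by
      rw [Matrix.submatrix_mul_equiv, rel1, Matrix.submatrix_mul_equiv])
    (by
      rw [Matrix.submatrix_mul_equiv, rel2, Matrix.submatrix_id_id])
  have h2 : ((dmat U U').submatrix e1.symm id).det = cV e1 U U' := by
    rw [cV, ← Matrix.det_submatrix_equiv_self e1.symm, Matrix.submatrix_submatrix]
    congr 1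
    ext i j
    simp
  rw [h2] at key
  refine key.trans ?_
  have h3 := h U'
  rw [ThM] at h3
  rw [h3, mul_assoc]

end BD
end EmbThm


namespace EmbThm
open Finset
open scoped Kronecker
variable {Q : FinQuiver}
namespace BD
variable {N : ℕ} {ε : Fin N → Q.V → ℕ} {n : Fin N → Fin N → ℕ} (B : BD Q ε n) {α β γ : Fin N → ℕ}

theorem J0_eq (u : H0 (QN n) α β) (x : Q.V) :
    J0 ε n α β u x = (Matrix.blockDiagonal' (fun i : Fin N =>
      (u i : Matrix (Fin (β i)) (Fin (α i)) ℂ) ⊗ₖ (1 : Matrix (Fin (ε i x)) (Fin (ε i x)) ℂ))).submatrix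
        ((eT ε β x).symm.trans (eT1 ε β x)) ((eT ε α x).symm.trans (eT1 ε α x)) := by
  apply blkM_ext
  rintro ⟨i, a⟩ ⟨j, b⟩
  ext e' e
  have hr : blkM ((Matrix.blockDiagonal' (fun i : Fin N =>
      (u i : Matrix (Fin (β i)) (Fin (α i)) ℂ) ⊗ₖ (1 : Matrix (Fin (ε i x)) (Fin (ε i x)) ℂ))).submatrix
        ((eT ε β x).symm.trans (eT1 ε β x)) ((eT ε α x).symm.trans (eT1 ε α x))) ⟨i, a⟩ ⟨j, b⟩ e' e =
      Matrix.blockDiagonal' (fun i : Fin N =>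
      (u i : Matrix (Fin (β i)) (Fin (α i)) ℂ) ⊗ₖ (1 : Matrix (Fin (ε i x)) (Fin (ε i x)) ℂ))
        ⟨j, b, e'⟩ ⟨i, a, e⟩ := by
    simp only [blkM, Matrix.of_apply, Matrix.submatrix_apply, Equiv.trans_apply, Equiv.symm_apply_apply]
    rfl
  rw [hr]
  by_cases h : i = j
  · subst h
    rw [blk_J0_self, Matrix.blockDiagonal'_apply_eq]
    rfl
  · rw [blk_J0_ne _ _ _ _ h, Matrix.blockDiagonal'_apply_ne _ _ _ (Ne.symm h)]
    rfl

theorem J0_mul (u : H0 (QN n) β γ) (v : H0 (QN n) α β) (x : Q.V) :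
    J0 ε n β γ u x * J0 ε n α β v x = J0 ε n α γ (fun i => (u i * v i)) x := by
  rw [J0_eq, J0_eq, J0_eq, Matrix.submatrix_mul_equiv, ← Matrix.blockDiagonal'_mul]
  congr 2
  funext i
  rw [← Matrix.mul_kronecker_mul, Matrix.mul_one]

theorem J0_one (x : Q.V) : J0 ε n α α (fun _ => 1) x = 1 := by
  rw [J0_eq]
  have : (fun i : Fin N => (1 : Matrix (Fin (α i)) (Fin (α i)) ℂ) ⊗ₖ (1 : Matrix (Fin (ε i x)) (Fin (ε i x)) ℂ)) = 1 := by
    funext i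
    exact Matrix.one_kronecker_one
  refine (congrArg (fun z => (Matrix.blockDiagonal' z).submatrix _ _) this).trans ?_
  rw [Matrix.blockDiagonal'_one]
  exact Matrix.submatrix_one_equiv _

theorem J0_det (u : H0 (QN n) α α) (x : Q.V) :
    (J0 ε n α α u x).det = ∏ i : Fin N, (u i : Matrix (Fin (α i)) (Fin (α i)) ℂ).det ^ ε i x := by
  rw [J0_eq, Matrix.det_submatrix_equiv_self, det_bd]
  refine Finset.prod_congr rfl (fun i _ => ?_)
  rw [Matrix.det_kronecker]
  simp

/-- the group homomorphism `GL(β) → GL(I β)` -/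
noncomputable def GJ (ε : Fin N → Q.V → ℕ) (n : Fin N → Fin N → ℕ) (α : Fin N → ℕ) (g : (QN n).GLb α) :
    Q.GLb (Iv ε α) := fun x =>
  ⟨J0 ε n α α (fun i => (g i).val) x, J0 ε n α α (fun i => ((g i)⁻¹).val) x,
    by
      rw [J0_mul, ← J0_one (n := n)]
      refine congrArg (fun z : H0 (QN n) α α => J0 ε n α α z x) ?_
      funext i
      exact (g i).mul_inv,
    by
      rw [J0_mul, ← J0_one (n := n)]
      refine congrArg (fun z : H0 (QN n) α α => J0 ε n α α z x) ?_
      funext i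
      exact (g i).inv_mul⟩

theorem Phi_invAct (g : (QN n).GLb α) (U : (QN n).Rep α) :
    Q.invAct (GJ ε n α g) (B.Phi U) = B.Phi ((QN n).invAct g U) := by
  have h0 : dl ((QN n).invAct g U) U (fun i => (g i).val) = 0 := by
    funext a
    refine (dl_apply _ _ _ _).trans (sub_eq_zero.2 ?_)
    change (g ((QN n).h a)).val * (((g ((QN n).h a))⁻¹).val * U a * (g ((QN n).t a)).val) = U a * (g ((QN n).t a)).val
    rw [Matrix.mul_assoc, ← Matrix.mul_assoc (g ((QN n).h a)).val]
    rw [Units.mul_inv, Matrix.one_mul]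
  have h1 := B.dl_J0 ((QN n).invAct g U) U (fun i => (g i).val)
  rw [h0, map_zero] at h1
  funext a
  have h2 := congrFun h1 a
  have h3 := sub_eq_zero.1 ((dl_apply _ _ _ _).symm.trans h2)
  change ((GJ ε n α g (Q.h a))⁻¹).val * B.Phi U a * (GJ ε n α g (Q.t a)).val = _
  have h4 : (GJ ε n α g (Q.h a)).val * B.Phi ((QN n).invAct g U) a = B.Phi U a * (GJ ε n α g (Q.t a)).val := h3
  rw [Matrix.mul_assoc, ← h4, ← Matrix.mul_assoc, Units.inv_mul, Matrix.one_mul]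

theorem detWeight_GJ (g : (QN n).GLb α) (σ : Q.V → ℤ) :
    Q.detWeight σ (GJ ε n α g) = (QN n).detWeight (fun i => ∑ x, σ x * ε i x) g := by
  unfold FinQuiver.detWeight
  have h1 : ∀ x, (GJ ε n α g x).val.det ^ σ x = ∏ i : Fin N, ((g i).val.det ^ (σ x * ε i x)) := by
    intro x
    change (J0 ε n α α (fun i => (g i).val) x).det ^ σ x = _
    rw [J0_det, ← Finset.prod_zpow]
    refine Finset.prod_congr rfl (fun i _ => ?_)
    rw [← zpow_natCast, ← zpow_mul, mul_comm]
  rw [Finset.prod_congr rfl (fun x _ => h1 x), Finset.prod_comm]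
  refine Finset.prod_congr rfl (fun i _ => ?_)
  have hne : (g i).val.det ≠ 0 := ((Matrix.isUnit_iff_isUnit_det _).1 (g i).isUnit).ne_zero
  have : ∀ s : Finset Q.V, ∏ x ∈ s, (g i).val.det ^ (σ x * ε i x) = (g i).val.det ^ ∑ x ∈ s, (σ x * ε i x) := by
    intro s
    induction s using Finset.induction_on with
    | empty => simp
    | insert a s ha ih => rw [Finset.prod_insert ha, Finset.sum_insert ha, ih, zpow_add₀ hne]
  exact this _

theorem res_mem {σ : Q.V → ℤ} {f : Q.Rep (Iv ε β) → ℂ} (hf : f ∈ Q.SIw (Iv ε β) σ) :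
    (fun U => f (B.Phi U)) ∈ (QN n).SIw β (fun i => ∑ x, σ x * ε i x) := by
  refine ⟨pf_comp (Q := QN n) (fun U => B.Phi U) B.pf_Phi hf.1, fun g U => ?_⟩
  change f (B.Phi ((QN n).invAct g U)) = _
  rw [← B.Phi_invAct, hf.2, detWeight_GJ]

theorem res_inj {σ : Q.V → ℤ} {f : Q.Rep (Iv ε β) → ℂ} (hf : f ∈ Q.SIw (Iv ε β) σ)
    (h0 : ∀ U, f (B.Phi U) = 0) : f = 0 := by
  refine density (B.Phi (Z0 n β)) (ι := C1 (QN n) β β) (B.J1 β β ∘ₗ (vec1 (QN n) β β).symm.toLinearMap) ?_ f hf.1 ?_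
  · intro ζ
    obtain ⟨X, u, h⟩ := B.subm ζ
    refine ⟨X, vec1 (QN n) β β u, ?_⟩
    rw [← h]
    rfl
  · intro g u
    have h1 : (fun a => B.Phi (Z0 n β) a + (B.J1 β β ∘ₗ (vec1 (QN n) β β).symm.toLinearMap) u a) =
        B.Phi ((vec1 (QN n) β β).symm u) := by
      funext a
      exact (B.Phi_eq _ a).symm
    refine (hf.2 g _).trans ?_
    refine (congrArg (fun z => Q.detWeight σ g * f z) h1).trans ?_
    exact (congrArg (fun z => Q.detWeight σ g * z) (h0 _)).trans (mul_zero _)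

end BD
end EmbThm


namespace EmbThm
open Finset
variable {Q : FinQuiver}

theorem exists_compl {X Y : Type*} [AddCommGroup X] [Module ℂ X] [AddCommGroup Y] [Module ℂ Y]
    [FiniteDimensional ℂ Y] (f : X →ₗ[ℂ] Y) (k : ℕ)
    (hk : k + Module.finrank ℂ (LinearMap.range f) = Module.finrank ℂ Y) :
    ∃ ξ : Fin k → Y, (∀ ζ, ∃ φ, ∃ η : Fin k → ℂ, f φ + ∑ r, η r • ξ r = ζ) ∧
      (∀ φ, ∀ η : Fin k → ℂ, f φ + ∑ r, η r • ξ r = 0 → f φ = 0 ∧ η = 0) := by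
  obtain ⟨C, hC⟩ := Submodule.exists_isCompl (LinearMap.range f)
  have hd := Submodule.finrank_add_eq_of_isCompl hC
  have hCk : Module.finrank ℂ C = k := by omega
  let b := Module.finBasisOfFinrankEq ℂ C hCk
  refine ⟨fun r => (b r : Y), fun ζ => ?_, fun φ η h => ?_⟩
  · have : ζ ∈ LinearMap.range f ⊔ C := by rw [hC.sup_eq_top]; trivial
    obtain ⟨_, ⟨φ, rfl⟩, y, hy, rfl⟩ := Submodule.mem_sup.1 this
    refine ⟨φ, fun r => b.repr ⟨y, hy⟩ r, ?_⟩
    congr 1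
    have := congrArg Subtype.val (b.sum_repr ⟨y, hy⟩)
    rw [AddSubmonoidClass.coe_finsetSum] at this
    exact this
  · have e : ∑ r, η r • (b r : Y) = ((∑ r, η r • b r : C) : Y) := by simp
    rw [e] at h
    have hm : f φ ∈ LinearMap.range f ⊓ C := by
      refine ⟨⟨φ, rfl⟩, ?_⟩
      rw [eq_neg_of_add_eq_zero_left h]
      exact C.neg_mem (Subtype.mem _)
    rw [hC.inf_eq_bot, Submodule.mem_bot] at hm
    refine ⟨hm, ?_⟩
    rw [hm, zero_add] at h
    have h' : ∑ r, η r • b r = 0 := Subtype.ext h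
    funext r
    exact Fintype.linearIndependent_iff.1 b.linearIndependent η h' r

abbrev nn {N : ℕ} (ε : Fin N → Q.V → ℕ) (i j : Fin N) : ℕ :=
  if i = j then 0 else (-(Q.euler (natToInt (ε i)) (natToInt (ε j)))).toNat

theorem exists_BD (hac : Q.Acyclic) {N : ℕ} (ε : Fin N → Q.V → ℕ) (hE : Q.IsExcSeq ε) :
    Nonempty (BD Q ε (nn ε)) ∧ (∀ i j, Q.euler (natToInt (ε i)) (natToInt (ε j)) =
      (if i = j then 1 else 0) - (nn ε i j : ℤ)) := by
  obtain ⟨h1, h2⟩ := hE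
  choose he E hS using h1
  have hs : ∀ i, Function.Surjective (dl (E i) (E i)) := fun i => schur_surj _ (hS i) (he i)
  have hend := fun i => (schur_end (E i) (hS i)).1
  have hx := fun i => (schur_end (E i) (hS i)).2
  choose x0 hx0 using hx
  have hb : ∀ i j, j < i → Function.Bijective (dl (E i) (E j)) ∧ Q.euler (natToInt (ε i)) (natToInt (ε j)) = 0 :=
    fun i j hij => circ_bij hac (h2 j i hij).2 (E i) (E j) (hs i) (hs j)
  have hi : ∀ i j, i < j → Function.Injective (dl (E i) (E j)) := fun i j hij =>
    hom_zero (E i) (E j) (hs i) (hs j) (hend i) (hend j) (hb j i hij).1.2 (h2 i j hij).1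
  have hn : ∀ i j, j ≤ i → nn ε i j = 0 := by
    intro i j hij
    rcases hij.eq_or_lt with rfl | h
    · simp [nn]
    · simp [nn, (hb i j h).2]
  have hdim : ∀ i j, nn ε i j + Module.finrank ℂ (LinearMap.range (dl (E i) (E j))) =
      Module.finrank ℂ (H1 Q (ε i) (ε j)) := by
    intro i j
    rcases lt_trichotomy i j with h | rfl | h
    · have hr := dl_rank (E i) (E j)
      rw [LinearMap.ker_eq_bot.2 (hi i j h), finrank_bot] at hr
      have hle := (h2 i j h).1
      have : nn ε i j = (-(Q.euler (natToInt (ε i)) (natToInt (ε j)))).toNat := if_neg h.ne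
      omega
    · rw [hn i i le_rfl, LinearMap.range_eq_top.2 (hs i), finrank_top, zero_add]
    · rw [hn i j h.le, LinearMap.range_eq_top.2 (hb i j h).1.2, finrank_top, zero_add]
  choose ξ hξ1 hξ2 using fun i j => exists_compl (dl (E i) (E j)) (nn ε i j) (hdim i j)
  have hinj : ∀ i j, i ≠ j → Function.Injective (dl (E i) (E j)) := by
    intro i j hij
    rcases lt_or_gt_of_ne hij with h | h
    · exact hi i j h
    · exact (hb i j h).1.1
  refine ⟨⟨{ E := E, ξ := ξ, hn := hn, surj := hξ1, inj := ?_, x0 := x0, y0 := fun i => ⟨0, hx0 i⟩, injd := ?_ }⟩, ?_⟩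
  · intro i j φ η hij h
    obtain ⟨a, b⟩ := hξ2 i j φ η h
    exact ⟨(injective_iff_map_eq_zero _).1 (hinj i j hij) φ a, b⟩
  · intro i φ h0 hφ
    obtain ⟨c, hc⟩ := hend i φ h0
    have hc0 : c = 0 := by
      rw [hc (x0 i)] at hφ
      simpa using hφ
    funext x
    refine (hc x).trans ?_
    rw [hc0]
    exact zero_smul ℂ _
  · intro i j
    rcases lt_trichotomy i j with h | rfl | h
    · have hle := (h2 i j h).1
      have : nn ε i j = (-(Q.euler (natToInt (ε i)) (natToInt (ε j)))).toNat := if_neg h.ne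
      rw [if_neg h.ne]
      omega
    · rw [hn i i le_rfl, he i]; simp
    · rw [hn i j h.le, if_neg h.ne', (hb i j h).2]; simp

theorem sum_weight (γ δ : Q.V → ℕ) :
    ∑ x, Q.weightOf γ x * δ x = Q.euler (natToInt γ) (natToInt δ) := by
  unfold FinQuiver.weightOf FinQuiver.euler natToInt
  simp only [sub_mul, Finset.sum_sub_distrib, Finset.sum_mul]
  congr 1
  rw [Finset.sum_comm]
  refine Finset.sum_congr rfl (fun a _ => ?_)
  simp [ite_mul]

theorem euler_Iv {N : ℕ} (ε : Fin N → Q.V → ℕ) (α : Fin N → ℕ) (δ : Q.V → ℕ) :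
    Q.euler (natToInt (Iv ε α)) (natToInt δ) = ∑ j, (α j : ℤ) * Q.euler (natToInt (ε j)) (natToInt δ) := by
  unfold FinQuiver.euler natToInt
  simp only [Nat.cast_sum, Nat.cast_mul, mul_sub, Finset.sum_sub_distrib, Finset.sum_mul, Finset.mul_sum]
  congr 1
  · rw [Finset.sum_comm]
    simp only [mul_assoc]
  · rw [Finset.sum_comm]
    simp only [mul_assoc]

theorem weight_QN {N : ℕ} (n : Fin N → Fin N → ℕ) (α : Fin N → ℕ) (i : Fin N) :
    (QN n).weightOf α i = ∑ j, (α j : ℤ) * ((if j = i then 1 else 0) - (n j i : ℤ)) := by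
  simp only [mul_sub, Finset.sum_sub_distrib, mul_ite, mul_one, mul_zero, Finset.sum_ite_eq', Finset.mem_univ, if_true]
  unfold FinQuiver.weightOf
  refine congrArg (fun z => (α i : ℤ) - z) ?_
  refine (Fintype.sum_sigma _).trans (Finset.sum_congr rfl (fun j _ => ?_))
  refine (Fintype.sum_sigma _).trans ?_
  rw [Finset.sum_eq_single i]
  · simp [mul_comm]
  · intro k _ hk
    refine Finset.sum_eq_zero (fun r _ => if_neg hk)
  · simp

theorem weight_main {N : ℕ} (ε : Fin N → Q.V → ℕ) (n : Fin N → Fin N → ℕ)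
    (he : ∀ i j, Q.euler (natToInt (ε i)) (natToInt (ε j)) = (if i = j then 1 else 0) - (n i j : ℤ))
    (α : Fin N → ℕ) :
    (fun i => ∑ x, Q.weightOf (Iv ε α) x * ε i x) = (QN n).weightOf α := by
  funext i
  refine (sum_weight _ _).trans ((euler_Iv ε α (ε i)).trans (Eq.trans ?_ (weight_QN n α i).symm))
  simp only [he]

theorem main {N : ℕ} (ε : Fin N → Q.V → ℕ) (n : Fin N → Fin N → ℕ) (B : BD Q ε n)
    (he : ∀ i j, Q.euler (natToInt (ε i)) (natToInt (ε j)) = (if i = j then 1 else 0) - (n i j : ℤ))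
    (α β : Fin N → ℕ) : (QN n).circ α β = Q.circ (Iv ε α) (Iv ε β) := by
  have hw := weight_main ε n he α
  have hm : ∀ f : Q.Rep (Iv ε β) → ℂ, f ∈ Q.SIw (Iv ε β) (Q.weightOf (Iv ε α)) →
      (fun U => f (B.Phi U)) ∈ (QN n).SIw β ((QN n).weightOf α) := by
    intro f hf
    have := B.res_mem hf
    rw [hw] at this
    exact this
  let r : Q.SIw (Iv ε β) (Q.weightOf (Iv ε α)) →ₗ[ℂ] (QN n).SIw β ((QN n).weightOf α) :=
    { toFun := fun f => ⟨fun U => f.1 (B.Phi U), hm f.1 f.2⟩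
      map_add' := fun _ _ => rfl
      map_smul' := fun _ _ => rfl }
  have hinj : Function.Injective r := by
    rw [injective_iff_map_eq_zero]
    intro f hf
    apply Subtype.ext
    exact B.res_inj f.2 (fun U => congrFun (congrArg Subtype.val hf) U)
  have hsurj : Function.Surjective r := by
    intro f
    by_cases h0 : f.1 = 0
    · exact ⟨0, by rw [map_zero]; exact (Subtype.ext h0).symm⟩
    obtain ⟨e1⟩ := exists_e0 f.2 h0
    have hcard : Fintype.card (C1 Q (Iv ε α) (Iv ε β)) = Fintype.card (C0 Q (Iv ε α) (Iv ε β)) := by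
      have c1 := card_C (Q := QN n) α β
      have c2 := card_C (Iv ε α) (Iv ε β)
      rw [Fintype.card_congr e1, sub_self] at c1
      have c3 : ∑ x, Q.weightOf (Iv ε α) x * ((Iv ε β x : ℕ) : ℤ) = ∑ i : Fin N, (QN n).weightOf α i * (β i : ℤ) := by
        rw [← hw]
        simp only [Nat.cast_sum, Nat.cast_mul, Finset.mul_sum, Finset.sum_mul]
        rw [Finset.sum_comm]
        refine Finset.sum_congr rfl (fun i _ => Finset.sum_congr rfl (fun x _ => ?_))
        ring
      have c4 : (0 : ℤ) = ∑ i : Fin N, (QN n).weightOf α i * (β i : ℤ) := c1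
      rw [c3, ← c4] at c2
      omega
    have e0 := Fintype.equivOfCardEq hcard
    have hrk : ∀ a : (QN n).A, ((QN n).t a : Fin N).val < ((QN n).h a : Fin N).val := by
      rintro ⟨i, j, q⟩
      by_contra hle
      have h0 : n i j = 0 := B.hn i j (by simpa using hle)
      have := q.2
      omega
    have hsp := span_cV (Q := QN n) (fun i : Fin N => i.val) hrk f.2 e1
    have hle : Submodule.span ℂ (Set.range fun V : (QN n).Rep α => fun W : (QN n).Rep β => cV e1 V W) ≤
        (LinearMap.range r).map ((QN n).SIw β ((QN n).weightOf α)).subtype := by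
      rw [Submodule.span_le]
      rintro _ ⟨U, rfl⟩
      obtain ⟨c, hc, h⟩ := B.cV_Phi e0 e1 U
      refine ⟨r (c⁻¹ • ⟨fun W => cV e0 (B.Phi U) W, cV_mem e0 (B.Phi U)⟩), ⟨_, rfl⟩, ?_⟩
      funext U'
      change c⁻¹ * cV e0 (B.Phi U) (B.Phi U') = cV e1 U U'
      rw [h, ← mul_assoc, inv_mul_cancel₀ hc, one_mul]
    obtain ⟨g, ⟨g', rfl⟩, hg⟩ := hle hsp
    exact ⟨g', Subtype.ext hg⟩
  exact (LinearEquiv.ofBijective r ⟨hinj, hsurj⟩).finrank_eq.symm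

theorem emb (hac : Q.Acyclic) {N : ℕ} (ε : Fin N → Q.V → ℕ) (hE : Q.IsExcSeq ε) (α β : Fin N → ℕ) :
    (Q.quiverOfSeq ε).circ α β =
      Q.circ (fun x => ∑ i : Fin N, α i * ε i x) (fun x => ∑ i : Fin N, β i * ε i x) := by
  obtain ⟨⟨B⟩, he⟩ := exists_BD hac ε hE
  exact main ε (nn ε) B he α β

end EmbThm

/-- the Embedding Theorem for quiver semi-invariants. If
`ℰ = (ε₁,…,ε_N)` is a quiver exceptional sequence for `Q` and `α, β` are dimension
vectors of `Q(ℰ)`, then `(α∘β)_{Q(ℰ)} = (I(α)∘I(β))_Q` where `I(γ) = Σᵢ γᵢ εᵢ`. -/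
theorem embedding_theorem
    (Q : FinQuiver) (hconn : Q.Connected) (hacyc : Q.Acyclic)
    {Nn : ℕ} (ε : Fin Nn → (Q.V → ℕ)) (hE : Q.IsExcSeq ε)
    (α β : Fin Nn → ℕ) :
    (Q.quiverOfSeq ε).circ α β =
      Q.circ (fun x => ∑ i : Fin Nn, α i * ε i x) (fun x => ∑ i : Fin Nn, β i * ε i x) := by
  exact EmbThm.emb hacyc ε hE α β
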